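/- Let d ≥ 1 be an integer, p > max{1, 2d/(d+2)}, and let q, m be reals with 0 ≤ q < σ − 1 and q < m < σ, where σ = ((p−1)d + p)/(d − p) if p < d and σ = +∞ if p ≥ d; set θ = pd(m−q)/((m+1)(d(p−q−1) + p(q+1))). Suppose u_c : [0,∞) → ℝ is continuously differentiable, nonnegative, nonincreasing, with u_c'(0) = 0, lim_{r→∞} u_c(r) = 0 and ∫_0^∞ r^{d−1} u_c(r)^{q+1} dr < ∞, and that either (a) u_c(r) > 0 for all r ≥ 0 and the function r ↦ r^{d−1}|u_c'(r)|^{p−2}u_c'(r) is differentiable on (0,∞) with derivative r^{d−1}(u_c(r)^q − u_c(r)^m), or (b) there is R > 0 with u_c > 0 on [0,R), u_c ≡ 0 on [R,∞), u_c'(R) = 0, and the same differential relation holds on (0,R). Set M_c = ∫_{ℝ^d} u_c(‖x‖)^{q+1} dx and C = θ^{−θ/p} (1−θ)^{θ/p − 1/(m+1)} M_c^{−θ/d}. Then for every continuously differentiable u : ℝ^d → ℝ with ∫|u|^{q+1} dx < ∞ and ∫‖∇u(x)‖^p dx < ∞, one has (∫_{ℝ^d}|u|^{m+1} dx)^{1/(m+1)}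 ≤ C · (∫_{ℝ^d}|u|^{q+1} dx)^{(1−θ)/(q+1)} · (∫_{ℝ^d}‖∇u(x)‖^p dx)^{θ/p}; and equality holds whenever u(x) = A · u_c(λ‖x − x₀‖) for some A > 0, λ > 0 and x₀ ∈ ℝ^d. -/

import Mathlib

open Filter Set Topology MeasureTheory

namespace GN
variable {d : ℕ} {p q m : ℝ} {v g v1 g1 v2 g2 : ℝ → ℝ}
local notation "Ka" => measurableSet_Ioi
local notation "Kb" => Real.rpow_nonneg
local notation "Kc" => Real.norm_of_nonneg
local notation "Kd" => Real.zero_rpow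
local notation "Ke" => measurableSet_Ioc
local notation "Kf" => lt_of_le_of_ne
local notation "Kg" => Real.mul_rpow
local notation "Kh" => indicator_of_mem
local notation "Ki" => ENNReal.ofReal_le_ofReal
local notation "Kj" => ENNReal.ofReal_mul
local notation "Kl" => ofReal_integral_eq_lintegral_ofReal
local notation "Kn" => lt_of_lt_of_le
local notation "Ko" => Real.rpow_le_rpow
local notation "Kp" => intervalIntegrable_iff_integrableOn_Ioc_of_le
local notation "Kq" => mul_le_mul_of_nonneg_left
local notation "Kr" => Real.rpow_add
local notation "Ks" => Real.rpow_mul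
local notation "Kt" => div_mul_eq_mul_div
local notation "Ku" => Real.rpow_one
local notation "Kv" => intervalIntegral.integral_of_le
local notation "Kw" => ae_restrict_mem
local notation "Kx" => le_of_lt
local notation "Ky" => lintegral_const_mul'
local notation "Kz" => indicator_of_notMem
local notation "La" => mul_nonneg
local notation "Lb" => min_le_right
local notation "Lc" => tendsto_one_div_add_atTop_nhds_zero_nat
local notation "Ld" => mul_le_mul'
local notation "Le" => mem_ofPred_eq
local notation "Lf" => le_max_left
local notation "Lg" => ENNReal.ofReal_le_ofReal_iff
local notation "Lh" => lt_mem_nhds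
local notation "Li" => setLIntegral_mono'
local notation "Lj" => le_rfl
local notation "Lk" => measurableSet_lt
local notation "Ll" => Real.exp
local notation "Lm" => nhdsWithin_le_nhds
local notation "Ln" => self_mem_nhdsWithin
local notation "Lo" => integral_eq_zero_iff_of_nonneg_ae
local notation "Lp" => Integrable.mono'
local notation "Lq" => min_le_left
local notation "Lr" => eventually_ge_atTop
local notation "Ls" => ENNReal.mul_rpow_of_nonneg
local notation "Lt" => lintegral_indicator_one
local notation "Lu" => pow_le_pow_left₀
local notation "Lv" => Metric.ball
local notation "Lw" => lt_div_iff₀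
local notation "Lx" => Real.hasDerivAt_rpow_const
local notation "Ly" => zero_le_one
local notation "Lz" => one_pos
local notation "Mb" => volume.restrict
local notation "Md" => mul_nonpos_of_nonneg_of_nonpos
local notation "Me" => mul_le_mul_of_nonneg_right
local notation "Mf" => integrable_indicator_iff
local notation "Mg" => intervalIntegral.integral_hasDerivAt_right
local notation "Mh" => continuous_id.pow
local notation "Mi" => lintegral_const_mul
local notation "Mj" => one_ne_zero
local notation "Mk" => Real.norm_eq_abs
local notation "Ml" => tendsto_const_nhds.congr'
local notation "Mm" => le_trans
local notation "Mn" => mul_zero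
local notation "Mo" => le_max_right
local notation "Mp" => eventually_gt_atTop
local notation "Mq" => measurable_one.indicator
local notation "Mr" => ENNReal.ofReal_add
local notation "Ms" => le_div_iff₀
local notation "Mt" => div_le_iff₀
local notation "Mu" => lt_of_le_of_lt
local notation "Mv" => measurable_const
local notation "Mw" => abs_nonneg
local notation "Mx" => mul_assoc
local notation "Mz" => le_or_gt
local notation "Na" => abs_of_pos
local notation "Nb" => integral_congr_ae
local notation "Nd" => ENNReal.rpow_le_rpow
local notation "LA" => (by linarith)
local notation "PO" => (by positivity)
local notation "dX" => (d:ℝ)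
local notation "mJ" => (m+1)
local notation "qJ" => (q+1)
local notation "dJ" => (d-1)
local notation "pJ" => (p-1)
local notation "oR" => ENNReal.ofReal
local notation "EE" => EuclideanSpace ℝ (Fin d)

structure Par (d : ℕ) (p q m : ℝ) : Prop where
  hd : 1 ≤ d
  hp : 1 < p
  hq : 0 ≤ q
  hqm : q < m
  hs1 : (m+1)*((d:ℝ)-p) < p*d
  hs2 : (q+2)*((d:ℝ)-p) < p*d

local notation "PA" => Par d p q m

lemma par_of (d : ℕ) (hd : 1 ≤ d) (p q m : ℝ)
    (hp : max 1 (2 * (d : ℝ) / ((d : ℝ) + 2)) < p)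
    (hq0 : 0 ≤ q) (hqm : q < m)
    (hsub : p < d → q < ((p - 1) * (d : ℝ) + p) / ((d : ℝ) - p) - 1 ∧
      m < ((p - 1) * (d : ℝ) + p) / ((d : ℝ) - p)) : Par d p q m := by
  have h1 : 1 < p := Mu (Lf _ _) hp
  have hpd : 0 < p * d := by positivity
  refine ⟨hd, h1, hq0, hqm, ?_, ?_⟩
  · rcases lt_or_ge p d with h | h
    · have h2 := (hsub h).2
      rw [Lw LA] at h2
      nlinarith
    · have : (m+1)*((d:ℝ)-p) ≤ 0 := Md LA LA
      linarith
  · rcases lt_or_ge p d with h | h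
    · have h2 := (hsub h).1
      rw [lt_sub_iff_add_lt, Lw LA] at h2
      nlinarith
    · have : (q+2)*((d:ℝ)-p) ≤ 0 := Md LA LA
      linarith

noncomputable def fN (q m u : ℝ) : ℝ := u ^ m - u ^ q

noncomputable def FN (q m u : ℝ) : ℝ := u ^ (m+1) / (m+1) - u ^ (q+1) / (q+1)

lemma quad_pos (hq : 0 ≤ q) (hqm : q < m) {κ : ℝ} (h1 : κ * mJ < 1) (h2 : κ * (q+2) < 1)
    {y : ℝ} (hy : 0 < y) (hy1 : y ≠ 1) :
    0 < (1-κ)*(y-1)^2 - (m*y-q)*(y/mJ - 1/qJ) := by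
  have hM : 0 < m + 1 := by linarith
  have hQ2 : 0 < q + 2 := by linarith
  have hy2 : 0 < (y-1)^2 := by
    positivity
  rcases Mz 1 (m-q) with hk | hk
  · have key : 0 ≤ (1-1/mJ)*(y-1)^2 - (m*y-q)*(y/mJ - 1/qJ) := by
      have : (1-1/mJ)*(y-1)^2 - (m*y-q)*(y/mJ - 1/qJ) =
          ((m-q)*(m-q-1)*y + (m - q)) / (mJ*qJ) := by
        field_simp; ring
      rw [this]
      apply div_nonneg _ PO
      have : 0 ≤ (m-q)*(m-q-1)*y := by
        apply La (La _ _) hy.le <;> linarith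
      linarith
    have : κ < 1/mJ := by rw [Lw hM]; exact h1
    nlinarith
  · have key : 0 ≤ (1-1/(q+2))*(y-1)^2 - (m*y-q)*(y/mJ - 1/qJ) := by
      have e : (1-1/(q+2))*(y-1)^2 - (m*y-q)*(y/mJ - 1/qJ) =
          (qJ*(1-(m-q))*y^2 + (mJ*qJ*(q+2) *(2/(q+2)-2+m/qJ+q/mJ))*y + mJ)/(mJ*qJ*(q+2)) := by
        field_simp; ring
      rw [e]
      apply div_nonneg _ PO
      have e2 : (mJ*qJ*(q+2) *(2/(q+2)-2+m/qJ+q/mJ)) =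
        2*mJ*qJ -2*mJ*qJ*(q+2)+m*mJ*(q+2) + q*qJ*(q+2) := by
        field_simp
      rw [e2]
      obtain ⟨k, rfl⟩ : ∃ k, m = q + k := ⟨m-q, by ring⟩
      obtain ⟨Q, rfl⟩ : ∃ Q, q = Q - 1 := ⟨q+1, by ring⟩
      have hk0 : 0 < k := by linarith
      have hk1 : 0 < 1 - k := by linarith
      have hQ' : 1 ≤ Q := by linarith
      have lin : 2*(Q-1+k+1)*(Q-1+1) -2*(Q-1+k+1)*(Q-1+1)*(Q-1+2)+(Q-1+k)*(Q-1+k+1)*(Q-1+2) + (Q-1)*(Q-1+1)*(Q-1+2)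
        = -(1-k)*(k*(Q+1)+2*Q) := by ring
      rw [lin]

      have disc : (1-k)*(k*(Q+1)+2*Q)^2 ≤ 4*Q*(Q+k) := by
        have h3 : 0 ≤ 4*Q*(Q+1) - (1-k)*(Q+1)^2 := by nlinarith [mul_pos hk0 (by positivity : 0 < (Q+1)^2)]
        nlinarith [La (sq_nonneg k) h3]
      have h4 : 0 ≤ 4*Q*(Q*(1-k)*y^2 + -(1-k)*(k*(Q+1)+2*Q)*y + (Q+k)) := by
        have : 4*Q*(Q*(1-k)*y^2 + -(1-k)*(k*(Q+1)+2*Q)*y + (Q+k)) =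
          (1-k)*(2*Q*y - (k*(Q+1)+2*Q))^2 + (4*Q*(Q+k) - (1-k)*(k*(Q+1)+2*Q)^2) := by ring
        rw [this]
        have := La hk1.le (sq_nonneg (2*Q*y - (k*(Q+1)+2*Q)))
        linarith
      have h5 : 0 < 4*Q := by linarith
      have := nonneg_of_mul_nonneg_right h4 h5
      have e3 : (Q - 1 + 1) * (1 - (Q - 1 + k - (Q - 1))) = Q*(1-k) := by ring
      rw [e3]; linarith
    have : κ < 1/(q+2) := by rw [Lw hQ2]; exact h2
    nlinarith

lemma fN_hasDeriv {u : ℝ} (hu : 0 < u) :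
    HasDerivAt (fN q m) (m*u^(m-1) - q*u^(q-1)) u := by
  unfold fN
  exact (Lx (Or.inl hu.ne')).sub (Lx (Or.inl hu.ne'))

lemma FN_hasDeriv (hq : 0 ≤ q) (hqm : q < m) {u : ℝ} (hu : 0 ≤ u) :
    HasDerivAt (FN q m) (fN q m u) u := by
  unfold FN fN
  have h1 := (Real.hasDerivAt_rpow_const (x := u) (p := m+1) (Or.inr LA)).div_const mJ
  have h2 := (Real.hasDerivAt_rpow_const (x := u) (p := q+1) (Or.inr LA)).div_const qJ
  refine (h1.sub h2).congr_deriv ?_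
  rw [add_sub_cancel_right, add_sub_cancel_right, mul_div_cancel_left₀ _ LA, mul_div_cancel_left₀ _ LA]

lemma FN_zero (hq : 0 ≤ q) (hqm : q < m) : FN q m 0 = 0 := by
  unfold FN
  rw [Kd LA, Kd LA]; simp

lemma fN_eq {u : ℝ} (hu : 0 < u) : fN q m u = u^q*(u^(m-q) - 1) := by
  unfold fN; rw [mul_sub, ← Kr hu]; ring_nf

lemma FN_eq {u : ℝ} (hu : 0 < u) :
    FN q m u = u^qJ*(u^(m-q)/mJ - 1/qJ) := by
  unfold FN; rw [mul_sub, ← mul_div_assoc, ← Kr hu]; ring_nf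

lemma fN_pos (hqm : q < m) {u : ℝ} (hu : 1 < u) : 0 < fN q m u := by
  unfold fN; linarith [Real.rpow_lt_rpow_of_exponent_lt hu hqm]

lemma fN_neg (hqm : q < m) {u : ℝ} (hu : 0 < u) (hu1 : u < 1) : fN q m u < 0 := by
  unfold fN; linarith [Real.rpow_lt_rpow_of_exponent_gt hu hu1 hqm]

lemma FN_neg (hq : 0 ≤ q) (hqm : q < m) {u : ℝ} (hu : 0 < u) (hu1 : u ≤ 1) : FN q m u < 0 := by
  rw [FN_eq hu]
  apply mul_neg_of_pos_of_neg PO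
  have h1 : u^(m-q) ≤ 1 := Real.rpow_le_one hu.le hu1 LA
  have h2 : u^(m-q)/mJ ≤ 1/mJ := by gcongr; linarith
  have h3 : 1/mJ < 1/qJ := by
    apply one_div_lt_one_div_of_lt <;> linarith
  linarith

lemma one_lt_of_FN (hq : 0 ≤ q) (hqm : q < m) {u : ℝ} (hu : 0 < u) (h : 0 ≤ FN q m u) : 1 < u := by
  by_contra hc
  exact absurd (FN_neg hq hqm hu (not_lt.1 hc)) (not_lt.2 h)

lemma FN_le_mul (hq : 0 ≤ q) (hqm : q < m) {u : ℝ} (hu : 0 < u) :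
    FN q m u ≤ u/mJ * fN q m u := by
  rw [FN_eq hu, fN_eq hu, Kr hu, Ku]
  have h0 : 0 < u^q*u := by positivity
  have h3 : 1/mJ ≤ 1/qJ := by
    apply one_div_le_one_div_of_le <;> linarith
  have := Kq h3 h0.le
  have e : u / mJ * (u ^ q * (u ^ (m - q) - 1)) = (u^q*u)*(u^(m-q)/mJ) - (u^q*u)*(1/mJ) := by ring
  rw [e]; linarith

lemma K_pos (P : PA) {u : ℝ} (hu : 0 < u) (hu1 : u ≠ 1) :
    (dX-p)/(d*p) < (fN q m u * fN q m u - FN q m u * (m*u^(m-1) - q*u^(q-1))) / (fN q m u)^2 := by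
  have hd0 : (0:ℝ) < d := by exact_mod_cast P.hd
  have hp := P.hp
  have hf : fN q m u ≠ 0 := by
    rcases lt_or_gt_of_ne hu1 with h | h
    · exact (fN_neg P.hqm hu h).ne
    · exact (fN_pos P.hqm h).ne'
  have hf2 : 0 < (fN q m u)^2 := by positivity
  rw [Lw hf2]
  set κ := (dX-p)/(d*p) with hκ
  have hdp : 0 < dX*p := by positivity
  have h1 : κ * mJ < 1 := by
    rw [hκ, Kt, div_lt_one hdp]; linarith [P.hs1]
  have h2 : κ * (q+2) < 1 := by
    rw [hκ, Kt, div_lt_one hdp]; linarith [P.hs2]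
  set y := u^(m-q) with hy
  have hy0 : 0 < y := by positivity
  have hy1 : y ≠ 1 := by
    rcases lt_or_gt_of_ne hu1 with h | h
    · exact (Real.rpow_lt_one hu.le h (by linarith [P.hqm])).ne
    · exact (Real.one_lt_rpow h (by linarith [P.hqm])).ne'
  have key := quad_pos P.hq P.hqm h1 h2 hy0 hy1
  have e1 : fN q m u = u^q*(y-1) := fN_eq hu
  have e2 : FN q m u = u^q*u*(y/mJ-1/qJ) := by
    rw [FN_eq hu, Kr hu, Ku]
  have e3 : u * (m*u^(m-1) - q*u^(q-1)) = u^q*(m*y-q) := by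
    have a1 : u^m = u^q*y := by rw [hy, ← Kr hu]; ring_nf
    have a2 : u*u^(m-1) = u^m := by
      nth_rewrite 1 [← Ku u]; rw [← Kr hu]; ring_nf
    have a3 : u*u^(q-1) = u^q := by
      nth_rewrite 1 [← Ku u]; rw [← Kr hu]; ring_nf
    calc _ = m*(u*u^(m-1)) - q*(u*u^(q-1)) := by ring
      _ = _ := by rw [a2, a3, a1]; ring
  have e4 : FN q m u * (m*u^(m-1) - q*u^(q-1)) = (u^q)^2*((y/mJ-1/qJ)*(m*y-q)) := by
    rw [e2]
    calc _ = u^q*(y/mJ-1/qJ)*(u * (m*u^(m-1) - q*u^(q-1))) := by ring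
      _ = _ := by rw [e3]; ring
  rw [e4, e1]
  have : 0 < (u^q)^2 := by positivity
  nlinarith

lemma anti_of {f f' : ℝ → ℝ} {a b : ℝ} (hab : a ≤ b) (h : ∀ x ∈ Icc a b, HasDerivAt f (f' x) x)
    (h' : ∀ x ∈ Icc a b, f' x ≤ 0) : f b ≤ f a := by
  have : AntitoneOn f (Icc a b) := by
    apply antitoneOn_of_deriv_nonpos (convex_Icc a b)
    · exact fun x hx => (h x hx).continuousAt.continuousWithinAt
    · intro x hx; rw [interior_Icc] at hx
      exact (h x ⟨hx.1.le, hx.2.le⟩).differentiableAt.differentiableWithinAt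
    · intro x hx; rw [interior_Icc] at hx
      rw [(h x ⟨hx.1.le, hx.2.le⟩).deriv]; exact h' x ⟨hx.1.le, hx.2.le⟩
  exact this (left_mem_Icc.2 hab) (right_mem_Icc.2 hab) hab

lemma mono_of {f f' : ℝ → ℝ} {a b : ℝ} (hab : a ≤ b) (h : ∀ x ∈ Icc a b, HasDerivAt f (f' x) x)
    (h' : ∀ x ∈ Icc a b, 0 ≤ f' x) : f a ≤ f b := by
  have := anti_of (f := fun x => - f x) (f' := fun x => - f' x) hab (fun x hx => (h x hx).neg)
    (fun x hx => by simpa using h' x hx)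
  simpa using this

lemma smono_of {f f' : ℝ → ℝ} {a b : ℝ} (hab : a < b) (h : ∀ x ∈ Icc a b, HasDerivAt f (f' x) x)
    (h' : ∀ x ∈ Icc a b, 0 < f' x) : f a < f b := by
  have : StrictMonoOn f (Icc a b) := by
    apply strictMonoOn_of_deriv_pos (convex_Icc a b)
    · exact fun x hx => (h x hx).continuousAt.continuousWithinAt
    · intro x hx; rw [interior_Icc] at hx
      rw [(h x ⟨hx.1.le, hx.2.le⟩).deriv]; exact h' x ⟨hx.1.le, hx.2.le⟩
  exact this (left_mem_Icc.2 hab.le) (right_mem_Icc.2 hab.le) hab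

noncomputable def Nn (d : ℕ) (p : ℝ) (g : ℝ → ℝ) (r : ℝ) : ℝ := r^(d-1) * g r^(p-1)

noncomputable def En (p q m : ℝ) (v g : ℝ → ℝ) (r : ℝ) : ℝ := (p-1)/p * g r^p + FN q m (v r)

structure GS (d : ℕ) (p q m : ℝ) (v g : ℝ → ℝ) : Prop where
  hv : ∀ r, 0 < r → HasDerivAt v (-(g r)) r
  hg : ∀ r, 0 < r → 0 ≤ g r
  hv0 : ∀ r, 0 < r → 0 ≤ v r
  gc : ContinuousOn g (Ioi 0)
  lim : Tendsto v atTop (𝓝 0)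
  pos : ∃ r, 0 < r ∧ 0 < v r
  ode : ∀ r, 0 < r → 0 < v r → HasDerivAt (Nn d p g) (r^(d-1) * fN q m (v r)) r
  N0 : Tendsto (Nn d p g) (𝓝[>] 0) (𝓝 0)
  iG : IntegrableOn (fun r => r^(d-1) * g r^p) (Ioi 0)
  iM : IntegrableOn (fun r => r^(d-1) * v r^(q+1)) (Ioi 0)
  iI : IntegrableOn (fun r => r^(d-1) * v r^(m+1)) (Ioi 0)

local notation "GV" => GS d p q m

namespace GS

lemma anti (S : GV v g) {a b : ℝ} (ha : 0 < a) (hab : a ≤ b) : v b ≤ v a := by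
  apply anti_of hab (f' := fun r => -(g r))
  · exact fun x hx => S.hv x (ha.trans_le hx.1)
  · intro x hx; simpa using S.hg x (ha.trans_le hx.1)

lemma pos_left (S : GV v g) {a b : ℝ} (ha : 0 < a) (hab : a ≤ b) (hb : 0 < v b) : 0 < v a :=
  hb.trans_le (S.anti ha hab)

lemma hasDeriv_gp1 (P : PA) (S : GV v g) {r : ℝ} (hr : 0 < r) (hv : 0 < v r) :
    HasDerivAt (fun s => g s^pJ) (fN q m (v r) - dJ/r * g r^pJ) r := by
  have h1 := S.ode r hr hv
  have h2 : HasDerivAt (fun s : ℝ => s^dJ) ((d-1:ℕ)*r^(d-1-1)) r := hasDerivAt_pow dJ r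
  have hr1 : r^dJ ≠ 0 := by positivity
  have h3 := h1.div h2 hr1
  refine HasDerivAt.congr_deriv (h3.congr_of_eventuallyEq ?_) ?_
  · filter_upwards [Lh hr] with s hs
    simp only [Nn, Pi.div_apply]; field_simp
  have e : ((d-1:ℕ):ℝ) = dX - 1 := by rw [Nat.cast_sub P.hd]; simp
  rw [e]
  rcases Nat.lt_or_ge dJ 1 with h | h
  · have : d = 1 := by have := P.hd; omega
    subst this
    simp [Nn]
  · have e2 : r^dJ = r^(d-1-1)*r := by rw [← pow_succ]; congr 1; omega
    unfold Nn
    rw [e2]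
    field_simp

lemma hasDeriv_gp (P : PA) (S : GV v g) {r : ℝ} (hr : 0 < r) (hv : 0 < v r) :
    HasDerivAt (fun s => g s^p) (p/pJ * g r * (fN q m (v r) - dJ/r * g r^pJ)) r := by
  have hp := P.hp
  have hp1 : p - 1 ≠ 0 := by linarith
  have h := (S.hasDeriv_gp1 P hr hv).rpow_const (p := p/pJ) (Or.inr (by
    rw [Ms LA]; linarith))
  refine HasDerivAt.congr_deriv (h.congr_of_eventuallyEq ?_) ?_
  · filter_upwards [Lh hr] with s hs
    rw [← Ks (S.hg s hs)]; congr 1; field_simp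
  rw [← Ks (S.hg r hr)]
  have : pJ*(p/pJ - 1) = 1 := by field_simp; ring
  rw [this, Ku]; ring

lemma gmul (P : PA) (S : GV v g) {r : ℝ} (hr : 0 < r) : g r * g r^pJ = g r^p := by
  have hp := P.hp
  rcases (S.hg r hr).eq_or_lt with h | h
  · rw [← h, Kd LA, Kd LA]; simp
  · nth_rewrite 1 [← Ku (g r)]; rw [← Kr h]; ring_nf

lemma hasDeriv_F (P : PA) (S : GV v g) {r : ℝ} (hr : 0 < r) :
    HasDerivAt (fun s => FN q m (v s)) (fN q m (v r) * (-(g r))) r :=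
  (FN_hasDeriv P.hq P.hqm (S.hv0 r hr)).comp r (S.hv r hr)

lemma hasDeriv_E (P : PA) (S : GV v g) {r : ℝ} (hr : 0 < r) (hv : 0 < v r) :
    HasDerivAt (En p q m v g) (-(dJ/r * g r^p)) r := by
  have hp := P.hp
  have h := ((S.hasDeriv_gp P hr hv).const_mul (pJ/p)).add (S.hasDeriv_F P hr)
  refine h.congr_deriv ?_
  rw [← S.gmul P hr]
  have : p - 1 ≠ 0 := by linarith
  field_simp; ring

lemma E_anti (P : PA) (S : GV v g) {a b : ℝ} (ha : 0 < a) (hab : a ≤ b)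
    (hb : 0 < v b) : En p q m v g b ≤ En p q m v g a := by
  apply anti_of hab (f' := fun r => -(dJ/r * g r^p))
  · exact fun x hx => S.hasDeriv_E P (ha.trans_le hx.1) (S.pos_left (ha.trans_le hx.1) hx.2 hb)
  · intro x hx
    have hx0 := ha.trans_le hx.1
    have := Kb (S.hg x hx0) p
    have h1 : (1:ℝ) ≤ d := by exact_mod_cast P.hd
    have : 0 ≤ dJ/x * g x^p := La (div_nonneg LA hx0.le) this
    linarith

lemma exists_val (S : GV v g) {a ε : ℝ} (ha : 0 < a) (hε : 0 < ε) (h : ε < v a) :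
    ∃ r, a < r ∧ v r = ε := by
  obtain ⟨b, hb, hb'⟩ := ((S.lim.eventually (gt_mem_nhds hε)).and (Mp a)).exists
  have hc : ContinuousOn v (Icc a b) := fun x hx =>
    (S.hv x (ha.trans_le hx.1)).continuousAt.continuousWithinAt
  obtain ⟨r, hr, hr'⟩ := intermediate_value_Icc' hb'.le hc ⟨hb.le, h.le⟩
  refine ⟨r, Kf hr.1 ?_, hr'⟩
  rintro rfl; linarith

lemma E_nonneg (P : PA) (S : GV v g) {r : ℝ} (hr : 0 < r) (hv : 0 < v r) :
    0 ≤ En p q m v g r := by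
  have hF : Tendsto (FN q m) (𝓝[>] 0) (𝓝 0) := by
    have := (FN_hasDeriv P.hq P.hqm Lj).continuousAt.tendsto
    rw [FN_zero P.hq P.hqm] at this
    exact this.mono_left Lm
  refine le_of_tendsto hF ?_
  filter_upwards [Ioo_mem_nhdsGT hv] with ε hε
  obtain ⟨s, hs, hs'⟩ := S.exists_val hr hε.1 hε.2
  have h1 := S.E_anti P hr hs.le (by rw [hs']; exact hε.1)
  refine Mm ?_ h1
  unfold En
  rw [hs']
  have hp := P.hp
  have := Kb (S.hg s (hr.trans hs)) p
  have : 0 ≤ pJ/p * g s^p := La (div_nonneg LA LA) this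
  linarith

lemma N_nonneg (S : GV v g) {r : ℝ} (hr : 0 < r) : 0 ≤ Nn d p g r :=
  La PO (Kb (S.hg r hr) _)

lemma g_pos (P : PA) (S : GV v g) {r : ℝ} (hr : 0 < r) (hv : 0 < v r) : 0 < g r := by
  have hp := P.hp
  refine Kf (S.hg r hr) fun h => ?_
  have hE := S.E_nonneg P hr hv
  unfold En at hE
  rw [← h, Kd LA] at hE
  have h1 := one_lt_of_FN P.hq P.hqm hv LA
  have h2 := fN_pos P.hqm h1
  have hmin : IsLocalMin (Nn d p g) r := by
    filter_upwards [Lh hr] with s hs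
    have : Nn d p g r = 0 := by unfold Nn; rw [← h, Kd LA]; simp
    rw [this]; exact S.N_nonneg hs
  have h3 := hmin.hasDerivAt_eq_zero (S.ode r hr hv)
  have : 0 < r^dJ*fN q m (v r) := by positivity
  linarith

lemma g_zero (S : GV v g) {r : ℝ} (hr : 0 < r) (hv : v r = 0) : g r = 0 := by
  have hmin : IsLocalMin v r := by
    filter_upwards [Lh hr] with s hs
    rw [hv]; exact S.hv0 s hs
  have := hmin.hasDerivAt_eq_zero (S.hv r hr)
  linarith

lemma E_cont (P : PA) (S : GV v g) {r : ℝ} (hr : 0 < r) :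
    ContinuousAt (En p q m v g) r := by
  have h1 : ContinuousAt g r := S.gc.continuousAt (Ioi_mem_nhds hr)
  have h2 := (S.hasDeriv_F P hr).continuousAt
  have h3 : ContinuousAt (fun s => g s^p) r := h1.rpow_const (Or.inr (by linarith [P.hp]))
  exact (h3.const_mul _).add h2

lemma L3 (P : PA) (S : GV v g) {r0 ε : ℝ} (hr0 : 0 < r0) (hv0 : 0 < v r0) (hε : 0 < ε) :
    ∃ r, r0 < r ∧ 0 < v r ∧ r^d * En p q m v g r < ε := by
  have hp := P.hp
  by_contra! hc
  by_cases hz : ∃ r, r0 < r ∧ v r = 0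
  · obtain ⟨b, hb, hb0⟩ := hz
    set Z := {r | r0 ≤ r ∧ v r = 0} with hZ
    have hne : Z.Nonempty := ⟨b, hb.le, hb0⟩
    have hbd : BddBelow Z := ⟨r0, fun x hx => hx.1⟩
    have hcl : IsClosed Z := by
      have hc : ContinuousOn v (Ici r0) := fun x hx =>
        (S.hv x (hr0.trans_le hx)).continuousAt.continuousWithinAt
      have := hc.preimage_isClosed_of_isClosed isClosed_Ici (isClosed_singleton (x := (0:ℝ)))
      exact this
    have hR := hcl.csInf_mem hne hbd
    set R := sInf Z
    have hr0R : r0 < R := by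
      refine Kf hR.1 ?_
      intro h; rw [h, hR.2] at hv0; exact lt_irrefl _ hv0
    have hR0 := hr0.trans hr0R
    have hER : En p q m v g R = 0 := by
      unfold En; rw [S.g_zero hR0 hR.2, hR.2, FN_zero P.hq P.hqm, Kd LA]; simp
    have ht : Tendsto (fun r => r^d * En p q m v g r) (𝓝[<] R) (𝓝 (R^d * En p q m v g R)) :=
      (((continuousAt_id.pow d).mul (S.E_cont P hR0)).tendsto).mono_left Lm
    rw [hER, Mn] at ht
    obtain ⟨r, h1, h2⟩ := ((ht.eventually (gt_mem_nhds hε)).and (Ioo_mem_nhdsLT hr0R)).exists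
    have hvr : 0 < v r := by
      refine Kf (S.hv0 r (hr0.trans h2.1)) fun h => ?_
      exact absurd (csInf_le hbd ⟨h2.1.le, h.symm⟩) (not_le.2 h2.2)
    exact absurd (hc r h2.1 hvr) (not_le.2 h1)
  · push Not at hz
    have hI : IntegrableOn (fun r => r^dJ * g r^p + r^dJ * v r^mJ) (Ioi r0) :=
      (S.iG.add S.iI).mono_set (Ioi_subset_Ioi hr0.le)
    have : IntegrableOn (fun r : ℝ => ε * r⁻¹) (Ioi r0) := by
      refine Lp hI (by fun_prop) ?_
      refine (Kw Ka).mono fun r hr => ?_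
      have hr' : r0 < r := hr
      have hr1 : 0 < r := hr0.trans hr
      have hvr : 0 < v r := Kf (S.hv0 r hr1) (hz r hr').symm
      have h1 := hc r hr' hvr
      rw [Kc PO]
      have e : r^d = r^dJ*r := by rw [← pow_succ]; congr 1; have := P.hd; omega
      rw [e] at h1
      have h2 : ε * r⁻¹ ≤ r^dJ * En p q m v g r := by
        rw [← div_eq_mul_inv, Mt hr1]; linarith
      refine h2.trans ?_
      rw [← mul_add]
      apply Kq _ PO
      unfold En FN
      have hg := Kb (S.hg r hr1) p
      have a1 : pJ/p * g r^p ≤ 1 * g r^p := by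
        apply Me _ hg
        rw [div_le_one LA]; linarith
      have a2 : v r^mJ/mJ ≤ v r^mJ := by
        apply div_le_self (Kb hvr.le _); linarith [P.hq, P.hqm]
      have a3 : 0 ≤ v r^qJ/qJ := by
        apply div_nonneg (Kb hvr.le _); linarith [P.hq]
      linarith
    have h2 : IntegrableOn (fun r : ℝ => r⁻¹) (Ioi r0) := by
      have := this.const_mul ε⁻¹
      refine this.congr ?_
      filter_upwards with r
      field_simp
    exact not_integrableOn_Ioi_inv h2

end GS

lemma exists_prim {h : ℝ → ℝ} (hi : IntegrableOn h (Ioi 0)) (hc : ContinuousOn h (Ioi 0)) :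
    ∃ H : ℝ → ℝ, Continuous H ∧ H 0 = 0 ∧ (∀ t, 0 < t → HasDerivAt H (h t) t) ∧
      Tendsto H atTop (𝓝 (∫ t in Ioi 0, h t)) := by
  have hI : Integrable ((Ioi 0).indicator h) := (Mf Ka).2 hi
  refine ⟨fun t => ∫ x in (0:ℝ)..t, (Ioi 0).indicator h x, hI.continuous_primitive 0, by simp, ?_, ?_⟩
  · intro t ht
    have hev : (Ioi 0).indicator h =ᶠ[𝓝 t] h := by
      filter_upwards [Lh ht] with s hs
      exact Kh hs h
    have hca : ContinuousAt ((Ioi 0).indicator h) t :=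
      (hc.continuousAt (Ioi_mem_nhds ht)).congr hev.symm
    have := Mg (hI.intervalIntegrable (a := 0) (b := t))
      hI.aestronglyMeasurable.stronglyMeasurableAtFilter hca
    rwa [hev.self_of_nhds] at this
  · have := intervalIntegral_tendsto_integral_Ioi 0 hI.integrableOn tendsto_id
    rwa [setIntegral_congr_fun Ka (fun x hx => Kh hx h)] at this

namespace GS

lemma gp_cont (P : PA) (S : GV v g) :
    ContinuousOn (fun r => r^dJ * g r^p) (Ioi 0) :=
  (continuousOn_id.pow _).mul (S.gc.rpow_const (fun _ _ => Or.inr (by linarith [P.hp])))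

lemma N_mono (S : GV v g) (P : PA) {a b : ℝ} (ha : 0 < a) (hab : a ≤ b) (hb : 1 < v b) :
    Nn d p g a ≤ Nn d p g b := by
  have h1 : ∀ x ∈ Icc a b, 1 < v x := fun x hx => hb.trans_le (S.anti (ha.trans_le hx.1) hx.2)
  apply mono_of hab (fun x hx => S.ode x (ha.trans_le hx.1) (by linarith [h1 x hx]))
  intro x hx
  have := fN_pos P.hqm (h1 x hx)
  have := ha.trans_le hx.1
  positivity

lemma Nv_small (P : PA) (S : GV v g) {r ε : ℝ} (hr : 0 < r) (hv : 1 < v r) (hε : 0 < ε) :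
    ∃ s, 0 < s ∧ s < r ∧ Nn d p g s * v s < ε := by
  obtain ⟨H, Hc, H0, Hd, -⟩ := exists_prim S.iG (S.gp_cont P)
  have h1 : Tendsto H (𝓝[>] 0) (𝓝 0) := by
    have := Hc.tendsto 0; rw [H0] at this; exact this.mono_left Lm
  obtain ⟨t, ht1, ht2⟩ := ((h1.eventually (gt_mem_nhds (half_pos hε))).and (Ioo_mem_nhdsGT hr)).exists
  have hvt : 1 < v t := hv.trans_le (S.anti ht2.1 ht2.2.le)
  have h2 : Tendsto (fun s => Nn d p g s * v t) (𝓝[>] 0) (𝓝 (0 * v t)) := S.N0.mul_const _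
  rw [zero_mul] at h2
  obtain ⟨s, hs1, hs2⟩ := ((h2.eventually (gt_mem_nhds (half_pos hε))).and (Ioo_mem_nhdsGT ht2.1)).exists
  refine ⟨s, hs2.1, hs2.2.trans ht2.2, ?_⟩
  have key : Nn d p g s * (v s - v t) - H t ≤ Nn d p g s * (v s - v s) - H s := by
    apply anti_of (f := fun τ => Nn d p g s * (v s - v τ) - H τ)
      (f' := fun τ => Nn d p g s * (0 - -(g τ)) - τ^dJ * g τ^p) hs2.2.le
    · intro x hx
      have hx0 := hs2.1.trans_le hx.1
      exact (((hasDerivAt_const x (v s)).sub (S.hv x hx0)).const_mul _).sub (Hd x hx0)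
    · intro x hx
      have hx0 := hs2.1.trans_le hx.1
      have := S.N_mono P hs2.1 hx.1 (hvt.trans_le (S.anti hx0 hx.2))
      rw [← S.gmul P hx0]
      have h3 := Me this (S.hg x hx0)
      unfold Nn at h3 ⊢
      nlinarith
  have hHs : 0 ≤ H s := by
    have : H 0 ≤ H s := by
      have hm : MonotoneOn H (Icc 0 s) := by
        apply monotoneOn_of_deriv_nonneg (convex_Icc 0 s) Hc.continuousOn
        · intro x hx; rw [interior_Icc] at hx
          exact (Hd x hx.1).differentiableAt.differentiableWithinAt
        · intro x hx; rw [interior_Icc] at hx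
          rw [(Hd x hx.1).deriv]
          have := Kb (S.hg x hx.1) p
          have := hx.1
          positivity
      exact hm (left_mem_Icc.2 hs2.1.le) (right_mem_Icc.2 hs2.1.le) hs2.1.le
    linarith
  nlinarith

noncomputable def Pn (d : ℕ) (p q m : ℝ) (v g : ℝ → ℝ) (r : ℝ) : ℝ :=
  r^d * En p q m v g r - d * Nn d p g r * (FN q m (v r) / fN q m (v r))

lemma fN_ne (hqm : q < m) {u : ℝ} (hu : 0 < u) (hu1 : u ≠ 1) : fN q m u ≠ 0 := by
  rcases lt_or_gt_of_ne hu1 with h | h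
  · exact (fN_neg hqm hu h).ne
  · exact (fN_pos hqm h).ne'

lemma pow_d (P : PA) (r : ℝ) : r^d = r^dJ*r := by
  rw [← pow_succ]; congr 1; have := P.hd; omega

lemma hasDeriv_rE (P : PA) (S : GV v g) {r : ℝ} (hr : 0 < r) (hv : 0 < v r) :
    HasDerivAt (fun s => s^d * En p q m v g s)
      (d * r^dJ * En p q m v g r - dJ * r^dJ * g r^p) r := by
  have h := (hasDerivAt_pow d r).mul (S.hasDeriv_E P hr hv)
  refine h.congr_deriv ?_
  rw [pow_d P]; field_simp; ring

lemma hasDeriv_P (P : PA) (S : GV v g) {r : ℝ} (hr : 0 < r) (hv : 0 < v r) (hv1 : v r ≠ 1) :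
    HasDerivAt (Pn d p q m v g)
      (d * r^dJ * g r^p * ((fN q m (v r) * fN q m (v r) - FN q m (v r) * (m*(v r)^(m-1) - q*(v r)^(q-1))) / (fN q m (v r))^2 - (dX-p)/(d*p))) r := by
  have hf := fN_ne P.hqm hv hv1
  have h1 := S.hasDeriv_rE P hr hv
  have h2 := ((FN_hasDeriv P.hq P.hqm hv.le).div (fN_hasDeriv hv) hf).comp r (S.hv r hr)
  have h3 := h1.sub (((S.ode r hr hv).const_mul dX).mul h2)
  refine h3.congr_deriv ?_
  have hd0 : dX ≠ 0 := by have := P.hd; positivity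
  have hp0 : p ≠ 0 := by linarith [P.hp]
  simp only [Function.comp, Pi.div_apply]
  unfold En Nn
  rw [← S.gmul P hr]
  field_simp
  ring

lemma P_deriv_pos (P : PA) (S : GV v g) {r : ℝ} (hr : 0 < r) (hv : 0 < v r) (hv1 : v r ≠ 1) :
   0 < (d * r^dJ * g r^p * ((fN q m (v r) * fN q m (v r) - FN q m (v r) * (m*(v r)^(m-1) - q*(v r)^(q-1))) / (fN q m (v r))^2 - (dX-p)/(d*p))) := by
  have h1 := K_pos P hv hv1
  have h2 := S.g_pos P hr hv
  have hd0 : (0:ℝ) < d := by exact_mod_cast P.hd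
  apply mul_pos PO LA

lemma P_le (P : PA) (S : GV v g) {r : ℝ} (hr : 0 < r) (hv : 0 < v r) (hv1 : v r < 1) :
    Pn d p q m v g r ≤ 0 := by
  refine le_of_forall_pos_lt_add fun ε hε => ?_
  obtain ⟨s, hs1, hs2, hs3⟩ := S.L3 P hr hv hε
  have h1 : Pn d p q m v g r ≤ Pn d p q m v g s := by
    have hh : ∀ x ∈ Icc r s, 0 < v x ∧ v x < 1 := fun x hx =>
      ⟨S.pos_left (hr.trans_le hx.1) hx.2 hs2, (S.anti hr hx.1).trans_lt hv1⟩
    apply mono_of hs1.le (fun x hx => S.hasDeriv_P P (hr.trans_le hx.1) (hh x hx).1 (hh x hx).2.ne)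
    exact fun x hx => (S.P_deriv_pos P (hr.trans_le hx.1) (hh x hx).1 (hh x hx).2.ne).le
  have h2 : Pn d p q m v g s ≤ s^d * En p q m v g s := by
    unfold Pn
    have hv1' : v s < 1 := (S.anti hr hs1.le).trans_lt hv1
    have : 0 ≤ FN q m (v s) / fN q m (v s) :=
      div_nonneg_of_nonpos (FN_neg P.hq P.hqm hs2 hv1'.le).le (fN_neg P.hqm hs2 hv1').le
    have h4 := S.N_nonneg (hr.trans hs1)
    have : 0 ≤ d * Nn d p g s * (FN q m (v s) / fN q m (v s)) := by positivity
    linarith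
  linarith

lemma P_ge (P : PA) (S : GV v g) {r : ℝ} (hr : 0 < r) (hv1 : 1 < v r) :
    0 ≤ Pn d p q m v g r := by
  refine le_of_forall_pos_lt_add fun ε hε => ?_
  have hd0 : (0:ℝ) < d := by exact_mod_cast P.hd
  have hm1 : 0 < m + 1 := by linarith [P.hq, P.hqm]
  obtain ⟨s, hs0, hs1, hs3⟩ := S.Nv_small P hr hv1 (ε := ε*mJ/d) PO
  have h1 : Pn d p q m v g s ≤ Pn d p q m v g r := by
    have hh : ∀ x ∈ Icc s r, 1 < v x := fun x hx =>
      hv1.trans_le (S.anti (hs0.trans_le hx.1) hx.2)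
    apply mono_of hs1.le (fun x hx => S.hasDeriv_P P (hs0.trans_le hx.1) (zero_lt_one.trans (hh x hx)) (hh x hx).ne')
    exact fun x hx => (S.P_deriv_pos P (hs0.trans_le hx.1) (zero_lt_one.trans (hh x hx)) (hh x hx).ne').le
  have hvs : 1 < v s := hv1.trans_le (S.anti hs0 hs1.le)
  have h2 : -ε < Pn d p q m v g s := by
    unfold Pn
    have hE := S.E_nonneg P hs0 LA
    have h3 : FN q m (v s) / fN q m (v s) ≤ v s/mJ := by
      rw [Mt (fN_pos P.hqm hvs)]; exact FN_le_mul P.hq P.hqm LA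
    have h4 := S.N_nonneg hs0
    have h5 : d * Nn d p g s * (FN q m (v s) / fN q m (v s)) ≤ d * Nn d p g s * (v s/mJ) :=
      Kq h3 PO
    have h6 : d * Nn d p g s * (v s/mJ) < ε := by
      rw [Lw hd0] at hs3
      rw [← mul_div_assoc, div_lt_iff₀ hm1]; linarith
    have : 0 ≤ s^d * En p q m v g s := by positivity
    linarith
  linarith

lemma P_pos (P : PA) (S : GV v g) {r : ℝ} (hr : 0 < r) (hv1 : 1 < v r) :
    0 < Pn d p q m v g r := by
  have hs0 : 0 < r/2 := by positivity
  have hs1 : r/2 < r := by linarith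
  have hh : ∀ x ∈ Icc (r/2) r, 1 < v x := fun x hx =>
      hv1.trans_le (S.anti (hs0.trans_le hx.1) hx.2)
  have h1 := S.P_ge P hs0 (hh _ (left_mem_Icc.2 hs1.le))
  refine h1.trans_lt ?_
  apply smono_of hs1 (fun x hx => S.hasDeriv_P P (hs0.trans_le hx.1) (zero_lt_one.trans (hh x hx)) (hh x hx).ne')
  exact fun x hx => (S.P_deriv_pos P (hs0.trans_le hx.1) (zero_lt_one.trans (hh x hx)) (hh x hx).ne')

lemma Q_nonneg (P : PA) (S : GV v g) {r : ℝ} (hr : 0 < r) (hv : 0 < v r) :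
    0 ≤ fN q m (v r) * (r^d * En p q m v g r) - d * FN q m (v r) * Nn d p g r := by
  rcases lt_trichotomy (v r) 1 with h | h | h
  · have h1 := S.P_le P hr hv h
    have h2 := fN_neg P.hqm hv h
    have : fN q m (v r) * (r^d * En p q m v g r) - d * FN q m (v r) * Nn d p g r = fN q m (v r) * Pn d p q m v g r := by
      unfold Pn; have := h2.ne; field_simp
    rw [this]; exact mul_nonneg_of_nonpos_of_nonpos h2.le h1
  · have h1 := FN_neg P.hq P.hqm hv h.le
    have h2 : fN q m (v r) = 0 := by rw [h]; simp [fN]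
    have h3 := S.N_nonneg hr
    have h4 : (0:ℝ) ≤ d := by positivity
    rw [h2]
    have := La (La h4 (neg_nonneg.2 h1.le)) h3
    nlinarith
  · have h1 := S.P_ge P hr h
    have h2 := fN_pos P.hqm h
    have : fN q m (v r) * (r^d * En p q m v g r) - d * FN q m (v r) * Nn d p g r = fN q m (v r) * Pn d p q m v g r := by
      unfold Pn; have := h2.ne'; field_simp
    rw [this]; exact La h2.le h1

lemma santi (P : PA) (S : GV v g) {a b : ℝ} (ha : 0 < a) (hab : a < b) (hb : 0 < v b) :
    v b < v a := by
  have := smono_of (f := fun x => - v x) hab (fun x hx => (S.hv x (ha.trans_le hx.1)).neg)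
    (fun x hx => by
      simpa using S.g_pos P (ha.trans_le hx.1) (S.pos_left (ha.trans_le hx.1) hx.2 hb))
  simpa using this

lemma exists_inv (P : PA) (S : GV v g) : ∃ ρ : ℝ → ℝ,
    (∀ u, 0 < u → (∃ r, 0 < r ∧ u < v r) → 0 < ρ u ∧ v (ρ u) = u ∧ HasDerivAt ρ (-(g (ρ u)))⁻¹ u) ∧
    (∀ r, 0 < r → 0 < v r → ρ (v r) = r) := by
  have h : ∀ u, ∃ r, 0 < u → (∃ r, 0 < r ∧ u < v r) → 0 < r ∧ v r = u := by
    intro u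
    by_cases hu : 0 < u ∧ ∃ r, 0 < r ∧ u < v r
    · obtain ⟨h1, r, h2, h3⟩ := hu
      obtain ⟨s, hs, hs'⟩ := S.exists_val h2 h1 h3
      exact ⟨s, fun _ _ => ⟨h2.trans hs, hs'⟩⟩
    · exact ⟨0, fun h1 h2 => absurd ⟨h1, h2⟩ hu⟩
  choose ρ hρ using h
  have hinj : ∀ r, 0 < r → 0 < v r → ρ (v r) = r := by
    intro r hr hvr
    have h1 : ∃ s, 0 < s ∧ v r < v s := ⟨r/2, by positivity, S.santi P PO LA hvr⟩
    obtain ⟨h2, h3⟩ := hρ (v r) hvr h1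
    rcases lt_trichotomy (ρ (v r)) r with h | h | h
    · have := S.santi P h2 h hvr; linarith
    · exact h
    · have := S.santi P hr h LA; linarith
  refine ⟨ρ, ?_, hinj⟩
  intro u hu hu'
  obtain ⟨h1, h2⟩ := hρ u hu hu'
  have hvpos : 0 < v (ρ u) := by rw [h2]; exact hu
  refine ⟨h1, h2, ?_⟩
  have hopen : ∀ᶠ y in 𝓝 u, 0 < y ∧ ∃ r, 0 < r ∧ y < v r := by
    obtain ⟨r, hr, hr'⟩ := hu'
    filter_upwards [Lh hu, gt_mem_nhds hr'] with y hy hy'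
    exact ⟨hy, r, hr, hy'⟩
  have hcont : ContinuousAt ρ u := by
    rw [ContinuousAt, tendsto_order]
    constructor
    · intro a ha
      have h3 : u < v (max a (ρ u/2)) := by
        refine lt_of_eq_of_lt h2.symm (S.santi P ?_ ?_ hvpos)
        · exact lt_max_of_lt_right PO
        · exact max_lt ha LA
      filter_upwards [gt_mem_nhds h3, hopen] with y hy hy'
      by_contra hc
      have := S.anti (hρ y hy'.1 hy'.2).1 ((not_lt.1 hc).trans (Lf a (ρ u/2)))
      rw [(hρ y hy'.1 hy'.2).2] at this; linarith
    · intro a ha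
      have h3 : v a < u := by
        by_cases h : 0 < v a
        · rw [← h2]; exact S.santi P h1 ha h
        · linarith
      filter_upwards [Lh h3, hopen] with y hy hy'
      by_contra hc
      have := S.anti (h1.trans ha) (not_lt.1 hc)
      rw [(hρ y hy'.1 hy'.2).2] at this; linarith
  refine HasDerivAt.of_local_left_inverse hcont (S.hv _ h1) ?_ ?_
  · exact neg_ne_zero.2 (S.g_pos P h1 hvpos).ne'
  · filter_upwards [hopen] with y hy
    exact (hρ y hy.1 hy.2).2

end GS

namespace GS

lemma le_lim (S : GV v g) {c : ℝ} (hc : Tendsto v (𝓝[>] 0) (𝓝 c)) {r : ℝ} (hr : 0 < r) :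
    v r ≤ c := by
  refine ge_of_tendsto hc ?_
  filter_upwards [Ioo_mem_nhdsGT hr] with s hs
  exact S.anti hs.1 hs.2.le

lemma c_pos (S : GV v g) {c : ℝ} (hc : Tendsto v (𝓝[>] 0) (𝓝 c)) : 0 < c := by
  obtain ⟨r, hr, hr'⟩ := S.pos
  exact hr'.trans_le (S.le_lim hc hr)

lemma v_ev_pos (S : GV v g) : ∀ᶠ r in 𝓝[>] (0:ℝ), 0 < r ∧ 0 < v r := by
  obtain ⟨r, hr, hr'⟩ := S.pos
  filter_upwards [Ioo_mem_nhdsGT hr] with s hs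
  exact ⟨hs.1, S.pos_left hs.1 hs.2.le hr'⟩

lemma N_asymp (P : PA) (S : GV v g) {c : ℝ} (hc : Tendsto v (𝓝[>] 0) (𝓝 c)) :
    Tendsto (fun r => Nn d p g r / r^d) (𝓝[>] 0) (𝓝 (fN q m c / d)) := by
  have hd0 : dX ≠ 0 := by have := P.hd; positivity
  refine HasDerivAt.lhopital_zero_nhdsGT (f' := fun r => r^dJ * fN q m (v r))
    (g' := fun r => d * r^dJ) ?_ ?_ ?_ S.N0 ?_ ?_
  · filter_upwards [S.v_ev_pos] with r hr
    exact S.ode r hr.1 hr.2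
  · filter_upwards with r
    exact hasDerivAt_pow d r
  · filter_upwards [Ln] with r (hr : 0 < r)
    have : r^dJ ≠ 0 := by positivity
    exact mul_ne_zero hd0 this
  · have : Tendsto (fun r : ℝ => r^d) (𝓝 0) (𝓝 (0^d)) := (continuous_pow d).tendsto 0
    rw [zero_pow (by have := P.hd; omega)] at this
    exact this.mono_left Lm
  · have h1 : Tendsto (fun r => fN q m (v r) / d) (𝓝[>] 0) (𝓝 (fN q m c / d)) :=
      ((fN_hasDeriv (S.c_pos hc)).continuousAt.tendsto.comp hc).div_const _
    refine h1.congr' ?_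
    filter_upwards [Ln] with r (hr : 0 < r)
    field_simp

lemma E_lim (P : PA) (S : GV v g) {c : ℝ} (hc : Tendsto v (𝓝[>] 0) (𝓝 c)) :
    Tendsto (En p q m v g) (𝓝[>] 0) (𝓝 (FN q m c)) := by
  have hp := P.hp
  have h1 : Tendsto (fun r => g r^pJ) (𝓝[>] 0) (𝓝 0) := by
    have h2 := (S.N_asymp P hc).mul (tendsto_id.mono_left Lm : Tendsto id (𝓝[>] (0:ℝ)) (𝓝 0))
    rw [Mn] at h2
    refine h2.congr' ?_
    filter_upwards [Ln] with r (hr : 0 < r)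
    simp only [id, Nn]
    rw [pow_d P]; field_simp
  have h2 : Tendsto (fun r => (g r^pJ)^(p/pJ)) (𝓝[>] 0) (𝓝 (0^(p/pJ))) := by
    apply h1.rpow_const
    right; exact div_nonneg LA LA
  have hpp : p/pJ ≠ 0 := by
    have : 0 < p/pJ := div_pos LA LA
    exact this.ne'
  rw [Kd hpp] at h2
  have h3 : Tendsto (fun r => g r^p) (𝓝[>] 0) (𝓝 0) := by
    refine h2.congr' ?_
    filter_upwards [Ln] with r (hr : 0 < r)
    have : p - 1 ≠ 0 := by linarith
    rw [← Ks (S.hg r hr)]; congr 1; field_simp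
  have h4 := (FN_hasDeriv P.hq P.hqm (S.c_pos hc).le).continuousAt.tendsto.comp hc
  have := (h3.const_mul (pJ/p)).add h4
  rwa [Mn, zero_add] at this

lemma comp_E (P : PA) (S : GV v g) {ρ : ℝ → ℝ} {u : ℝ} (h0 : 0 < ρ u) (hv : 0 < v (ρ u))
    (hρ : HasDerivAt ρ (-(g (ρ u)))⁻¹ u) :
    HasDerivAt (fun u => En p q m v g (ρ u)) (dJ/ρ u * g (ρ u)^pJ) u := by
  have h := (S.hasDeriv_E P h0 hv).comp u hρ
  refine h.congr_deriv ?_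
  have := S.g_pos P h0 hv
  rw [← S.gmul P h0]; field_simp

lemma comp_N (P : PA) (S : GV v g) {ρ : ℝ → ℝ} {u : ℝ} (h0 : 0 < ρ u) (hv : v (ρ u) = u)
    (hu : 0 < u) (hρ : HasDerivAt ρ (-(g (ρ u)))⁻¹ u) :
    HasDerivAt (fun u => Nn d p g (ρ u)) (-(fN q m u * Nn d p g (ρ u) / g (ρ u)^p)) u := by
  have hv' : 0 < v (ρ u) := by rw [hv]; exact hu
  have h := (S.ode _ h0 hv').comp u hρ
  refine h.congr_deriv ?_
  have := S.g_pos P h0 hv'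
  rw [← S.gmul P h0, hv]; unfold Nn; field_simp

lemma comp_A (P : PA) (S : GV v g) {ρ : ℝ → ℝ} {u : ℝ} (h0 : 0 < ρ u) (hv : v (ρ u) = u)
    (hu : 0 < u) (hρ : HasDerivAt ρ (-(g (ρ u)))⁻¹ u) :
    HasDerivAt (fun u => (ρ u)^d * En p q m v g (ρ u))
     ((dX-p)/p * Nn d p g (ρ u) - d * FN q m u * Nn d p g (ρ u) / g (ρ u)^p) u := by
  have hv' : 0 < v (ρ u) := by rw [hv]; exact hu
  have h := (S.hasDeriv_rE P h0 hv').comp u hρ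
  refine h.congr_deriv ?_
  have hp := P.hp
  have := S.g_pos P h0 hv'
  unfold Nn En
  rw [← S.gmul P h0, hv]; field_simp; ring

theorem L5 (P : PA) (S1 : GV v1 g1) (S2 : GV v2 g2) {c : ℝ}
    (hc : Tendsto v2 (𝓝[>] 0) (𝓝 c)) (h1 : ∃ r, 0 < r ∧ c < v1 r) : False := by
  have hp := P.hp
  have hd0 : (0:ℝ) < d := by exact_mod_cast P.hd
  have hc0 := S2.c_pos hc
  obtain ⟨ρ1, hρ1, hinj1⟩ := S1.exists_inv P
  obtain ⟨ρ2, hρ2, hinj2⟩ := S2.exists_inv P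
  have H1 : ∀ u, 0 < u → u ≤ c → 0 < ρ1 u ∧ v1 (ρ1 u) = u ∧ HasDerivAt ρ1 (-(g1 (ρ1 u)))⁻¹ u := by
    intro u hu huc
    obtain ⟨r, hr, hr'⟩ := h1
    exact hρ1 u hu ⟨r, hr, huc.trans_lt hr'⟩
  have H2 : ∀ u, 0 < u → u < c → 0 < ρ2 u ∧ v2 (ρ2 u) = u ∧ HasDerivAt ρ2 (-(g2 (ρ2 u)))⁻¹ u := by
    intro u hu huc
    obtain ⟨r, hr, hr'⟩ := ((hc.eventually (Lh huc)).and Ln).exists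
    exact hρ2 u hu ⟨r, hr', hr⟩
  have G1 : ∀ u, 0 < u → u ≤ c → 0 < g1 (ρ1 u) := fun u hu huc => by
    obtain ⟨a, b, -⟩ := H1 u hu huc
    exact S1.g_pos P a (by rw [b]; exact hu)
  have G2 : ∀ u, 0 < u → u < c → 0 < g2 (ρ2 u) := fun u hu huc => by
    obtain ⟨a, b, -⟩ := H2 u hu huc
    exact S2.g_pos P a (by rw [b]; exact hu)

  have hFc : 0 ≤ FN q m c := by
    refine ge_of_tendsto (S2.E_lim P hc) ?_
    filter_upwards [S2.v_ev_pos] with r hr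
    exact S2.E_nonneg P hr.1 hr.2
  have hc1 := one_lt_of_FN P.hq P.hqm hc0 hFc
  have hfc := fN_pos P.hqm hc1
  set E1 : ℝ → ℝ := fun u => En p q m v1 g1 (ρ1 u) with hE1
  set E2 : ℝ → ℝ := fun u => En p q m v2 g2 (ρ2 u) with hE2
  set N1 : ℝ → ℝ := fun u => Nn d p g1 (ρ1 u) with hN1
  set N2 : ℝ → ℝ := fun u => Nn d p g2 (ρ2 u) with hN2
  set A1 : ℝ → ℝ := fun u => (ρ1 u)^d * En p q m v1 g1 (ρ1 u) with hA1
  set A2 : ℝ → ℝ := fun u => (ρ2 u)^d * En p q m v2 g2 (ρ2 u) with hA2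
  have N1pos : ∀ u, 0 < u → u ≤ c → 0 < N1 u := fun u hu huc => by
    have a := (H1 u hu huc).1
    have b := G1 u hu huc
    simp only [hN1, Nn]; positivity
  have N2pos : ∀ u, 0 < u → u < c → 0 < N2 u := fun u hu huc => by
    have a := (H2 u hu huc).1
    have b := G2 u hu huc
    simp only [hN2, Nn]; positivity
  set X : ℝ → ℝ := fun u => A1 u - N1 u / N2 u * A2 u with hX
  set X' : ℝ → ℝ := fun u => - (N1 u / N2 u * ((g2 (ρ2 u)^p)⁻¹ - (g1 (ρ1 u)^p)⁻¹) *
    (fN q m u * A2 u - d * FN q m u * N2 u)) with hX'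
  have Xd : ∀ u, 0 < u → u < c → HasDerivAt X (X' u) u := by
    intro u hu huc
    obtain ⟨a1, a2, a3⟩ := H1 u hu huc.le
    obtain ⟨b1, b2, b3⟩ := H2 u hu huc
    have n1 := N1pos u hu huc.le
    have n2 := N2pos u hu huc
    have h := (S1.comp_A P a1 a2 hu a3).sub
      (((S1.comp_N P a1 a2 hu a3).div (S2.comp_N P b1 b2 hu b3) n2.ne').mul (S2.comp_A P b1 b2 hu b3))
    refine h.congr_deriv ?_
    have k1 : 0 < g1 (ρ1 u)^p := by have := G1 u hu huc.le; positivity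
    have k2 : 0 < g2 (ρ2 u)^p := by have := G2 u hu huc; positivity
    simp only [hX', Pi.div_apply]
    change _ = -(Nn d p g1 (ρ1 u) / Nn d p g2 (ρ2 u) * ((g2 (ρ2 u) ^ p)⁻¹ - (g1 (ρ1 u) ^ p)⁻¹) * (fN q m u * ((ρ2 u)^d * En p q m v2 g2 (ρ2 u)) - d * FN q m u * Nn d p g2 (ρ2 u)))
    have n2' : Nn d p g2 (ρ2 u) ≠ 0 := n2.ne'
    generalize Nn d p g1 (ρ1 u) = n1 at *
    generalize Nn d p g2 (ρ2 u) = n2 at *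
    generalize (g1 (ρ1 u) ^ p) = k1 at *
    generalize (g2 (ρ2 u) ^ p) = k2 at *
    generalize (ρ2 u)^d * En p q m v2 g2 (ρ2 u) = z
    field_simp
    ring

  have Esgn : ∀ u, 0 < u → u < c → E2 u ≤ E1 u → g2 (ρ2 u)^p ≤ g1 (ρ1 u)^p := by
    intro u hu huc h
    simp only [hE1, hE2, En] at h
    rw [(H1 u hu huc.le).2.1, (H2 u hu huc).2.1] at h
    have h3 : 0 < pJ/p := div_pos LA LA
    exact le_of_mul_le_mul_left LA h3
  have Xneg : ∀ u, 0 < u → u < c → E2 u ≤ E1 u → X' u ≤ 0 := by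
    intro u hu huc h
    have k2 : 0 < g2 (ρ2 u)^p := by have := G2 u hu huc; positivity
    have h4 := Esgn u hu huc h
    have h5 := inv_anti₀ k2 h4
    have n1 := N1pos u hu huc.le
    have n2 := N2pos u hu huc
    have hQ := S2.Q_nonneg P (H2 u hu huc).1 (by rw [(H2 u hu huc).2.1]; exact hu)
    rw [(H2 u hu huc).2.1] at hQ
    simp only [hX', neg_nonpos]
    exact La (La PO LA) hQ

  obtain ⟨u0, hu0, hu0c, hΔ0, hX0⟩ : ∃ u0, 0 < u0 ∧ u0 < c ∧ E2 u0 < E1 u0 ∧ 0 < X u0 := by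
    have hρc := H1 c hc0 Lj
    have hcont1 : Tendsto (fun r => ρ1 (v2 r)) (𝓝[>] 0) (𝓝 (ρ1 c)) :=
      hρc.2.2.continuousAt.tendsto.comp hc
    have e1 : ∀ᶠ r in 𝓝[>] 0, En p q m v2 g2 r < En p q m v1 g1 (ρ1 (v2 r)) := by
      have t1 := (S1.E_cont P hρc.1).tendsto.comp hcont1
      have t2 := S2.E_lim P hc
      refine t2.eventually_lt t1 ?_
      unfold En; rw [hρc.2.1]
      have := G1 c hc0 Lj
      have : 0 < pJ/p * g1 (ρ1 c)^p := mul_pos (div_pos LA LA) PO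
      linarith
    have e2 : ∀ᶠ r in 𝓝[>] 0, 0 < (ρ1 (v2 r))^d * En p q m v1 g1 (ρ1 (v2 r)) -
        Nn d p g1 (ρ1 (v2 r)) / Nn d p g2 r * (r^d * En p q m v2 g2 r) := by
      have t1 := ((continuousAt_id.pow d).mul (S1.E_cont P hρc.1)).tendsto.comp hcont1
      have hvc : 0 < v1 (ρ1 c) := by rw [hρc.2.1]; exact hc0
      have t2 := (S1.ode _ hρc.1 hvc).continuousAt.tendsto.comp hcont1
      have t3 := (S2.N_asymp P hc).inv₀ PO
      have t4 := t1.sub (t2.mul (t3.mul (S2.E_lim P hc)))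
      have hPp := S1.P_pos P hρc.1 (by rw [hρc.2.1]; exact hc1)
      unfold Pn at hPp
      rw [hρc.2.1] at hPp
      have h5 : 0 < ((id : ℝ → ℝ) ^ d * En p q m v1 g1) (ρ1 c) - Nn d p g1 (ρ1 c) * ((fN q m c / ↑d)⁻¹ * FN q m c) := by
        refine lt_of_lt_of_eq hPp ?_
        simp only [Pi.mul_apply, Pi.pow_apply, id]
        field_simp
      refine (t4.eventually (Lh h5)).mono fun r hr => ?_
      refine lt_of_lt_of_eq hr ?_
      simp only [Function.comp, Pi.mul_apply, Pi.pow_apply, id]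
      rw [inv_div]; ring
    obtain ⟨r, hr1, hr2, hr3, hr4⟩ := (e1.and (e2.and S2.v_ev_pos)).exists
    have hvr : v2 r < c := (S2.santi P (half_pos hr3) (half_lt_self hr3) hr4).trans_le (S2.le_lim hc (half_pos hr3))
    refine ⟨v2 r, hr4, hvr, ?_, ?_⟩
    · simp only [hE1, hE2]; rw [hinj2 r hr3 hr4]; exact hr1
    · simp only [hX, hA1, hA2, hN1, hN2]; rw [hinj2 r hr3 hr4]; exact hr2
  have Ed : ∀ u, 0 < u → u < c → HasDerivAt (fun u => E1 u - E2 u)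
      (dJ/ρ1 u * g1 (ρ1 u)^pJ - dJ/ρ2 u * g2 (ρ2 u)^pJ) u := by
    intro u hu huc
    obtain ⟨a1, a2, a3⟩ := H1 u hu huc.le
    obtain ⟨b1, b2, b3⟩ := H2 u hu huc
    exact (S1.comp_E P a1 (by rw [a2]; exact hu) a3).sub (S2.comp_E P b1 (by rw [b2]; exact hu) b3)
  have Xmono : ∀ u, 0 < u → u ≤ u0 → (∀ x ∈ Icc u u0, E2 x ≤ E1 x) → X u0 ≤ X u := by
    intro u hu huu h
    apply anti_of huu (fun x hx => Xd x (hu.trans_le hx.1) (hx.2.trans_lt hu0c))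
    exact fun x hx => Xneg x (hu.trans_le hx.1) (hx.2.trans_lt hu0c) (h x hx)

  have hΔ : ∀ u, 0 < u → u ≤ u0 → E2 u < E1 u := by
    by_contra! hcon
    obtain ⟨ub, hub, hub0, hubE⟩ := hcon
    set Z := {u | u ∈ Icc ub u0 ∧ E1 u - E2 u ≤ 0} with hZ
    have hcE : ContinuousOn (fun u => E1 u - E2 u) (Icc ub u0) := fun x hx =>
      (Ed x (hub.trans_le hx.1) (hx.2.trans_lt hu0c)).continuousAt.continuousWithinAt
    have hcl : IsClosed Z := hcE.preimage_isClosed_of_isClosed isClosed_Icc isClosed_Iic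
    have hne : Z.Nonempty := ⟨ub, ⟨Lj, hub0⟩, by linarith⟩
    have hbd : BddAbove Z := ⟨u0, fun x hx => hx.1.2⟩
    have hs := hcl.csSup_mem hne hbd
    set us := sSup Z with hus
    have hus0 : 0 < us := hub.trans_le hs.1.1
    have huslt : us < u0 := by
      refine Kf hs.1.2 fun h => ?_
      have := hs.2; rw [h] at this; linarith
    have husc := huslt.trans hu0c
    have hgt : ∀ x, us < x → x ≤ u0 → E2 x < E1 x := by
      intro x hx hx'
      by_contra hcc
      exact absurd (le_csSup hbd (show x ∈ Z from ⟨⟨hs.1.1.trans hx.le, hx'⟩, by linarith [not_lt.1 hcc]⟩)) (not_le.2 hx)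
    have hd1 := Ed us hus0 husc
    have hge : 0 ≤ E1 us - E2 us := by
      have t := hd1.continuousAt.tendsto.mono_left (nhdsWithin_le_nhds (s := Ioi us))
      refine ge_of_tendsto t ?_
      filter_upwards [Ioo_mem_nhdsGT huslt] with x hx
      linarith [hgt x hx.1 hx.2.le]
    have heq : E1 us = E2 us := by linarith [hs.2]
    have hXs : X u0 ≤ X us := by
      apply Xmono us hus0 huslt.le
      intro x hx
      rcases hx.1.eq_or_lt with h | h
      · rw [← h]; exact heq.ge
      · exact (hgt x h hx.2).le
    have hXpos := hX0.trans_le hXs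
    obtain ⟨a1, a2, a3⟩ := H1 us hus0 husc.le
    obtain ⟨b1, b2, b3⟩ := H2 us hus0 husc
    have gw1 := G1 us hus0 husc.le
    have gw2 := G2 us hus0 husc
    have hg : g1 (ρ1 us) = g2 (ρ2 us) := by
      have e := heq
      simp only [hE1, hE2, En] at e
      rw [a2, b2] at e
      have h3 : 0 < pJ/p := div_pos LA LA
      have e2 : g1 (ρ1 us)^p = g2 (ρ2 us)^p := mul_left_cancel₀ h3.ne' LA
      exact (Real.rpow_left_inj gw1.le gw2.le LA).1 e2
    have hEn : 0 ≤ E1 us := S1.E_nonneg P a1 (by rw [a2]; exact hus0)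
    have hXe : X us = E1 us * (ρ1 us)^dJ * (ρ1 us - ρ2 us) := by
      have e : En p q m v2 g2 (ρ2 us) = En p q m v1 g1 (ρ1 us) := heq.symm
      simp only [hX, hA1, hA2, hN1, hN2, Nn, hE1]
      rw [e, hg, pow_d P (ρ1 us), pow_d P (ρ2 us)]
      field_simp
    rw [hXe] at hXpos
    have hρlt : ρ2 us < ρ1 us := by
      by_contra hcc
      have : E1 us * (ρ1 us)^dJ * (ρ1 us - ρ2 us) ≤ 0 :=
        Md PO LA
      linarith
    have hEpos : 0 < E1 us := by
      refine Kf hEn fun h => ?_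
      rw [← h] at hXpos; simp at hXpos
    have hder : 0 ≤ dJ/ρ1 us * g1 (ρ1 us)^pJ - dJ/ρ2 us * g2 (ρ2 us)^pJ := by
      have t := hd1.tendsto_slope.mono_left (nhdsWithin_mono us (fun x (hx : us < x) => hx.ne') : 𝓝[>] us ≤ 𝓝[≠] us)
      refine ge_of_tendsto t ?_
      filter_upwards [Ioo_mem_nhdsGT huslt] with x hx
      rw [slope_def_field]
      apply div_nonneg _ (by linarith [hx.1])
      linarith [hgt x hx.1 hx.2.le]
    rcases P.hd.eq_or_lt with hd1' | hd2
    ·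
      have hdr : dX - 1 = 0 := by rw [← hd1']; simp
      obtain ⟨s, hs1, hs2, hs3⟩ := S1.L3 P a1 (by rw [a2]; exact hus0) (ε := ρ1 us * E1 us) PO
      have hEe : En p q m v1 g1 (ρ1 us) ≤ En p q m v1 g1 s := by
        apply mono_of hs1.le (fun x hx => S1.hasDeriv_E P (a1.trans_le hx.1) (S1.pos_left (a1.trans_le hx.1) hx.2 hs2))
        intro x hx; rw [hdr]; simp
      rw [← hd1', pow_one] at hs3
      have h7 : E1 us ≤ En p q m v1 g1 s := hEe
      have : ρ1 us * E1 us ≤ s * En p q m v1 g1 s := mul_le_mul hs1.le h7 hEpos.le (a1.trans hs1).le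
      linarith
    · have hdr : (0:ℝ) < dX - 1 := by
        have : (1:ℝ) < d := by exact_mod_cast hd2
        linarith
      rw [hg] at hder
      have h8 : dJ/ρ1 us < dJ/ρ2 us := div_lt_div_of_pos_left hdr b1 hρlt
      have h9 : 0 < g2 (ρ2 us)^pJ := by positivity
      nlinarith [mul_lt_mul_of_pos_right h8 h9]

  have hu0' := H1 u0 hu0 hu0c.le
  obtain ⟨r, hr1, hr2, hr3⟩ := S1.L3 P hu0'.1 (by rw [hu0'.2.1]; exact hu0) hX0
  have hrpos := hu0'.1.trans hr1
  have hvr : v1 r < u0 := by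
    have := S1.santi P hu0'.1 hr1 hr2; rwa [hu0'.2.1] at this
  have hX1 : X u0 ≤ X (v1 r) := Xmono _ hr2 hvr.le fun x hx => (hΔ x (hr2.trans_le hx.1) hx.2).le
  have hA : X (v1 r) ≤ A1 (v1 r) := by
    have n1 := N1pos _ hr2 (hvr.le.trans hu0c.le)
    have n2 := N2pos _ hr2 (hvr.trans hu0c)
    obtain ⟨b1, b2, -⟩ := H2 _ hr2 (hvr.trans hu0c)
    have h2 : 0 ≤ A2 (v1 r) := La PO (S2.E_nonneg P b1 (by rw [b2]; exact hr2))
    have : 0 ≤ N1 (v1 r) / N2 (v1 r) * A2 (v1 r) := by positivity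
    simp only [hX]; linarith
  have hAr : A1 (v1 r) = r^d * En p q m v1 g1 r := by simp only [hA1]; rw [hinj1 r hrpos hr2]
  linarith

end GS

lemma lip_of {φ φ' : ℝ → ℝ} {a b : ℝ} (h : ∀ x ∈ Icc a b, HasDerivAt φ (φ' x) x)
    (hc : ContinuousOn φ' (Icc a b)) :
    ∃ L, 0 ≤ L ∧ ∀ x ∈ Icc a b, ∀ y ∈ Icc a b, |φ x - φ y| ≤ L * |x - y| := by
  obtain ⟨L, hL⟩ := isCompact_Icc.exists_bound_of_continuousOn hc
  refine ⟨max L 0, Mo _ _, fun x hx y hy => ?_⟩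
  have := (convex_Icc a b).norm_image_sub_le_of_norm_hasDerivWithin_le
    (fun z hz => (h z hz).hasDerivWithinAt) (fun z hz => (hL z hz).trans (Lf L 0)) hy hx
  exact this

lemma bd_of {φ : ℝ → ℝ} {R l : ℝ} (hR : 0 < R) (hc : ContinuousOn φ (Ioi 0)) (hl : 0 < l)
    (hlim : Tendsto φ (𝓝[>] 0) (𝓝 l)) (hpos : ∀ s, 0 < s → s ≤ R → 0 < φ s) :
    ∃ a b, 0 < a ∧ ∀ s, 0 < s → s ≤ R → a ≤ φ s ∧ φ s ≤ b := by
  have h1 : ∀ᶠ s in 𝓝[>] (0:ℝ), l/2 < φ s ∧ φ s < 2*l :=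
    hlim.eventually (Ioo_mem_nhds LA LA)
  obtain ⟨ε, hε, hε'⟩ := (mem_nhdsGT_iff_exists_Ioo_subset).1 h1
  have hε0 : 0 < ε := hε
  set e := min (ε/2) R
  have he0 : 0 < e := lt_min LA hR
  have hne : (Icc e R).Nonempty := ⟨R, Lb _ _, Lj⟩
  have hcc : ContinuousOn φ (Icc e R) := hc.mono fun x hx => he0.trans_le hx.1
  obtain ⟨x, hx, hxm⟩ := isCompact_Icc.exists_isMinOn hne hcc
  obtain ⟨y, hy, hym⟩ := isCompact_Icc.exists_isMaxOn hne hcc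
  refine ⟨min (l/2) (φ x), max (2*l) (φ y), lt_min LA (hpos x (he0.trans_le hx.1) hx.2), ?_⟩
  intro s hs hsR
  rcases lt_or_ge s ε with h | h
  · have := hε' ⟨hs, h⟩
    exact ⟨(Lq _ _).trans this.1.le, this.2.le.trans (Lf _ _)⟩
  · have hs' : s ∈ Icc e R := ⟨(Lq _ _).trans LA, hsR⟩
    exact ⟨(Lb _ _).trans (hxm hs'), (hym hs').trans (Mo _ _)⟩

lemma cmp_of {φ φ' B B' : ℝ → ℝ} {R : ℝ} (h : ∀ x, 0 < x → x ≤ R → HasDerivAt φ (φ' x) x)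
    (hB : ∀ x, 0 < x → x ≤ R → HasDerivAt B (B' x) x)
    (hle : ∀ x, 0 < x → x ≤ R → |φ' x| ≤ B' x)
    (h0 : Tendsto φ (𝓝[>] 0) (𝓝 0)) (hB0 : Tendsto B (𝓝[>] 0) (𝓝 0)) {x : ℝ} (hx : 0 < x) (hxR : x ≤ R) :
    |φ x| ≤ B x := by
  rw [abs_le]
  constructor
  · have h1 : Tendsto (fun s => φ s + B s) (𝓝[>] 0) (𝓝 0) := by simpa using h0.add hB0
    have : 0 ≤ φ x + B x := by
      refine le_of_tendsto h1 ?_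
      filter_upwards [Ioo_mem_nhdsGT hx] with s hs
      apply mono_of hs.2.le (f := fun s => φ s + B s) (f' := fun s => φ' s + B' s)
      · exact fun y hy => (h y (hs.1.trans_le hy.1) (hy.2.trans hxR)).add (hB y (hs.1.trans_le hy.1) (hy.2.trans hxR))
      · intro y hy
        have := (abs_le.1 (hle y (hs.1.trans_le hy.1) (hy.2.trans hxR))).1
        linarith
    linarith
  · have h1 : Tendsto (fun s => φ s - B s) (𝓝[>] 0) (𝓝 0) := by simpa using h0.sub hB0
    have : φ x - B x ≤ 0 := by
      refine ge_of_tendsto h1 ?_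
      filter_upwards [Ioo_mem_nhdsGT hx] with s hs
      apply anti_of hs.2.le (f := fun s => φ s - B s) (f' := fun s => φ' s - B' s)
      · exact fun y hy => (h y (hs.1.trans_le hy.1) (hy.2.trans hxR)).sub (hB y (hs.1.trans_le hy.1) (hy.2.trans hxR))
      · intro y hy
        have := (abs_le.1 (hle y (hs.1.trans_le hy.1) (hy.2.trans hxR))).2
        linarith
    linarith

namespace GS

lemma one_lt_c (P : PA) (S : GV v g) {c : ℝ} (hc : Tendsto v (𝓝[>] 0) (𝓝 c)) : 1 < c := by
  have hFc : 0 ≤ FN q m c := by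
    refine ge_of_tendsto (S.E_lim P hc) ?_
    filter_upwards [S.v_ev_pos] with r hr
    exact S.E_nonneg P hr.1 hr.2
  exact one_lt_of_FN P.hq P.hqm (S.c_pos hc) hFc

lemma phi_bd (P : PA) (S : GV v g) {c R : ℝ} (hc : Tendsto v (𝓝[>] 0) (𝓝 c))
    (hR : 0 < R) (hv : 0 < v R) :
    ∃ a b, 0 < a ∧ ∀ s, 0 < s → s ≤ R → a ≤ Nn d p g s / s^d ∧ Nn d p g s / s^d ≤ b := by
  have hd0 : (0:ℝ) < d := by exact_mod_cast P.hd
  refine bd_of hR ?_ (div_pos (fN_pos P.hqm (S.one_lt_c P hc)) hd0) (S.N_asymp P hc) ?_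
  · apply ContinuousOn.div
    · exact (continuousOn_id.pow _).mul (S.gc.rpow_const (fun _ _ => Or.inr (by linarith [P.hp])))
    · exact continuousOn_id.pow _
    · intro x hx; exact pow_ne_zero _ (ne_of_gt hx)
  · intro s hs hsR
    have := S.g_pos P hs (S.pos_left hs hsR hv)
    unfold Nn; positivity

lemma g_eq (P : PA) (S : GV v g) {s : ℝ} (hs : 0 < s) :
    g s = s^(1/pJ) * (Nn d p g s / s^d)^(1/pJ) := by
  have hp : p - 1 ≠ 0 := by linarith [P.hp]
  have h1 : 0 ≤ Nn d p g s / s^d := div_nonneg (S.N_nonneg hs) PO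
  rw [← Kg hs.le h1]
  have : s * (Nn d p g s / s^d) = g s^pJ := by
    unfold Nn; rw [pow_d P]; field_simp
  rw [this, ← Ks (S.hg s hs), mul_one_div_cancel hp, Ku]

lemma eq_on_pos (P : PA) (S1 : GV v1 g1) (S2 : GV v2 g2) {c R : ℝ}
    (hc1 : Tendsto v1 (𝓝[>] 0) (𝓝 c)) (hc2 : Tendsto v2 (𝓝[>] 0) (𝓝 c))
    (hR : 0 < R) (hR1 : 0 < v1 R) (hR2 : 0 < v2 R) : v1 R = v2 R := by
  have hp := P.hp
  obtain ⟨a1, b1, ha1, hb1⟩ := S1.phi_bd P hc1 hR hR1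
  obtain ⟨a2, b2, ha2, hb2⟩ := S2.phi_bd P hc2 hR hR2
  set β := 1/pJ with hβ
  have hβ0 : 0 < β := by rw [hβ]; exact one_div_pos.2 LA
  set a := min a1 a2
  set b := max b1 b2
  have ha : 0 < a := lt_min ha1 ha2
  obtain ⟨Λ, hΛ0, hΛ⟩ := lip_of (φ := fun x => x^β) (φ' := fun x => β * x^(β-1)) (a := a) (b := b)
    (fun x hx => Lx (Or.inl (ha.trans_le hx.1).ne'))
    (continuousOn_const.mul (continuousOn_id.rpow_const (fun x hx => Or.inl (ha.trans_le hx.1).ne')))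
  set k := min (v1 R) (v2 R)
  have hk : 0 < k := lt_min hR1 hR2
  obtain ⟨L, hL0, hL⟩ := lip_of (φ := fN q m) (φ' := fun u => m*u^(m-1) - q*u^(q-1)) (a := k) (b := c)
    (fun x hx => fN_hasDeriv (hk.trans_le hx.1))
    ((continuousOn_const.mul (continuousOn_id.rpow_const (fun x hx => Or.inl (hk.trans_le hx.1).ne'))).sub
     (continuousOn_const.mul (continuousOn_id.rpow_const (fun x hx => Or.inl (hk.trans_le hx.1).ne'))))
  set C := R^β * Λ * L + 1 with hC
  set lam := 2*C with hlam
  set T := (fun s => Ll (-(lam*s)) * |v1 s - v2 s|) '' Ioc 0 R with hT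
  have hm1 : ∀ s, 0 < s → s ≤ R → v1 s ∈ Icc k c := fun s hs hsR =>
    ⟨(Lq _ _).trans (S1.anti hs hsR), S1.le_lim hc1 hs⟩
  have hm2 : ∀ s, 0 < s → s ≤ R → v2 s ∈ Icc k c := fun s hs hsR =>
    ⟨(Lb _ _).trans (S2.anti hs hsR), S2.le_lim hc2 hs⟩
  have hTb : BddAbove T := by
    refine ⟨c, ?_⟩
    rintro _ ⟨s, hs, rfl⟩
    have h1 := hm1 s hs.1 hs.2
    have h2 := hm2 s hs.1 hs.2
    have h3 : |v1 s - v2 s| ≤ c := by rw [abs_le]; constructor <;> linarith [h1.1, h1.2, h2.1, h2.2]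
    have h4 : Ll (-(lam*s)) ≤ 1 := Real.exp_le_one_iff.2 (by have := hs.1; simp; positivity)
    calc _ ≤ 1 * c := mul_le_mul h4 h3 (Mw _) (by norm_num)
      _ = c := one_mul _
  have hTn : T.Nonempty := ⟨_, R, ⟨hR, Lj⟩, rfl⟩
  set K := sSup T with hK
  have hKle : ∀ s, 0 < s → s ≤ R → |v1 s - v2 s| ≤ K * Ll (lam*s) := by
    intro s hs hsR
    have h1 : Ll (-(lam*s)) * |v1 s - v2 s| ≤ K := le_csSup hTb ⟨s, ⟨hs, hsR⟩, rfl⟩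
    rw [Real.exp_neg] at h1
    have := Real.exp_pos (lam*s)
    rw [inv_mul_le_iff₀ this] at h1; linarith
  have hK0 : 0 ≤ K := by
    refine Mm ?_ (le_csSup hTb ⟨R, ⟨hR, Lj⟩, rfl⟩)
    positivity
  have hd1 : (1:ℝ) ≤ d := by exact_mod_cast P.hd

  have hN : ∀ s, 0 < s → s ≤ R → |Nn d p g1 s - Nn d p g2 s| ≤ L*K*(s^d * Ll (lam*s)) := by
    intro s hs hsR
    refine cmp_of (φ := fun s => Nn d p g1 s - Nn d p g2 s) (B := fun s => L*K*(s^d * Ll (lam*s)))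
      (φ' := fun s => s^dJ * fN q m (v1 s) - s^dJ * fN q m (v2 s))
      (B' := fun s => L*K*((d*s^dJ) * Ll (lam*s) + s^d * (Ll (lam*s) * (lam*1)))) (R := R) ?_ ?_ ?_ ?_ ?_ hs hsR
    · exact fun x hx hxR => (S1.ode x hx (hk.trans_le (hm1 x hx hxR).1)).sub (S2.ode x hx (hk.trans_le (hm2 x hx hxR).1))
    · intro x hx hxR
      exact ((hasDerivAt_pow d x).mul (((hasDerivAt_id x).const_mul lam).exp)).const_mul _
    · intro x hx hxR
      have h1 := hL _ (hm1 x hx hxR) _ (hm2 x hx hxR)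
      have h2 := hKle x hx hxR
      have h3 : 0 < x^dJ := by positivity
      have hexp := Real.exp_pos (lam*x)
      rw [← mul_sub, abs_mul, Na h3]
      calc x^dJ * |fN q m (v1 x) - fN q m (v2 x)| ≤ x^dJ * (L * (K*Ll (lam*x))) := by
            apply Kq _ h3.le
            exact h1.trans (Kq h2 hL0)
        _ = L*K*((1*x^dJ)*Ll (lam*x) + 0) := by ring
        _ ≤ _ := by
            apply Kq _ PO
            gcongr
            positivity
    · simpa using S1.N0.sub S2.N0
    · have : Continuous (fun s => L*K*(s^d * Ll (lam*s))) := by fun_prop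
      have := this.tendsto 0
      rw [zero_pow (by have := P.hd; omega)] at this
      simp only [zero_mul, Mn] at this
      exact this.mono_left Lm
  have hg : ∀ s, 0 < s → s ≤ R → |g1 s - g2 s| ≤ C*K*Ll (lam*s) := by
    intro s hs hsR
    have m1 : Nn d p g1 s / s^d ∈ Icc a b := ⟨(Lq _ _).trans (hb1 s hs hsR).1, (hb1 s hs hsR).2.trans (Lf _ _)⟩
    have m2 : Nn d p g2 s / s^d ∈ Icc a b := ⟨(Lb _ _).trans (hb2 s hs hsR).1, (hb2 s hs hsR).2.trans (Mo _ _)⟩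
    have h1 := hΛ _ m1 _ m2
    rw [S1.g_eq P hs, S2.g_eq P hs, ← mul_sub, abs_mul, Na (by positivity : 0 < s^(1/pJ))]
    have hsd : 0 < s^d := by positivity
    have h2 : |Nn d p g1 s / s^d - Nn d p g2 s / s^d| ≤ L*K*Ll (lam*s) := by
      rw [← sub_div, abs_div, Na hsd, Mt hsd]
      linarith [hN s hs hsR]
    have h3 : s^β ≤ R^β := Ko hs.le hsR hβ0.le
    have hexp := Real.exp_pos (lam*s)
    calc _ ≤ R^β * (Λ * (L*K*Ll (lam*s))) := by
          apply mul_le_mul h3 (h1.trans (Kq h2 hΛ0)) (Mw _) PO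
      _ = (R^β*Λ*L)*(K*Ll (lam*s)) := by ring
      _ ≤ C*(K*Ll (lam*s)) := by
          apply Me _ PO
          linarith
      _ = _ := by ring
  have hv : ∀ s, 0 < s → s ≤ R → |v1 s - v2 s| ≤ K/2*(Ll (lam*s) - 1) := by
    intro s hs hsR
    refine cmp_of (φ := fun s => v1 s - v2 s) (B := fun s => K/2*(Ll (lam*s) - 1))
      (φ' := fun s => -(g1 s) - -(g2 s))
      (B' := fun s => K/2*(Ll (lam*s) * (lam*1))) (R := R) ?_ ?_ ?_ ?_ ?_ hs hsR
    · exact fun x hx hxR => (S1.hv x hx).sub (S2.hv x hx)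
    · intro x hx hxR
      exact ((((hasDerivAt_id x).const_mul lam).exp).sub_const 1).const_mul _
    · intro x hx hxR
      have := hg x hx hxR
      rw [abs_sub_comm] at this
      have e : -(g1 x) - -(g2 x) = g2 x - g1 x := by ring
      rw [e]
      refine this.trans (le_of_eq ?_)
      rw [hlam]; ring
    · simpa using hc1.sub hc2
    · have : Continuous (fun s => K/2*(Ll (lam*s) - 1)) := by fun_prop
      have := this.tendsto 0
      simp only [Mn, Real.exp_zero, sub_self] at this
      exact this.mono_left Lm
  have hKK : K ≤ K/2 := by
    refine csSup_le hTn ?_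
    rintro _ ⟨s, hs, rfl⟩
    have h1 := hv s hs.1 hs.2
    have hexp := Real.exp_pos (lam*s)
    simp only
    rw [Real.exp_neg, inv_mul_le_iff₀ hexp]
    nlinarith
  have hK00 : K = 0 := by linarith
  have := hKle R hR Lj
  rw [hK00, zero_mul] at this
  exact sub_eq_zero.1 (abs_nonpos_iff.1 this)

lemma eq_zero_aux (P : PA) (S1 : GV v1 g1) (S2 : GV v2 g2) {c R : ℝ}
    (hc1 : Tendsto v1 (𝓝[>] 0) (𝓝 c)) (hc2 : Tendsto v2 (𝓝[>] 0) (𝓝 c))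
    (hR : 0 < R) (hR1 : 0 < v1 R) : 0 < v2 R := by
  by_contra hcon
  have hlt : v1 R / 2 < c := by linarith [S1.le_lim hc1 hR]
  obtain ⟨t, ht, ht'⟩ := ((hc2.eventually (Lh hlt)).and Ln).exists
  obtain ⟨s, hs, hs'⟩ := S2.exists_val ht' (half_pos hR1) ht
  have hs0 : 0 < s := lt_trans ht' hs
  have hsR : s < R := by
    by_contra hc
    have := S2.anti hR (not_lt.1 hc); linarith
  have h1 := S1.anti hs0 hsR.le
  have := S1.eq_on_pos P S2 hc1 hc2 hs0 LA LA
  linarith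

theorem unique (P : PA) (S1 : GV v1 g1) (S2 : GV v2 g2) {c : ℝ}
    (hc : Tendsto v2 (𝓝[>] 0) (𝓝 c)) : ∀ r, 0 < r → v1 r = v2 r := by
  have hle : ∀ r, 0 < r → v1 r ≤ c := by
    intro r hr
    by_contra h
    exact L5 P S1 S2 hc ⟨r, hr, not_le.1 h⟩
  have hA : AntitoneOn v1 (Ioi 0) := fun a ha b _ hab => S1.anti ha hab
  have hb : BddAbove (v1 '' Ioi 0) := by
    refine ⟨c, ?_⟩; rintro _ ⟨r, hr, rfl⟩; exact hle r hr
  have ht : Tendsto v1 (𝓝[>] 0) (𝓝 (sSup (v1 '' Ioi 0))) := hA.tendsto_nhdsGT hb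
  have heq : sSup (v1 '' Ioi 0) = c := by
    apply le_antisymm
    · exact csSup_le ⟨_, 1, mem_Ioi.2 Lz, rfl⟩ (by rintro _ ⟨r, hr, rfl⟩; exact hle r hr)
    · by_contra h
      obtain ⟨r, hr, hr'⟩ := ((hc.eventually (Lh (not_le.1 h))).and Ln).exists
      exact L5 P S2 S1 ht ⟨r, hr', hr⟩
  rw [heq] at ht
  intro r hr
  by_cases h1 : 0 < v1 r
  · exact S1.eq_on_pos P S2 ht hc hr h1 (S1.eq_zero_aux P S2 ht hc hr h1)
  · by_cases h2 : 0 < v2 r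
    · exact absurd (S2.eq_zero_aux P S1 hc ht hr h2) h1
    · have := S1.hv0 r hr; have := S2.hv0 r hr; linarith

end GS

noncomputable def nu (d : ℕ) : Measure ℝ :=
  (Mb (Ioi 0)).withDensity (fun r => ENNReal.ofReal (r^(d-1)))

lemma nu_meas : Measurable (fun r : ℝ => oR (r^dJ)) := by fun_prop

lemma nu_ac : nu d ≪ Mb (Ioi 0) := withDensity_absolutelyContinuous _ _

lemma nu_ae {P : ℝ → Prop} (h : ∀ᵐ r ∂Mb (Ioi 0), P r) : ∀ᵐ r ∂nu d, P r :=
  nu_ac.ae_le h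

lemma nu_pos_ae : ∀ᵐ r ∂nu d, 0 < r := nu_ae (Kw Ka)

lemma ae_nu {P : ℝ → Prop} (h : ∀ᵐ r ∂nu d, P r) : ∀ᵐ r ∂Mb (Ioi 0), P r := by
  have := (ae_withDensity_iff nu_meas).1 h
  filter_upwards [this, Kw Ka] with r hr h0
  apply hr
  have : 0 < r^dJ := pow_pos h0 _
  simpa using this

lemma nu_lint (f : ℝ → ENNReal) :
    ∫⁻ r, f r ∂nu d = ∫⁻ r in Ioi 0, oR (r^dJ) * f r := by
  unfold nu
  rw [lintegral_withDensity_eq_lintegral_mul_non_measurable _ nu_meas (by simp)]; rfl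

lemma nu_int (f : ℝ → ℝ) : ∫ r, f r ∂nu d = ∫ r in Ioi 0, r^dJ * f r := by
  unfold nu
  rw [integral_withDensity_eq_integral_toReal_smul nu_meas (by simp)]
  apply setIntegral_congr_fun Ka
  intro r hr
  have : 0 ≤ r^dJ := pow_nonneg (Kx hr) _
  simp [ENNReal.toReal_ofReal this]

lemma nu_integrable (f : ℝ → ℝ) :
    Integrable f (nu d) ↔ IntegrableOn (fun r => r^dJ * f r) (Ioi 0) := by
  unfold nu
  rw [integrable_withDensity_iff_integrable_smul' nu_meas (by simp)]
  apply integrableOn_congr_fun _ Ka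
  intro r hr
  have : 0 ≤ r^dJ := pow_nonneg (Kx hr) _
  simp [ENNReal.toReal_ofReal this]

lemma nu_loc {a : ℝ} (ha : 0 < a) (f : ℝ → ENNReal) :
    ∫⁻ r in Ioi a, f r ≤ oR (1/a^dJ) * ∫⁻ r, f r ∂nu d := by
  rw [nu_lint, ← Ky _ _ (by simp)]
  refine Mm ?_ (lintegral_mono_set (Ioi_subset_Ioi ha.le))
  apply Li Ka
  intro r hr
  rw [← Mx, ← Kj PO]
  refine le_mul_of_one_le_left' ?_
  rw [ENNReal.one_le_ofReal, Kt, one_mul, one_le_div PO]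
  exact Lu ha.le (Kx hr) _

lemma trunc (hp : 1 < p) {x T : ℝ} (hx : 0 ≤ x) (hT : 0 < T) :
    x ≤ min x T + T^(1-p) * x^p := by
  rcases Mz x T with h | h
  · rw [min_eq_left h]; have : 0 ≤ T^(1-p) * x^p := by positivity
    linarith
  · have h0 : 0 < x := hT.trans h
    have : x = x^(1-p) * x^p := by rw [← Kr h0]; simp
    have h2 : x^(1-p) ≤ T^(1-p) := Real.rpow_le_rpow_of_nonpos hT h.le LA
    have h3 : x^(1-p) * x^p ≤ T^(1-p) * x^p := by gcongr
    have : 0 ≤ min x T := le_min hx hT.le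
    linarith

lemma trunc_int (hp : 1 < p) {f : ℝ → ℝ} (hf : AEMeasurable f (Mb (Ioi 0)))
    (hf0 : ∀ r, 0 < r → 0 ≤ f r) {a b T : ℝ} (ha : 0 < a) (hT : 0 < T) :
    ∫⁻ r in Ioc a b, oR (f r) ≤ (∫⁻ r in Ioc a b, oR (min (f r) T)) +
      oR (T^(1-p)/a^dJ) * ∫⁻ r, oR (f r^p) ∂nu d := by
  have hs : Ioc a b ⊆ Ioi 0 := fun x hx => ha.trans hx.1
  calc _ ≤ ∫⁻ r in Ioc a b, (oR (min (f r) T) + oR (T^(1-p)) * oR (f r^p)) := by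
        apply Li Ke
        intro r hr
        have := hf0 r (hs hr)
        rw [← Kj PO, ← Mr PO PO]
        exact Ki (trunc hp this hT)
    _ = (∫⁻ r in Ioc a b, oR (min (f r) T)) + oR (T^(1-p)) * ∫⁻ r in Ioc a b, oR (f r^p) := by
        rw [lintegral_add_left', Ky _ _ (by simp)]
        exact ((hf.mono_set hs).min aemeasurable_const).ennreal_ofReal
    _ ≤ _ := by
        apply add_le_add Lj
        rw [div_eq_mul_one_div, Kj PO, Mx]
        gcongr
        exact (lintegral_mono_set Ioc_subset_Ioi_self).trans (nu_loc ha _)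

structure Rad (v g : ℝ → ℝ) : Prop where
  gm : Measurable g
  g0 : ∀ r, 0 ≤ g r
  gi : ∀ r, 0 < r → IntegrableOn g (Ioi r)
  hv : ∀ r, 0 < r → v r = ∫ s in Ioi r, g s

lemma anti_dq {v : ℝ → ℝ} (hv : AntitoneOn v (Ioi 0)) {a b h : ℝ} (ha : 0 < a) (hab : a ≤ b) (hh : 0 < h) :
    v (a+h) - v b ≤ ∫ r in a..b, (v r - v (r+h))/h := by
  have ii : ∀ x y, 0 < x → x ≤ y → IntervalIntegrable v volume x y := fun x y hx hxy => by
    apply AntitoneOn.intervalIntegrable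
    rw [uIcc_of_le hxy]
    exact hv.mono fun z hz => Kn hx hz.1
  have i2 : IntervalIntegrable (fun r => v (r+h)) volume a b := by
    have := (ii (a+h) (b+h) LA LA).comp_add_right h
    simpa using this
  rw [intervalIntegral.integral_div, intervalIntegral.integral_sub (ii a b ha hab) i2,
    intervalIntegral.integral_comp_add_right, Ms hh,
    intervalIntegral.integral_interval_sub_interval_comm (ii a b ha hab) (ii _ _ LA LA) (ii _ _ LA LA)]
  have h1 : ∫ r in a..(a+h), v (a+h) ≤ ∫ r in a..(a+h), v r := by
    apply intervalIntegral.integral_mono_on LA (by simp) (ii _ _ ha LA)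
    intro x hx
    exact hv (Kn ha hx.1) (by simp; linarith) hx.2
  have h2 : ∫ r in b..(b+h), v r ≤ ∫ r in b..(b+h), v b := by
    apply intervalIntegral.integral_mono_on LA (ii _ _ LA LA) (by simp)
    intro x hx
    exact hv (by simp; linarith) (by simp; linarith [hx.1]) hx.1
  simp at h1 h2
  linarith

lemma riesz (hp : 1 < p) {v : ℝ → ℝ} (hv : AntitoneOn v (Ioi 0)) (hlim : Tendsto v atTop (𝓝 0))
    {h : ℕ → ℝ} (hh : ∀ k, 0 < h k) (hh0 : Tendsto h atTop (𝓝 0)) {K : ENNReal} (hK : K ≠ ⊤)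
    {Kk : ℕ → ENNReal} (hKk : Tendsto Kk atTop (𝓝 K))
    (hle : ∀ k, ∫⁻ r, oR (((v r - v (r + h k))/h k)^p) ∂nu d ≤ Kk k) :
    ∃ g, Rad v g ∧ ∫⁻ r, oR (g r^p) ∂nu d ≤ K := by
  set g : ℝ → ℝ := fun r => max (-deriv v r) 0 with hg
  have gm : Measurable g := (measurable_deriv v).neg.max Mv
  have g0 : ∀ r, 0 ≤ g r := fun r => Mo _ _
  set Q : ℕ → ℝ → ℝ := fun k r => (v r - v (r + h k))/h k with hQ
  have Q0 : ∀ k r, 0 < r → 0 ≤ Q k r := fun k r hr => by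
    apply div_nonneg _ (hh k).le
    linarith [hv (a := r) (b := r + h k) hr (by simp; linarith [hh k]) (by linarith [hh k])]
  have vm : AEMeasurable v (Mb (Ioi 0)) := aemeasurable_restrict_of_antitoneOn Ka hv
  have Qm : ∀ k, AEMeasurable (Q k) (Mb (Ioi 0)) := fun k => by
    apply AEMeasurable.div_const
    apply vm.sub
    apply aemeasurable_restrict_of_antitoneOn Ka
    intro x hx y hy hxy
    have := hh k
    simp only [mem_Ioi] at hx hy
    exact hv (by simp; linarith) (by simp; linarith) LA
  have hn : MonotoneOn (fun r => - v r) (Ioi 0) := fun x hx y hy hxy => neg_le_neg (hv hx hy hxy)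
  have hdiff : ∀ᵐ r ∂Mb (Ioi 0), DifferentiableAt ℝ v r := by
    filter_upwards [hn.ae_differentiableWithinAt Ka, Kw Ka] with r hr h0
    have := (hr.differentiableAt (Ioi_mem_nhds h0)).neg
    simpa using! this
  have gder : ∀ r, 0 < r → g r = - deriv v r := fun r hr => by
    apply max_eq_left
    by_cases hd : DifferentiableAt ℝ v r
    · have : deriv v r ≤ 0 := by
        rw [← hd.derivWithin (uniqueDiffOn_Ioi (0:ℝ) r hr)]
        exact hv.derivWithin_nonpos
      linarith
    · rw [deriv_zero_of_not_differentiableAt hd]; simp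
  have hconv : ∀ᵐ r ∂Mb (Ioi 0), Tendsto (fun k => Q k r) atTop (𝓝 (g r)) := by
    filter_upwards [hdiff, Kw Ka] with r hr h0
    rw [gder r h0]
    have h1 := hasDerivAt_iff_tendsto_slope_zero.1 hr.hasDerivAt
    have h2 : Tendsto h atTop (𝓝[≠] 0) := tendsto_nhdsWithin_iff.2 ⟨hh0, .of_forall fun k => (hh k).ne'⟩
    refine (h1.comp h2).neg.congr fun k => ?_
    simp only [hQ, Function.comp, smul_eq_mul]; ring

  have fat : ∫⁻ r, oR (g r^p) ∂nu d ≤ K := by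
    have pc : Continuous (fun x : ℝ => oR (x^p)) :=
      ENNReal.continuous_ofReal.comp (Real.continuous_rpow_const LA)
    calc ∫⁻ r, oR (g r^p) ∂nu d = ∫⁻ r, liminf (fun k => oR (Q k r^p)) atTop ∂nu d := by
          apply lintegral_congr_ae
          filter_upwards [nu_ae hconv] with r hr
          exact ((pc.tendsto _).comp hr).liminf_eq.symm
      _ ≤ liminf (fun k => ∫⁻ r, oR (Q k r^p) ∂nu d) atTop := by
          apply lintegral_liminf_le'
          intro k
          exact (pc.measurable.comp_aemeasurable (Qm k)).mono_ac nu_ac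
      _ ≤ liminf Kk atTop := liminf_le_liminf (.of_forall hle)
      _ = K := hKk.liminf_eq

  have gii : ∀ a b, 0 < a → a ≤ b → IntervalIntegrable g volume a b := fun a b ha hab => by
    have hs : uIcc a b ⊆ Ioi 0 := by
      rw [uIcc_of_le hab]; exact fun z hz => Kn ha hz.1
    refine ((hn.mono hs).intervalIntegrable_deriv).congr ?_
    intro r hr
    rw [deriv.fun_neg, gder r (hs (uIoc_subset_uIcc hr))]
  have glo : ∀ a b, 0 < a → a ≤ b → ∫ r in a..b, g r ≤ v a - v b := fun a b ha hab => by
    have hs : uIcc a b ⊆ Ioi 0 := by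
      rw [uIcc_of_le hab]; exact fun z hz => Kn ha hz.1
    have h1 := (hn.mono hs).intervalIntegral_deriv_mem_uIcc
    have h2 : ∫ r in a..b, g r = ∫ r in a..b, deriv (fun r => - v r) r := by
      apply intervalIntegral.integral_congr
      intro r hr
      rw [deriv.fun_neg, gder r (hs hr)]
    have h3 : v b ≤ v a := hv ha (Kn ha hab) hab
    rw [← h2, uIcc_of_le LA] at h1
    linarith [h1.2]
  have lq : ∀ (f : ℝ → ℝ) a b, a ≤ b → (∀ r ∈ Ioc a b, 0 ≤ f r) → IntervalIntegrable f volume a b →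
      oR (∫ r in a..b, f r) = ∫⁻ r in Ioc a b, oR (f r) := fun f a b hab h0 hi => by
    rw [Kv hab, Kl]
    · exact (Kp hab).1 hi
    · filter_upwards [Kw Ke] with r hr using h0 r hr
  have gup1 : ∀ a' a b T, 0 < a' → a' < a → a ≤ b → 0 < T → oR (v a - v b) ≤
      oR (∫ r in a'..b, g r) + oR (T^(1-p)/a'^dJ) * K := by
    intro a' a b T ha' haa hab hT
    have hs : Ioc a' b ⊆ Ioi 0 := fun x hx => ha'.trans hx.1
    have step : ∀ᶠ k in atTop, oR (v a - v b) ≤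
        (∫⁻ r in Ioc a' b, oR (min (Q k r) T)) + oR (T^(1-p)/a'^dJ) * Kk k := by
      filter_upwards [hh0.eventually (gt_mem_nhds (sub_pos.2 haa))] with k hk
      have e1 := anti_dq hv ha' (haa.le.trans hab) (hh k)
      have e2 : v a ≤ v (a' + h k) := hv (by simp; linarith [hh k]) (ha'.trans haa) LA
      refine Mm ?_ ((trunc_int (d := d) hp (Qm k) (Q0 k) (b := b) ha' hT).trans (by gcongr; exact hle k))
      rw [← lq]
      · exact Ki (by simp only [hQ]; linarith)
      · linarith
      · exact fun r hr => Q0 k r (hs hr)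
      · apply IntervalIntegrable.div_const
        apply IntervalIntegrable.sub
        · apply AntitoneOn.intervalIntegrable
          rw [uIcc_of_le LA]
          exact hv.mono fun z hz => Kn ha' hz.1
        · apply AntitoneOn.intervalIntegrable
          rw [uIcc_of_le LA]
          intro x hx y hy hxy
          have := hh k
          exact hv (by simp; linarith [hx.1]) (by simp; linarith [hy.1]) LA
    have l1 : Tendsto (fun k => ∫⁻ r in Ioc a' b, oR (min (Q k r) T)) atTop
        (𝓝 (∫⁻ r in Ioc a' b, oR (min (g r) T))) := by
      apply tendsto_lintegral_of_dominated_convergence' (fun _ => oR T)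
      · intro k
        exact (((Qm k).mono_set hs).min aemeasurable_const).ennreal_ofReal
      · intro k
        exact .of_forall fun r => Ki (Lb _ _)
      · simp
        exact ENNReal.mul_ne_top (by simp) (by simp)
      · filter_upwards [ae_restrict_of_ae_restrict_of_subset hs hconv] with r hr
        exact (ENNReal.continuous_ofReal.tendsto _).comp (hr.min tendsto_const_nhds)
    have l2 := l1.add (ENNReal.Tendsto.const_mul hKk (a := oR (T^(1-p)/a'^dJ)) (Or.inr (by simp)))
    refine (ge_of_tendsto l2 step).trans ?_
    gcongr
    rw [lq g a' b LA (fun r _ => g0 r) (gii _ _ ha' LA)]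
    exact lintegral_mono fun r => Ki (Lq _ _)
  have gup2 : ∀ a' a b, 0 < a' → a' < a → a ≤ b → v a - v b ≤ ∫ r in a'..b, g r := by
    intro a' a b ha' haa hab
    have hnn : 0 ≤ ∫ r in a'..b, g r := intervalIntegral.integral_nonneg LA fun r _ => g0 r
    have t1 : Tendsto (fun T : ℝ => oR (∫ r in a'..b, g r) + oR (T^(1-p)/a'^dJ) * K) atTop
        (𝓝 (oR (∫ r in a'..b, g r) + oR (0/a'^dJ) * K)) := by
      apply tendsto_const_nhds.add
      apply ENNReal.Tendsto.mul_const _ (Or.inr hK)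
      apply (ENNReal.continuous_ofReal.tendsto _).comp
      apply Tendsto.div_const
      have := tendsto_rpow_neg_atTop (y := p-1) LA
      simpa using this
    have t2 := ge_of_tendsto t1 (by
      filter_upwards [Mp 0] with T hT using gup1 a' a b T ha' haa hab hT)
    simp at t2
    rw [Lg hnn] at t2
    exact t2
  have geq : ∀ a b, 0 < a → a ≤ b → ∫ r in a..b, g r = v a - v b := by
    intro a b ha hab
    apply le_antisymm (glo a b ha hab)
    have hc : ContinuousWithinAt (fun x => ∫ r in x..b, g r) (Icc (a/2) b) a := by
      have i := (intervalIntegrable_iff_integrableOn_Icc_of_le LA).1 (gii (a/2) b LA LA)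
      have := intervalIntegral.continuousOn_primitive_interval_left (μ := volume) (f := g) (a := a/2) (b := b)
        (by rw [uIcc_of_le LA]; exact i)
      rw [uIcc_of_le LA] at this
      exact this a ⟨by linarith, hab⟩
    have hc2 : Tendsto (fun x => ∫ r in x..b, g r) (𝓝[<] a) (𝓝 (∫ r in a..b, g r)) := by
      refine hc.mono_left ?_
      apply nhdsWithin_le_of_mem
      filter_upwards [Ioo_mem_nhdsLT (show a/2 < a by linarith)] with x hx using ⟨hx.1.le, hx.2.le.trans hab⟩
    apply ge_of_tendsto hc2
    filter_upwards [Ioo_mem_nhdsLT (show a/2 < a by linarith)] with x hx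
    exact gup2 x a b (by linarith [hx.1]) hx.2 hab
  have gi : ∀ r, 0 < r → IntegrableOn g (Ioi r) := fun r hr => by
    apply integrableOn_Ioi_of_intervalIntegral_norm_bounded (l := atTop) (b := fun n : ℝ => n) (v r + 1) r
    · intro n
      rcases Mz r n with h' | h'
      · exact (Kp h').1 (gii r n hr h')
      · rw [Ioc_eq_empty LA]; simp
    · exact tendsto_id
    · filter_upwards [Lr r, hlim.eventually (Lh (show (-1:ℝ) < 0 by norm_num))] with n hn h1
      have : ∫ x in r..n, ‖g x‖ = ∫ x in r..n, g x := by
        congr 1; ext x; exact Kc (g0 x)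
      rw [this, geq r n hr hn]; linarith
  refine ⟨g, ⟨gm, g0, gi, fun r hr => ?_⟩, fat⟩
  have t := intervalIntegral_tendsto_integral_Ioi r (gi r hr) tendsto_id
  have t2 : Tendsto (fun n => ∫ x in r..(id n), g x) atTop (𝓝 (v r - 0)) := by
    refine (tendsto_const_nhds.sub hlim).congr' ?_
    filter_upwards [Lr r] with n hn
    exact (geq r n hr hn).symm
  rw [tendsto_nhds_unique t t2, sub_zero]

noncomputable def LI (d : ℕ) (s : ℝ) (v : ℝ → ℝ) : ENNReal := ∫⁻ r, ENNReal.ofReal (v r ^ s) ∂nu d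

namespace Rad

lemma diff (S : Rad v g) {a b : ℝ} (ha : 0 < a) (hab : a ≤ b) : v a - v b = ∫ s in Ioc a b, g s := by
  rw [S.hv a ha, S.hv b LA, ← Ioc_union_Ioi_eq_Ioi hab, setIntegral_union (by simp) Ka
    ((S.gi a ha).mono_set Ioc_subset_Ioi_self) (S.gi b LA)]
  ring

lemma nonneg (S : Rad v g) {r : ℝ} (hr : 0 < r) : 0 ≤ v r := by
  rw [S.hv r hr]; exact integral_nonneg S.g0

lemma anti (S : Rad v g) : AntitoneOn v (Ioi 0) := by
  intro a ha b hb hab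
  have := S.diff ha hab
  have : 0 ≤ ∫ s in Ioc a b, g s := integral_nonneg S.g0
  linarith

lemma lim (S : Rad v g) : Tendsto v atTop (𝓝 0) := by
  have t := intervalIntegral_tendsto_integral_Ioi 1 (S.gi 1 Lz) tendsto_id
  rw [← S.hv 1 Lz] at t
  have := (tendsto_const_nhds (x := v 1)).sub t
  rw [sub_self] at this
  refine this.congr' ?_
  filter_upwards [Lr 1] with x hx
  simp only [id]
  rw [Kv hx, ← S.diff Lz hx]; ring

lemma vm (S : Rad v g) : AEMeasurable v (Mb (Ioi 0)) :=
  aemeasurable_restrict_of_antitoneOn Ka S.anti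

lemma vm' (S : Rad v g) : AEMeasurable v (nu d) := S.vm.mono_ac nu_ac

lemma diff_l (S : Rad v g) {a b : ℝ} (ha : 0 < a) (hab : a ≤ b) :
    oR (v a - v b) = ∫⁻ s in Ioc a b, oR (g s) := by
  rw [S.diff ha hab, Kl]
  · exact (S.gi a ha).mono_set Ioc_subset_Ioi_self
  · exact .of_forall S.g0

lemma cont (S : Rad v g) : ContinuousOn v (Ioi 0) := by
  intro r hr
  rw [mem_Ioi] at hr
  have i := (S.gi (r/2) LA)
  have hc := intervalIntegral.continuousOn_primitive_interval (μ := volume) (f := g) (a := r/2) (b := r+1)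
    (by rw [uIcc_of_le LA, integrableOn_Icc_iff_integrableOn_Ioc]; exact i.mono_set Ioc_subset_Ioi_self)
  rw [uIcc_of_le LA] at hc
  have h1 : ContinuousAt (fun x => ∫ t in (r/2)..x, g t) r :=
    (hc r ⟨by linarith, by linarith⟩).continuousAt (Icc_mem_nhds LA LA)
  refine ContinuousAt.continuousWithinAt ?_
  have h2 : ContinuousAt (fun x => v (r/2) - ∫ t in (r/2)..x, g t) r := continuousAt_const.sub h1
  apply h2.congr
  filter_upwards [Ioi_mem_nhds (show r/2 < r by linarith)] with x hx
  rw [Kv (Kx hx), ← S.diff LA (Kx hx)]; ring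

lemma dq_le (S : Rad v g) (hp : 1 < p) {h : ℝ} (hh : 0 < h) :
    ∫⁻ r, oR (((v r - v (r+h))/h)^p) ∂nu d ≤ LI d p g := by
  set G : ℝ → ENNReal := fun r => oR (g r ^ p) with hG
  have Gm : Measurable G := (S.gm.pow_const p).ennreal_ofReal
  have h0 : oR h ≠ 0 := by simpa using hh
  have point : ∀ r, 0 < r → oR (((v r - v (r+h))/h)^p) ≤
      (oR h)⁻¹ * ∫⁻ t in Ioc 0 h, G (r+t) := by
    intro r hr
    have e1 : ∫⁻ s in Ioc r (r+h), G s = ∫⁻ t in Ioc 0 h, G (r+t) := by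
      have := (measurePreserving_add_left (volume : Measure ℝ) r).setLIntegral_comp_preimage (s := Ioc r (r+h)) Ke Gm
      rw [← this]; congr 2; ext x; simp [add_comm]
    have dn : 0 ≤ v r - v (r+h) := by
      linarith [S.anti (a := r) (b := r+h) hr (by simp; linarith) LA]
    have hpq : p.HolderConjugate (p/pJ) := by
      rw [Real.holderConjugate_iff]
      exact ⟨hp, by field_simp; ring⟩
    have H := ENNReal.lintegral_mul_le_Lp_mul_Lq (Mb (Ioc r (r+h))) hpq
      (f := fun s => oR (g s)) (g := fun _ => 1) (S.gm.ennreal_ofReal.aemeasurable) aemeasurable_const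
    simp only [Pi.mul_apply, mul_one, ENNReal.one_rpow, lintegral_const, Measure.restrict_apply_univ, Real.volume_Ioc, one_mul, add_sub_cancel_left] at H
    rw [← S.diff_l hr LA] at H
    have H2 := ENNReal.rpow_le_rpow H (z := p) LA
    have eg : ∀ s, oR (g s) ^ p = G s := fun s => by
      simp only [hG]; rw [ENNReal.ofReal_rpow_of_nonneg (S.g0 s) LA]
    simp only [eg] at H2
    rw [Ls _ _ LA, ← ENNReal.rpow_mul, ← ENNReal.rpow_mul, one_div_mul_cancel LA,
      ENNReal.rpow_one, e1] at H2
    have e3 : 1 / (p/pJ) * p = p - 1 := by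
      field_simp
    rw [e3] at H2
    rw [← ENNReal.ofReal_rpow_of_nonneg (div_nonneg dn hh.le) LA, ENNReal.ofReal_div_of_pos hh,
      ENNReal.div_rpow_of_nonneg _ _ LA]
    calc _ ≤ ((∫⁻ t in Ioc 0 h, G (r+t)) * oR h ^ pJ) / oR h ^ p := by gcongr
      _ = _ := by
        rw [mul_div_assoc, mul_comm]
        congr 1
        rw [ENNReal.div_eq_inv_mul, ← ENNReal.rpow_neg, ← ENNReal.rpow_add _ _ h0 (by simp)]
        rw [← ENNReal.rpow_neg_one]; congr 1; ring
  unfold LI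
  rw [nu_lint, nu_lint]
  calc _ ≤ ∫⁻ r in Ioi 0, (oR h)⁻¹ * ∫⁻ t in Ioc 0 h, oR (r^dJ) * G (r+t) := by
        apply Li Ka
        intro r hr
        rw [Ky _ _ (by simp), ← Mx, mul_comm (oR h)⁻¹, Mx]
        gcongr
        exact point r hr
    _ = (oR h)⁻¹ * ∫⁻ t in Ioc 0 h, ∫⁻ r in Ioi 0, oR (r^dJ) * G (r+t) := by
        rw [Ky _ _ (by simpa using hh), lintegral_lintegral_swap]
        apply Measurable.aemeasurable
        fun_prop
    _ ≤ (oR h)⁻¹ * ∫⁻ t in Ioc 0 h, ∫⁻ r in Ioi 0, oR (r^dJ) * G r := by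
        apply Ld Lj
        apply Li Ke
        intro t ht
        calc _ ≤ ∫⁻ r in Ioi 0, oR ((r+t)^dJ) * G (r+t) := by
              apply Li Ka
              intro r hr
              have : 0 < r := hr
              gcongr
              linarith [ht.1]
          _ = ∫⁻ r in Ioi t, oR (r^dJ) * G r := by
              have := (measurePreserving_add_right (volume : Measure ℝ) t).setLIntegral_comp_preimage (s := Ioi t) Ka
                (f := fun r => oR (r^dJ) * G r) (by fun_prop)
              rw [← this]; congr 2; ext x; simp
          _ ≤ _ := lintegral_mono_set (Ioi_subset_Ioi ht.1.le)
    _ = _ := by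
        rw [lintegral_const, Measure.restrict_apply_univ, Real.volume_Ioc, sub_zero, mul_comm, Mx,
          ENNReal.mul_inv_cancel h0 (by simp), mul_one]

end Rad

namespace Rad

lemma bd_inf (S : Rad v g) (hd : 1 ≤ d) (hq : 0 ≤ q) (hM : LI d qJ v ≤ 1) {r : ℝ} (hr : 0 < r) :
    v r ≤ dX^(1/qJ) * r^(-(dX/qJ)) := by
  have hd0 : (0:ℝ) < d := by exact_mod_cast hd
  have vr := S.nonneg hr
  have h1 : oR (r^d/d * v r^qJ) ≤ 1 := by
    refine Mm ?_ hM
    unfold LI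
    rw [nu_lint]
    calc _ = oR (∫ s in Ioc 0 r, s^dJ * v r^qJ) := by
          congr 1
          rw [integral_mul_const, ← Kv hr.le, integral_pow]
          have e : d - 1 + 1 = d := by omega
          have e2 : ((d-1:ℕ):ℝ) + 1 = d := by exact_mod_cast e
          rw [e, e2, zero_pow (by omega), sub_zero]
      _ = ∫⁻ s in Ioc 0 r, oR (s^dJ * v r^qJ) := by
          apply Kl
          · apply Integrable.mul_const
            exact ((continuous_pow dJ).integrableOn_Icc (a := 0) (b := r)).mono_set Ioc_subset_Icc_self
          · filter_upwards [Kw Ke] with s hs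
            have := hs.1
            simp only [Pi.zero_apply]; positivity
      _ ≤ ∫⁻ s in Ioc 0 r, oR (s^dJ) * oR (v s^qJ) := by
          apply Li Ke
          intro s hs
          have h0 := hs.1
          rw [Kj PO]
          gcongr
          exact S.anti h0 hr hs.2
      _ ≤ _ := lintegral_mono_set Ioc_subset_Ioi_self
  rw [ENNReal.ofReal_le_one] at h1
  have h2 : v r^qJ ≤ d * (r^d)⁻¹ := by
    rw [← div_eq_mul_inv, Ms PO]
    rw [Kt, div_le_one hd0] at h1; linarith
  have h3 := Real.rpow_le_rpow PO h2 (z := 1/qJ) PO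
  rw [← Ks vr, mul_one_div_cancel PO, Ku, Kg hd0.le PO] at h3
  refine h3.trans_eq ?_
  congr 1
  rw [← Real.rpow_natCast, ← Real.rpow_neg hr.le, ← Ks hr.le]
  congr 1; ring

lemma bd_diff (S : Rad v g) (hp : 1 < p) (hG : LI d p g ≤ 1) {a b T : ℝ} (ha : 0 < a) (hab : a ≤ b) (hT : 0 < T) :
    v a - v b ≤ T*(b-a) + T^(1-p)/a^dJ := by
  have h := trunc_int (d := d) (b := b) hp S.gm.aemeasurable (fun r _ => S.g0 r) ha hT
  rw [← S.diff_l ha hab] at h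
  have h2 : (∫⁻ r in Ioc a b, oR (min (g r) T)) ≤ oR (T*(b-a)) := by
    calc _ ≤ ∫⁻ r in Ioc a b, oR T := lintegral_mono fun r => Ki (Lb _ _)
      _ = _ := by simp [Kj hT.le]
  have h3 := h.trans (add_le_add h2 (Ld Lj hG))
  rw [mul_one, ← Mr (La hT.le LA) PO] at h3
  rwa [Lg (by have := La hT.le (sub_nonneg.2 hab); positivity)] at h3

lemma bd_zero (S : Rad v g) (hd : 1 ≤ d) (hp : 1 < p) (hG : LI d p g ≤ 1) {γ : ℝ} (hγ : 0 < γ) (hγ2 : dX-p ≤ γ*p)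
    {r : ℝ} (hr : 0 < r) (hr1 : r ≤ 1) : v r ≤ v 1 + r^(-γ)*(1/γ+1) := by
  have key : oR (v r - v 1) ≤ oR (r^(-γ)*(1/γ+1)) := by
    rw [S.diff_l hr hr1]
    have hi : IntegrableOn (fun s : ℝ => s^(-γ-1)) (Ioc r 1) := by
      rw [← Kp hr1]
      apply intervalIntegral.intervalIntegrable_rpow
      right; rw [uIcc_of_le hr1]; intro h; linarith [h.1]
    calc _ ≤ ∫⁻ s in Ioc r 1, (oR (s^(-γ-1)) + oR (r^(-γ)) * (oR (s^dJ) * oR (g s^p))) := by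
          apply Li Ke
          intro s hs
          have h0 : 0 < s := hr.trans hs.1
          have := S.g0 s
          rw [← Kj PO, ← Kj PO, ← Mr PO PO]
          apply Ki
          refine (trunc hp this (T := s^(-γ-1)) PO).trans ?_
          rw [← Mx]
          gcongr
          · exact Lb _ _
          · rw [← Ks h0.le]
            calc s^((-γ-1)*(1-p)) ≤ s^(-γ + ((d-1:ℕ):ℝ)) := by
                  apply Real.rpow_le_rpow_of_exponent_ge h0 hs.2
                  rw [Nat.cast_sub hd]; push_cast; nlinarith
              _ = s^(-γ) * s^dJ := by rw [Kr h0, Real.rpow_natCast]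
              _ ≤ _ := by
                  gcongr ?_ * _
                  exact Real.rpow_le_rpow_of_nonpos hr hs.1.le LA
      _ = oR (∫ s in Ioc r 1, s^(-γ-1)) + oR (r^(-γ)) * ∫⁻ s in Ioc r 1, (oR (s^dJ) * oR (g s^p)) := by
          rw [lintegral_add_left (by fun_prop), Ky _ _ (by simp), Kl hi]
          filter_upwards [Kw Ke] with s hs
          have := hr.trans hs.1
          simp only [Pi.zero_apply]; positivity
      _ ≤ oR (r^(-γ)/γ) + oR (r^(-γ)) * 1 := by
          gcongr
          · rw [← Kv hr1, integral_rpow (Or.inr ⟨by linarith, by rw [uIcc_of_le hr1]; intro h; linarith [h.1]⟩)]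
            rw [sub_add_cancel, Real.one_rpow, div_neg, ← neg_div]
            gcongr; linarith
          · refine Mm ?_ hG
            unfold LI; rw [nu_lint]
            exact lintegral_mono_set (fun s hs => hr.trans hs.1)
      _ = _ := by
          rw [mul_one, ← Mr PO PO]; congr 1; ring
  rw [Lg PO] at key
  linarith

end Rad

lemma exists_dom (P : PA) : ∃ B : ℝ → ℝ, (∀ r, 0 < r → 0 ≤ B r) ∧ Integrable (fun r => B r^mJ) (nu d) ∧
    ∀ v g, Rad v g → LI d qJ v ≤ 1 → LI d p g ≤ 1 → ∀ r, 0 < r → v r ≤ B r := by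
  have hd0 : (0:ℝ) < d := by exact_mod_cast P.hd
  have hp := P.hp
  have hq := P.hq
  have hqm := P.hqm
  obtain ⟨γ, hγ, hγ1, hγ2⟩ : ∃ γ : ℝ, 0 < γ ∧ dX-p ≤ γ*p ∧ γ*mJ < d := by
    refine ⟨max ((dX-p)/p) (d/(2*mJ)), lt_max_of_lt_right (by apply div_pos hd0; linarith), ?_, ?_⟩
    · have := Lf ((dX-p)/p) (d/(2*mJ))
      rwa [Mt LA] at this
    · rw [← Lw LA, max_lt_iff]
      constructor
      · rw [div_lt_div_iff₀ LA LA]; linarith [P.hs1]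
      · exact div_lt_div_of_pos_left hd0 LA LA
  set C : ℝ := dX^(1/qJ) + (1/γ+1) with hC
  have hC0 : 0 < C := by positivity
  refine ⟨fun r => if r ≤ 1 then C*r^(-γ) else C*r^(-(dX/qJ)), ?_, ?_, ?_⟩
  · intro r hr; dsimp only; split_ifs <;> positivity
  · rw [nu_integrable, ← Ioc_union_Ioi_eq_Ioi Ly]
    have ed : ∀ r : ℝ, 0 < r → r^dJ = r^(dX-1) := fun r hr => by
      rw [← Real.rpow_natCast, Nat.cast_sub P.hd]; simp
    apply IntegrableOn.union
    · have : IntegrableOn (fun r : ℝ => C^mJ * r^(d-1+(-γ)*mJ)) (Ioc 0 1) := by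
        apply Integrable.const_mul
        rw [← IntegrableOn, ← Kp Ly]
        apply intervalIntegral.intervalIntegrable_rpow'; linarith
      refine this.congr_fun (fun r hr => ?_) Ke
      have h0 := hr.1
      simp only [if_pos hr.2]
      rw [Kg hC0.le PO, Kr h0, Ks h0.le, ed r h0]; ring
    · have : IntegrableOn (fun r : ℝ => C^mJ * r^(d-1+(-(dX/qJ))*mJ)) (Ioi 1) := by
        apply Integrable.const_mul
        apply integrableOn_Ioi_rpow_of_lt _ Lz
        have : dX < d/qJ*mJ := by
          rw [Kt, Lw LA]
          nlinarith
        linarith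
      refine this.congr_fun (fun r hr => ?_) Ka
      have h0 : 0 < r := lt_trans Lz hr
      simp only [if_neg (not_le.2 (mem_Ioi.1 hr))]
      rw [Kg hC0.le PO, Kr h0, Ks h0.le, ed r h0]; ring
  · intro v g S hM hG r hr
    dsimp only
    split_ifs with h
    · have h1 := S.bd_zero P.hd hp hG hγ hγ1 hr h
      have h2 := S.bd_inf P.hd hq hM Lz
      rw [Real.one_rpow, mul_one] at h2
      have h3 : 1 ≤ r^(-γ) := Real.one_le_rpow_of_pos_of_le_one_of_nonpos hr h LA
      have : dX^(1/qJ) * 1 ≤ dX^(1/qJ) * r^(-γ) := by gcongr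
      rw [hC]; linarith
    · refine (S.bd_inf P.hd hq hM hr).trans ?_
      gcongr
      rw [hC]; have : 0 < 1/γ + 1 := by positivity
      linarith

lemma ofReal_rpow_cont {s : ℝ} (hs : 0 ≤ s) : Continuous (fun x : ℝ => oR (x^s)) :=
  ENNReal.continuous_ofReal.comp (Real.continuous_rpow_const hs)

lemma fatou_nu {s : ℝ} (hs : 0 ≤ s) {f : ℕ → ℝ → ℝ} {F : ℝ → ℝ} (hm : ∀ n, AEMeasurable (f n) (nu d))
    (hc : ∀ r, 0 < r → Tendsto (fun n => f n r) atTop (𝓝 (F r))) {K : ENNReal} (hK : ∀ n, LI d s (f n) ≤ K) :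
    LI d s F ≤ K := by
  calc LI d s F = ∫⁻ r, liminf (fun k => oR (f k r^s)) atTop ∂nu d := by
        apply lintegral_congr_ae
        filter_upwards [nu_pos_ae] with r hr
        exact (((ofReal_rpow_cont hs).tendsto _).comp (hc r hr)).liminf_eq.symm
    _ ≤ liminf (fun k => LI d s (f k)) atTop := by
        apply lintegral_liminf_le'
        intro k
        exact (ofReal_rpow_cont hs).measurable.comp_aemeasurable (hm k)
    _ ≤ liminf (fun _ : ℕ => K) atTop := liminf_le_liminf (.of_forall hK)
    _ = K := by simp

lemma compact (P : PA) {v g : ℕ → ℝ → ℝ} (S : ∀ n, Rad (v n) (g n))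
    (hM : ∀ n, LI d qJ (v n) ≤ 1) (hG : ∀ n, LI d p (g n) ≤ 1) :
    ∃ w k, Rad w k ∧ LI d qJ w ≤ 1 ∧ LI d p k ≤ 1 ∧ LI d mJ w ≠ ⊤ ∧ ∃ φ : ℕ → ℕ, StrictMono φ ∧
      Tendsto (fun n => LI d mJ (v (φ n))) atTop (𝓝 (LI d mJ w)) := by
  have hd0 : (0:ℝ) < d := by exact_mod_cast P.hd
  have hp := P.hp
  have hq := P.hq
  have hqm := P.hqm
  obtain ⟨B, hB0, hBi, hB⟩ := exists_dom P
  let ι := {i : ℚ // 0 < i}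
  have cpt : IsCompact (Set.pi univ (fun i : ι => Icc (0:ℝ) (B i.1))) := isCompact_univ_pi fun i => isCompact_Icc
  have ipos : ∀ i : ι, (0:ℝ) < (i.1:ℝ) := fun i => by exact_mod_cast i.2
  obtain ⟨x, -, φ, hφ, hx⟩ := cpt.tendsto_subseq (x := fun n (i : ι) => v n i.1) (fun n i _ =>
    ⟨(S n).nonneg (ipos i), hB _ _ (S n) (hM n) (hG n) _ (ipos i)⟩)
  rw [tendsto_pi_nhds] at hx
  have equi : ∀ r, 0 < r → ∀ ε, 0 < ε → ∃ i : ι, ∀ n, |v n i.1 - v n r| ≤ ε := by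
    intro r hr ε hε
    have t : Tendsto (fun T : ℝ => T^(1-p)/(r/2)^dJ) atTop (𝓝 (0/(r/2)^dJ)) := by
      apply Tendsto.div_const
      simpa using tendsto_rpow_neg_atTop (y := p-1) LA
    rw [zero_div] at t
    obtain ⟨T, hT, hT0⟩ := ((t.eventually (gt_mem_nhds (half_pos hε))).and (Mp 0)).exists
    have hlt : max (r/2) (r - ε/2/T) < r := by
      apply max_lt LA; have : 0 < ε/2/T := by positivity
      linarith
    obtain ⟨i, hi1, hi2⟩ := exists_rat_btwn hlt
    rw [max_lt_iff] at hi1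
    have i0 : (0:ℝ) < i := by linarith [hi1.1]
    refine ⟨⟨i, by exact_mod_cast i0⟩, fun n => ?_⟩
    have h1 := (S n).bd_diff hp (hG n) i0 hi2.le hT0
    have h2 := (S n).anti i0 hr hi2.le
    rw [abs_of_nonneg (by simpa using h2)]
    have h3 : T*(r-i) ≤ ε/2 := by
      rw [← le_div_iff₀' hT0]; linarith [hi1.2]
    have h4 : T^(1-p)/(i:ℝ)^dJ ≤ T^(1-p)/(r/2)^dJ := by
      gcongr; exact hi1.1.le
    linarith
  have hconv : ∀ r, ∃ l, 0 < r → Tendsto (fun n => v (φ n) r) atTop (𝓝 l) := by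
    intro r
    by_cases hr : 0 < r
    swap
    · exact ⟨0, fun h => absurd h hr⟩
    have : CauchySeq (fun n => v (φ n) r) := by
      rw [Metric.cauchySeq_iff]
      intro ε hε
      obtain ⟨i, hi⟩ := equi r hr (ε/4) LA
      obtain ⟨N, hN⟩ := Metric.cauchySeq_iff.1 (hx i).cauchySeq (ε/4) LA
      refine ⟨N, fun a ha b hb => ?_⟩
      have h1 := hN a ha b hb
      rw [Real.dist_eq, abs_lt] at h1 ⊢
      have h2 := abs_le.1 (hi (φ a))
      have h3 := abs_le.1 (hi (φ b))
      simp only [Function.comp] at h1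
      constructor <;> linarith [h1.1, h1.2, h2.1, h2.2, h3.1, h3.2]
    obtain ⟨l, hl⟩ := cauchySeq_tendsto_of_complete this
    exact ⟨l, fun _ => hl⟩
  choose w hw using hconv
  have w0 : ∀ r, 0 < r → 0 ≤ w r := fun r hr => ge_of_tendsto (hw r hr) (.of_forall fun n => (S _).nonneg hr)
  have wanti : AntitoneOn w (Ioi 0) := fun a ha b hb hab =>
    le_of_tendsto_of_tendsto (hw b hb) (hw a ha) (.of_forall fun n => (S _).anti ha hb hab)
  have wlim : Tendsto w atTop (𝓝 0) := by
    have t : Tendsto (fun r : ℝ => dX^(1/qJ) * r^(-(dX/qJ))) atTop (𝓝 (dX^(1/qJ) * 0)) :=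
      (tendsto_rpow_neg_atTop PO).const_mul _
    rw [Mn] at t
    refine tendsto_of_tendsto_of_tendsto_of_le_of_le' tendsto_const_nhds t ?_ ?_
    · filter_upwards [Mp 0] with r hr using w0 r hr
    · filter_upwards [Mp 0] with r hr
      exact le_of_tendsto (hw r hr) (.of_forall fun n => (S _).bd_inf P.hd hq (hM _) hr)
  have wdq : ∀ k : ℕ, ∫⁻ r, oR (((w r - w (r + 1/((k:ℝ)+1)))/(1/((k:ℝ)+1)))^p) ∂nu d ≤ 1 := by
    intro k
    set h : ℝ := 1/((k:ℝ)+1)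
    have hh : 0 < h := by positivity
    apply fatou_nu (f := fun n r => (v (φ n) r - v (φ n) (r+h))/h) (s := p) LA
    · intro n
      apply AEMeasurable.mono_ac _ nu_ac
      apply AEMeasurable.div_const
      apply (S _).vm.sub
      apply aemeasurable_restrict_of_antitoneOn Ka
      intro x hx y hy hxy
      simp only [mem_Ioi] at hx hy
      exact (S _).anti (by simp; linarith) (by simp; linarith) LA
    · intro r hr
      exact ((hw r hr).sub (hw (r+h) LA)).div_const h
    · intro n
      exact ((S _).dq_le hp hh).trans (hG _)
  obtain ⟨k, hk, hk1⟩ := riesz (K := 1) (Kk := fun _ => 1) hp wanti wlim (h := fun k : ℕ => 1/((k:ℝ)+1)) (fun k => by positivity)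
    Lc (by simp) tendsto_const_nhds wdq
  have hBi2 : ∫⁻ r, oR (B r^mJ) ∂nu d ≠ ⊤ := hBi.lintegral_lt_top.ne
  refine ⟨w, k, hk, ?_, hk1, ?_, φ, hφ, ?_⟩
  · exact fatou_nu LA (fun n => (S (φ n)).vm') hw (fun n => hM _)
  · refine ne_top_of_le_ne_top hBi2 (lintegral_mono_ae ?_)
    filter_upwards [nu_pos_ae] with r hr
    have h1 := w0 r hr
    have h2 : w r ≤ B r := le_of_tendsto (hw r hr) (.of_forall fun n => hB _ _ (S _) (hM _) (hG _) _ hr)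
    exact Ki (Ko h1 h2 LA)
  · apply tendsto_lintegral_of_dominated_convergence' (fun r => oR (B r^mJ))
    · intro n
      exact (ofReal_rpow_cont LA).measurable.comp_aemeasurable (S _).vm'
    · intro n
      filter_upwards [nu_pos_ae] with r hr
      exact Ki (Ko ((S _).nonneg hr) (hB _ _ (S _) (hM _) (hG _) _ hr) LA)
    · exact hBi2
    · filter_upwards [nu_pos_ae] with r hr
      exact ((ofReal_rpow_cont LA).tendsto _).comp (hw r hr)

lemma exists_max (P : PA) : ∃ w k, Rad w k ∧ LI d qJ w ≤ 1 ∧ LI d p k ≤ 1 ∧ LI d mJ w ≠ ⊤ ∧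
    ∀ v g, Rad v g → LI d qJ v ≤ 1 → LI d p g ≤ 1 → LI d mJ v ≤ LI d mJ w := by
  set A : Set ENNReal := {x | ∃ v g, Rad v g ∧ LI d qJ v ≤ 1 ∧ LI d p g ≤ 1 ∧ x = LI d mJ v} with hA
  have hp := P.hp
  have hq := P.hq
  have ne : A.Nonempty := by
    refine ⟨_, fun _ => 0, fun _ => 0, ⟨Mv, fun _ => Lj, fun _ _ => by simp, fun _ _ => by simp⟩, ?_, ?_, rfl⟩
    · simp [LI, Kd (show q + 1 ≠ 0 by linarith)]
    · simp [LI, Kd (show p ≠ 0 by linarith)]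
  obtain ⟨x, hxm, hx, hxA⟩ := exists_seq_tendsto_sSup ne (OrderTop.bddAbove A)
  choose v g S hM hG he using hxA
  obtain ⟨w, k, h1, h2, h3, h4, φ, hφ, h5⟩ := compact P S hM hG
  refine ⟨w, k, h1, h2, h3, h4, fun v' g' S' hM' hG' => ?_⟩
  have : LI d mJ w = sSup A := by
    refine tendsto_nhds_unique h5 ?_
    have := hx.comp hφ.tendsto_atTop
    refine this.congr fun n => ?_
    simp [he]
  rw [this]
  exact le_sSup ⟨v', g', S', hM', hG', rfl⟩

noncomputable def ea (d : ℕ) (p q m : ℝ) : ℝ := (d*p-(m+1)*(d-p))/(d*p-(q+1)*(d-p))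

local notation "eX" => ea d p q m

noncomputable def eb (d : ℕ) (p q m : ℝ) : ℝ := d*(m-q)/(d*p-(q+1)*(d-p))

local notation "eY" => eb d p q m

namespace Par

lemma d0 (P : PA) : (0:ℝ) < d := by exact_mod_cast P.hd

lemma den (P : PA) : 0 < d*p-qJ*(dX-p) := by
  have := P.hs1; have := P.hqm; have := P.hq; have := P.d0; have := P.hp
  rcases Mz dX p with h | h
  · have h1 : qJ*(dX-p) ≤ 0 := Md LA LA
    have : 0 < dX*p := by positivity
    linarith
  · nlinarith

lemma a0 (P : PA) : 0 < eX := div_pos (by linarith [P.hs1]) P.den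

lemma b0 (P : PA) : 0 < eY := div_pos (mul_pos P.d0 (by linarith [P.hqm])) P.den

lemma e1 (P : PA) : eX * qJ + eY * p = m+1 := by
  have := P.den.ne'
  unfold ea eb; rw [Kt, Kt, ← add_div, div_eq_iff this]; ring

lemma e2 (P : PA) : eX * d + eY * (d-p) = d := by
  have := P.den.ne'
  unfold ea eb; rw [Kt, Kt, ← add_div, div_eq_iff this]; ring

lemma q0 (P : PA) : 0 < q + 1 := by linarith [P.hq]

lemma m0 (P : PA) : 0 < m + 1 := by linarith [P.hq, P.hqm]

lemma p0 (P : PA) : 0 < p := by linarith [P.hp]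

lemma scal_id (P : PA) {A l x y : ℝ} (hA : 0 < A) (hl : 0 < l) (hx : 0 ≤ x) (hy : 0 ≤ y) :
    (A^qJ * l^(-dX) * x)^(eX) * (A^p * l^(p-d) * y)^(eY) =
      A^mJ * l^(-dX) * (x^(eX) * y^(eY)) := by
  rw [Kg PO hx, Kg PO hy, Kg PO PO,
    Kg PO PO, ← Ks hA.le, ← Ks hA.le, ← Ks hl.le, ← Ks hl.le]
  have e1 : A^mJ = A^(qJ*eX) * A^(p*eY) := by
    rw [← Kr hA, ← P.e1]; ring_nf
  have e2 : l^(-dX) = l^(-dX*eX) * l^((p-d)*eY) := by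
    rw [← Kr hl]; congr 1; linarith [P.e2]
  rw [e1, e2]; ring

end Par

noncomputable def RI (d : ℕ) (s : ℝ) (v : ℝ → ℝ) : ℝ := ∫ r, v r ^ s ∂nu d

lemma li_iff {s : ℝ} (hm : AEMeasurable v (nu d)) (h0 : ∀ r, 0 < r → 0 ≤ v r) :
    LI d s v ≠ ⊤ ↔ Integrable (fun r => v r ^ s) (nu d) := by
  have hn : 0 ≤ᵐ[nu d] fun r => v r ^ s := by
    filter_upwards [nu_pos_ae] with r hr using Kb (h0 r hr) s
  constructor
  · intro h
    refine ⟨(hm.pow_const s).aestronglyMeasurable, ?_⟩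
    rw [hasFiniteIntegral_iff_ofReal hn]
    exact lt_top_iff_ne_top.2 h
  · intro h; exact h.lintegral_lt_top.ne

lemma li_eq {s : ℝ} (h0 : ∀ r, 0 < r → 0 ≤ v r) (hi : Integrable (fun r => v r ^ s) (nu d)) :
    LI d s v = oR (RI d s v) := by
  unfold LI RI
  rw [Kl hi]
  filter_upwards [nu_pos_ae] with r hr using Kb (h0 r hr) s

lemma RI_nonneg {s : ℝ} (h0 : ∀ r, 0 < r → 0 ≤ v r) : 0 ≤ RI d s v := by
  apply integral_nonneg_of_ae
  filter_upwards [nu_pos_ae] with r hr using Kb (h0 r hr) s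

lemma pow_scale (hd : 1 ≤ d) {A l s : ℝ} (hA : 0 ≤ A) (hl : 0 < l) (h0 : ∀ r, 0 < r → 0 ≤ v r) {r : ℝ} (hr : 0 < r) :
    r^dJ * (A * v (l*r))^s = A^s * l^(-dX) * l * ((l*r)^dJ * v (l*r)^s) := by
  rw [Kg hA (h0 _ PO), mul_pow]
  have : l^(-dX) * l * l^dJ = 1 := by
    rw [Mx, ← pow_succ', Nat.sub_add_cancel hd, Real.rpow_neg hl.le, Real.rpow_natCast]
    exact inv_mul_cancel₀ PO
  calc _ = (l^(-dX) * l * l^dJ) * (r^dJ * (A^s * v (l*r)^s)) := by rw [this, one_mul]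
    _ = _ := by ring

lemma RI_scale (hd : 1 ≤ d) {A l s : ℝ} (hA : 0 ≤ A) (hl : 0 < l) (h0 : ∀ r, 0 < r → 0 ≤ v r) :
    RI d s (fun r => A * v (l*r)) = A^s * l^(-dX) * RI d s v := by
  unfold RI
  rw [nu_int, nu_int, setIntegral_congr_fun Ka (fun r hr => pow_scale hd hA hl h0 hr),
    integral_const_mul, integral_comp_mul_left_Ioi (fun r => r^dJ * v r^s) 0 hl, Mn, smul_eq_mul]
  field_simp

lemma int_scale (hd : 1 ≤ d) {A l s : ℝ} (hA : 0 ≤ A) (hl : 0 < l) (h0 : ∀ r, 0 < r → 0 ≤ v r)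
    (hi : Integrable (fun r => v r^s) (nu d)) : Integrable (fun r => (A * v (l*r))^s) (nu d) := by
  rw [nu_integrable] at hi ⊢
  refine IntegrableOn.congr_fun ?_ (fun r hr => (pow_scale hd hA hl h0 hr).symm) Ka
  apply Integrable.const_mul
  have := (integrableOn_Ioi_comp_mul_left_iff (fun r => r^dJ * v r^s) 0 hl).2 (by rwa [Mn])
  exact this

structure Adm (d : ℕ) (p q : ℝ) (v g : ℝ → ℝ) : Prop extends Rad v g where
  iM : Integrable (fun r => v r^(q+1)) (nu d)
  iG : Integrable (fun r => g r^p) (nu d)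

local notation "AD" => Adm d p q

lemma Rad.scale (S : Rad v g) {A l : ℝ} (hA : 0 ≤ A) (hl : 0 < l) :
    Rad (fun r => A * v (l*r)) (fun r => A*l * g (l*r)) := by
  refine ⟨(S.gm.comp (measurable_const_mul l)).const_mul _, fun r => La PO (S.g0 _), fun r hr => ?_, fun r hr => ?_⟩
  · apply Integrable.const_mul
    exact (integrableOn_Ioi_comp_mul_left_iff g r hl).2 (S.gi _ PO)
  · rw [integral_const_mul, integral_comp_mul_left_Ioi g r hl, S.hv _ PO, smul_eq_mul]
    field_simp

lemma Adm.scale (S : AD v g) (hd : 1 ≤ d) {A l : ℝ} (hA : 0 ≤ A) (hl : 0 < l) :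
    AD (fun r => A * v (l*r)) (fun r => A*l * g (l*r)) :=
  ⟨S.toRad.scale hA hl, int_scale hd hA hl (fun _ hr => S.nonneg hr) S.iM, int_scale hd PO hl (fun r _ => S.g0 r) S.iG⟩

lemma RIg_scale (hd : 1 ≤ d) {A l : ℝ} (hA : 0 ≤ A) (hl : 0 < l) (h0 : ∀ r, 0 < r → 0 ≤ g r) :
    RI d p (fun r => A * l * g (l*r)) = A^p * l^(p-dX) * RI d p g := by
  rw [RI_scale hd PO hl h0, Kg hA hl.le, sub_eq_add_neg, Kr hl]; ring

lemma Adm.zero_of (P : PA) (S : AD v g) (h : RI d qJ v = 0 ∨ RI d p g = 0) :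
    ∀ r, 0 < r → v r = 0 := by
  rcases h with h | h
  · unfold RI at h
    rw [Lo _ S.iM] at h
    · intro r hr
      by_contra hc
      have hpos : 0 < v r := Kf (S.nonneg hr) (Ne.symm hc)
      have h2 := ae_nu h
      rw [ae_restrict_iff' Ka] at h2
      have h3 : volume (Ioo 0 r) = 0 := by
        refine measure_mono_null (fun x hx => ?_) h2
        simp only [mem_compl_iff, Le, not_forall]
        refine ⟨hx.1, fun h => ?_⟩
        have := S.anti (a := x) (b := r) hx.1 hr hx.2.le
        have : 0 < v x ^qJ := by have := Kn hpos this; positivity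
        exact this.ne' h
      simp at h3; linarith
    · filter_upwards [nu_pos_ae] with r hr using Kb (S.nonneg hr) _
  · unfold RI at h
    rw [Lo _ S.iG] at h
    · intro r hr
      rw [S.hv r hr]
      apply integral_eq_zero_of_ae
      refine ae_restrict_of_ae_restrict_of_subset (Ioi_subset_Ioi hr.le) ?_
      filter_upwards [ae_nu h] with x hx
      exact (Real.rpow_eq_zero (S.g0 x) P.p0.ne').1 hx
    · filter_upwards with r using Kb (S.g0 r) _

lemma exists_scale (P : PA) {x y : ℝ} (hx : 0 < x) (hy : 0 < y) : ∃ A l : ℝ, 0 < A ∧ 0 < l ∧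
    A^qJ * l^(-dX) * x = 1 ∧ A^p * l^(p-dX) * y = 1 := by
  have hD := P.den.ne'
  have hd := P.d0.ne'
  set X := Real.log x
  set Y := Real.log y
  set α := ((d-p)*X - d*Y)/(d*p-qJ*(dX-p)) with hα
  set β := (α*qJ+X)/d with hβ
  refine ⟨Ll α, Ll β, Real.exp_pos _, Real.exp_pos _, ?_, ?_⟩
  · rw [← Real.exp_log hx, ← Real.exp_mul, ← Real.exp_mul, ← Real.exp_add, ← Real.exp_add, Real.exp_eq_one_iff]
    rw [hβ]; field_simp; ring
  · rw [← Real.exp_log hy, ← Real.exp_mul, ← Real.exp_mul, ← Real.exp_add, ← Real.exp_add, Real.exp_eq_one_iff]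
    change α * p + β * (p-d) + Y = 0
    have h1 : α * (d*p-qJ*(dX-p)) = (d-p)*X - d*Y := div_mul_cancel₀ _ hD
    have h2 : β * d = α*qJ+X := div_mul_cancel₀ _ hd
    have h3 : d * (α * p + β * (p-d) + Y) = 0 := by linear_combination h1 + (p-d)*h2
    exact (mul_eq_zero.1 h3).resolve_left hd

def IsMax (d : ℕ) (p q m : ℝ) (v g : ℝ → ℝ) : Prop := ∀ w h, Adm d p q w h →
  Integrable (fun r => w r^(m+1)) (nu d) ∧
  RI d (m+1) w * (RI d (q+1) v^(ea d p q m) * RI d p g^(eb d p q m)) ≤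
    RI d (m+1) v * (RI d (q+1) w^(ea d p q m) * RI d p h^(eb d p q m))

lemma exists_ismax (P : PA) {w0 h0 : ℝ → ℝ} (S0 : AD w0 h0) (hp0 : 0 < RI d mJ w0) :
    ∃ v g, AD v g ∧ Integrable (fun r => v r^mJ) (nu d) ∧ 0 < RI d mJ v ∧
      RI d qJ v = eX*qJ/mJ * RI d mJ v ∧ RI d p g = eY*p/mJ * RI d mJ v ∧
      IsMax d p q m v g := by
  have hd := P.hd
  obtain ⟨v, g, S, hM, hG, hI, hmax⟩ := exists_max P
  have n0 : ∀ r, 0 < r → 0 ≤ v r := fun r hr => S.nonneg hr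
  have SA : AD v g := ⟨S, (li_iff S.vm' n0).1 (ne_top_of_le_ne_top (by simp) hM),
    (li_iff S.gm.aemeasurable (fun r _ => S.g0 r)).1 (ne_top_of_le_ne_top (by simp) hG)⟩
  have iI := (li_iff S.vm' n0).1 hI
  have hM1 : RI d qJ v ≤ 1 := by rw [li_eq n0 SA.iM] at hM; simpa using hM
  have hG1 : RI d p g ≤ 1 := by rw [li_eq (fun r _ => S.g0 r) SA.iG] at hG; simpa using hG
  have hM0 : 0 ≤ RI d qJ v := RI_nonneg n0
  have hG0 : 0 ≤ RI d p g := RI_nonneg (fun r _ => S.g0 r)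
  have ap := P.a0
  have bp := P.b0

  have key : ∀ w h, AD w h → Integrable (fun r => w r^mJ) (nu d) ∧
      RI d mJ w ≤ RI d mJ v * (RI d qJ w^(eX) * RI d p h^(eY)) := by
    intro w h W
    have wn : ∀ r, 0 < r → 0 ≤ w r := fun r hr => W.nonneg hr
    have x0 : 0 ≤ RI d qJ w := RI_nonneg wn
    have y0 : 0 ≤ RI d p h := RI_nonneg (fun r _ => W.g0 r)
    rcases eq_or_lt_of_le x0 with hx | hx
    · have hz := W.zero_of P (Or.inl hx.symm)
      have e : (fun r => w r^mJ) =ᵐ[nu d] fun _ => 0 := by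
        filter_upwards [nu_pos_ae] with r hr
        rw [hz r hr, Kd P.m0.ne']
      refine ⟨(integrable_zero _ _ _).congr e.symm, ?_⟩
      have : RI d mJ w = 0 := by unfold RI; rw [Nb e]; simp
      rw [this]; have := RI_nonneg (d := d) (s := m+1) n0; positivity
    rcases eq_or_lt_of_le y0 with hy | hy
    · have hz := W.zero_of P (Or.inr hy.symm)
      have e : (fun r => w r^mJ) =ᵐ[nu d] fun _ => 0 := by
        filter_upwards [nu_pos_ae] with r hr
        rw [hz r hr, Kd P.m0.ne']
      refine ⟨(integrable_zero _ _ _).congr e.symm, ?_⟩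
      have : RI d mJ w = 0 := by unfold RI; rw [Nb e]; simp
      rw [this]; have := RI_nonneg (d := d) (s := m+1) n0; positivity
    obtain ⟨A, l, hA, hl, h1, h2⟩ := exists_scale P hx hy
    have WS := W.scale hd hA.le hl
    have wsn : ∀ r, 0 < r → 0 ≤ A * w (l*r) := fun r hr => La hA.le (wn _ PO)
    have z1 := hmax _ _ WS.toRad (by rw [li_eq wsn WS.iM, RI_scale hd hA.le hl wn, h1]; simp)
      (by rw [li_eq (fun r _ => WS.g0 r) WS.iG, RIg_scale hd hA.le hl (fun r _ => W.g0 r), h2]; simp)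
    have fin := (li_iff WS.vm' wsn).1 (ne_top_of_le_ne_top hI z1)
    have i2 : Integrable (fun r => w r^mJ) (nu d) := by
      have := int_scale hd (A := A⁻¹) (l := l⁻¹) PO PO wsn fin
      refine this.congr (.of_forall fun r => ?_)
      dsimp only
      congr 1; rw [mul_inv_cancel_left₀ hl.ne', inv_mul_cancel_left₀ hA.ne']
    refine ⟨i2, ?_⟩
    rw [li_eq wsn fin, li_eq n0 iI, Lg (RI_nonneg n0), RI_scale hd hA.le hl wn] at z1
    have id := P.scal_id hA hl x0 y0
    rw [h1, h2] at id
    simp only [Real.one_rpow, mul_one] at id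
    have pos : 0 < RI d qJ w^(eX) * RI d p h^(eY) := by positivity
    calc RI d mJ w = (A^mJ*l^(-dX) * RI d mJ w) * (RI d qJ w^(eX) * RI d p h^(eY)) := by
          linear_combination RI d mJ w * id
      _ ≤ _ := by gcongr
  have Ipos : 0 < RI d mJ v := by
    rcases eq_or_lt_of_le (RI_nonneg (d := d) (s := m+1) n0) with h | h
    · have := (key _ _ S0).2; rw [← h, zero_mul] at this; linarith
    · exact h
  have hle1 : RI d qJ v^(eX) ≤ 1 := Real.rpow_le_one hM0 hM1 ap.le
  have hle2 : RI d p g^(eY) ≤ 1 := Real.rpow_le_one hG0 hG1 bp.le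
  have prod1 : 1 ≤ RI d qJ v^(eX) * RI d p g^(eY) := by
    have := (key _ _ SA).2
    by_contra hc; push Not at hc
    nlinarith
  have hMe : RI d qJ v = 1 := by
    by_contra hc
    have h1 := Real.rpow_lt_one hM0 (Kf hM1 hc) ap
    have h2 : 0 ≤ RI d p g^(eY) := by positivity
    have h3 : 0 ≤ RI d qJ v^(eX) := by positivity
    nlinarith
  have hGe : RI d p g = 1 := by
    by_contra hc
    have h1 := Real.rpow_lt_one hG0 (Kf hG1 hc) bp
    have h2 : 0 ≤ RI d p g^(eY) := by positivity
    have h3 : 0 ≤ RI d qJ v^(eX) := by positivity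
    nlinarith
  set I := RI d mJ v with hIdef
  set t := eY*p/mJ with ht
  set t' := eX*qJ/mJ with ht'
  have m0 := P.m0
  have p0 := P.p0
  have q0 := P.q0
  have t0 : 0 < t := by positivity
  have t0' : 0 < t' := by positivity
  have mq : 0 < m - q := by linarith [P.hqm]
  set A : ℝ := (1/(t'*I))^(1/(m-q)) with hA
  have A0 : 0 < A := by positivity
  set l : ℝ := (t*A^(m+1-p)*I)^(1/p) with hl
  have l0 : 0 < l := by positivity
  have eA : A^(m-q) = 1/(t'*I) := by rw [hA, ← Ks PO, one_div_mul_cancel mq.ne', Ku]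
  have el : l^p = t*A^(m+1-p)*I := by rw [hl, ← Ks PO, one_div_mul_cancel p0.ne', Ku]
  have VS := SA.scale hd A0.le l0
  refine ⟨_, _, VS, int_scale hd A0.le l0 n0 iI, ?_, ?_, ?_, ?_⟩
  · rw [RI_scale hd A0.le l0 n0]; positivity
  · rw [RI_scale hd A0.le l0 n0, RI_scale hd A0.le l0 n0, hMe, ← hIdef]
    have : A^mJ = A^qJ * A^(m-q) := by rw [← Kr A0]; ring_nf
    rw [this, eA]; field_simp
  · rw [RIg_scale hd A0.le l0 (fun r _ => S.g0 r), RI_scale hd A0.le l0 n0, hGe, ← hIdef]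
    have : A^mJ = A^p * A^(m+1-p) := by rw [← Kr A0]; ring_nf
    rw [sub_eq_add_neg, Kr l0, el, this]; ring
  · intro w h W
    refine ⟨(key w h W).1, ?_⟩
    rw [RI_scale hd A0.le l0 n0, RI_scale hd A0.le l0 n0, RIg_scale hd A0.le l0 (fun r _ => S.g0 r),
      P.scal_id A0 l0 hM0 hG0, hMe, hGe, Real.one_rpow, Real.one_rpow, mul_one, mul_one]
    have := (key w h W).2
    have c0 : 0 < A^mJ*l^(-dX) := by positivity
    have := Kq this c0.le
    linarith

lemma pow_tangent {s A B : ℝ} (hs : 1 ≤ s) (hA : 0 ≤ A) (hAB : 0 ≤ A + B) :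
    A^s + s*(A^(s-1)*B) ≤ (A+B)^s := by
  rcases eq_or_lt_of_le hA with h | h
  · subst h
    rcases eq_or_lt_of_le hs with h1 | h1
    · subst h1; simp
    · rw [Kd LA, Kd LA]
      simp; simp at hAB; positivity
  · have h1 := one_add_mul_self_le_rpow_one_add (s := B/A) (by rw [Ms h]; linarith) hs
    have h2 := Kq h1 (Kb hA s)
    rw [← Real.mul_rpow hA (by have : 1 + B/A = (A+B)/A := by field_simp
                               rw [this]; positivity)] at h2
    have e1 : A*(1+B/A) = A+B := by field_simp
    have e2 : A^s = A^(s-1)*A := by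
      nth_rewrite 3 [← Ku A]; rw [← Kr h]; ring_nf
    rw [e1] at h2
    refine Mm (le_of_eq ?_) h2
    rw [mul_add, mul_one]; nth_rewrite 3 [e2]; field_simp

lemma pow_convex {s A B ε : ℝ} (hs : 1 ≤ s) (hA : 0 ≤ A) (hAB : 0 ≤ A + B) (h0 : 0 ≤ ε) (h1 : ε ≤ 1) :
    (A+ε*B)^s ≤ A^s + ε*((A+B)^s - A^s) := by
  have := (convexOn_rpow hs).2 (show A ∈ Ici 0 from hA) (show A+B ∈ Ici 0 from hAB) (show 0 ≤ 1-ε by linarith) h0 (by ring)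
  simp only [smul_eq_mul] at this
  have e : (1-ε)*A + ε*(A+B) = A+ε*B := by ring
  rw [e] at this; linarith

lemma int_deriv {μ : Measure ℝ} {s : ℝ} (hs : 1 ≤ s) {A B : ℝ → ℝ} (hAm : AEMeasurable A μ) (hBm : AEMeasurable B μ)
    (hA : ∀ᵐ r ∂μ, 0 ≤ A r) (hAB : ∀ᵐ r ∂μ, 0 ≤ A r + B r) (iA : Integrable (fun r => A r^s) μ)
    (iAB : Integrable (fun r => (A r + B r)^s) μ) :
    HasDerivWithinAt (fun ε => ∫ r, (A r + ε * B r)^s ∂μ) (s * ∫ r, A r^(s-1) * B r ∂μ) (Ici 0) 0 := by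
  have iε : ∀ ε, 0 ≤ ε → ε ≤ 1 → Integrable (fun r => (A r + ε * B r)^s) μ := by
    intro ε h0 h1
    refine Lp (iA.add ((iAB.sub iA).const_mul ε)) (((hAm.add (hBm.const_mul ε)).pow_const s).aestronglyMeasurable) ?_
    filter_upwards [hA, hAB] with r h2 h3
    rw [Kc]
    · exact pow_convex hs h2 h3 h0 h1
    · apply Kb; nlinarith
  rw [hasDerivWithinAt_iff_tendsto_slope, Ici_sdiff_left, ← integral_const_mul]
  have t : Tendsto (fun ε => ∫ r, ((A r + ε*B r)^s - A r^s)/ε ∂μ) (𝓝[>] 0) (𝓝 (∫ r, s*(A r^(s-1) * B r) ∂μ)) := by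
    apply tendsto_integral_filter_of_dominated_convergence (fun r => s*A r^s + (A r + B r)^s)
    · filter_upwards with ε
      exact (((hAm.add (hBm.const_mul ε)).pow_const s).sub (hAm.pow_const s)).div_const ε |>.aestronglyMeasurable
    · filter_upwards [Ioc_mem_nhdsGT Lz] with ε hε
      filter_upwards [hA, hAB] with r h2 h3
      have c := pow_convex hs h2 h3 hε.1.le hε.2
      have h4 : 0 ≤ A r + ε * B r := by nlinarith [hε.1, hε.2]
      have tn := pow_tangent (B := ε * B r) hs h2 h4
      have p1 : 0 ≤ A r^s := Kb h2 s
      have p2 : 0 ≤ (A r + B r)^s := Kb h3 s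
      have p3 : 0 ≤ A r^(s-1) := Kb h2 _
      have e2 : A r^s = A r^(s-1)*A r := by
        rcases eq_or_lt_of_le h2 with h | h
        · rw [← h, Mn, Kd LA]
        · nth_rewrite 3 [← Ku (A r)]; rw [← Kr h]; ring_nf
      rw [Mk, abs_le]
      constructor
      · rw [Ms hε.1]
        have h5 : A r^(s-1)*(-A r) ≤ A r^(s-1) * B r := by gcongr; linarith
        have h6 : s * ε * (A r^(s-1)*(-A r)) ≤ s * ε * (A r^(s-1) * B r) := by
          have := hε.1; gcongr
        have h7 : 0 ≤ ε * (A r + B r)^s := La hε.1.le p2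
        have h8 : s * ε * (A r^(s-1)*(-A r)) = -(s * ε * A r^s) := by rw [e2]; ring
        linarith
      · rw [Mt hε.1]
        have h7 : 0 ≤ s * A r^s * ε := by have := hε.1; positivity
        have h8 : 0 ≤ ε * A r^s := La hε.1.le p1
        linarith
    · exact (iA.const_mul s).add iAB
    · filter_upwards [hA] with r h2
      have h1 : HasDerivAt (fun ε => A r + ε * B r) (B r) 0 := by
        simpa using ((hasDerivAt_id (0:ℝ)).mul_const (B r)).const_add (A r)
      have h3 := h1.rpow_const (p := s) (Or.inr hs)
      have h4 := (hasDerivWithinAt_iff_tendsto_slope' (s := Ioi 0) (by simp)).1 h3.hasDerivWithinAt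
      simp only [zero_mul, add_zero] at h4
      have e : B r * s * A r^(s-1) = s*(A r^(s-1) * B r) := by ring
      rw [e] at h4
      refine h4.congr fun ε => ?_
      simp [slope_def_field]
  refine t.congr' ?_
  filter_upwards [Ioc_mem_nhdsGT Lz] with ε hε
  rw [slope_def_field, integral_div, integral_sub (iε ε hε.1.le hε.2) iA]
  simp

lemma deriv_nonpos {f : ℝ → ℝ} {f' : ℝ} (h : HasDerivWithinAt f f' (Ici 0) 0) (hle : ∀ ε, 0 < ε → ε ≤ 1 → f ε ≤ f 0) :
    f' ≤ 0 := by
  rw [hasDerivWithinAt_iff_tendsto_slope, Ici_sdiff_left] at h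
  refine le_of_tendsto h ?_
  filter_upwards [Ioc_mem_nhdsGT Lz] with ε hε
  rw [slope_def_field]
  exact div_nonpos_of_nonpos_of_nonneg (by linarith [hle ε hε.1 hε.2]) (by linarith [hε.1])

lemma Adm.path (P : PA) (S : AD v g) {v1 g1 : ℝ → ℝ} (S1 : AD v1 g1) {ε : ℝ} (h0 : 0 ≤ ε) (h1 : ε ≤ 1) :
    AD (fun r => v r + ε * (v1 r - v r)) (fun r => g r + ε * (g1 r - g r)) := by
  have gn : ∀ r, 0 ≤ g r + ε * (g1 r - g r) := fun r => by nlinarith [S.g0 r, S1.g0 r]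
  have vn : ∀ r, 0 < r → 0 ≤ v r + ε * (v1 r - v r) := fun r hr => by nlinarith [S.nonneg hr, S1.nonneg hr]
  refine ⟨⟨?_, gn, fun r hr => ?_, fun r hr => ?_⟩, ?_, ?_⟩
  · exact S.gm.add ((S1.gm.sub S.gm).const_mul ε)
  · exact (S.gi r hr).add (((S1.gi r hr).sub (S.gi r hr)).const_mul ε)
  · have hi : IntegrableOn (fun s => g1 s - g s) (Ioi r) := (S1.gi r hr).sub (S.gi r hr)
    rw [integral_add (S.gi r hr) (hi.const_mul ε), integral_const_mul,
      integral_sub (S1.gi r hr) (S.gi r hr), S.hv r hr, S1.hv r hr]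
  · refine Lp (S.iM.add ((S1.iM.sub S.iM).const_mul ε)) (((S.vm'.add ((S1.vm'.sub S.vm').const_mul ε)).pow_const _).aestronglyMeasurable) ?_
    filter_upwards [nu_pos_ae] with r hr
    rw [Kc (Kb (vn r hr) _)]
    have := pow_convex (s := q+1) (A := v r) (B := v1 r - v r) (by linarith [P.hq]) (S.nonneg hr) (by simpa using S1.nonneg hr) h0 h1
    simpa using this
  · refine Lp (S.iG.add ((S1.iG.sub S.iG).const_mul ε)) (((S.gm.add ((S1.gm.sub S.gm).const_mul ε)).aemeasurable.pow_const _).aestronglyMeasurable) ?_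
    filter_upwards with r
    rw [Kc (Kb (gn r) _)]
    have := pow_convex (s := p) (A := g r) (B := g1 r - g r) P.hp.le (S.g0 r) (by simpa using S1.g0 r) h0 h1
    simpa using this

lemma el (P : PA) (S : AD v g) (iI : Integrable (fun r => v r^mJ) (nu d)) (hI : 0 < RI d mJ v)
    (hM : RI d qJ v = eX*qJ/mJ * RI d mJ v) (hG : RI d p g = eY*p/mJ * RI d mJ v)
    (hmax : IsMax d p q m v g) {v1 g1 : ℝ → ℝ} (S1 : AD v1 g1) :
    (∫ r, v r^m * (v1 r - v r) ∂nu d) - (∫ r, v r^q * (v1 r - v r) ∂nu d) - (∫ r, g r^pJ * (g1 r - g r) ∂nu d) ≤ 0 := by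
  have m0 := P.m0
  have p0 := P.p0
  have q0 := P.q0
  have a0 := P.a0
  have b0 := P.b0
  have hM0 : 0 < RI d qJ v := by rw [hM]; positivity
  have hG0 : 0 < RI d p g := by rw [hG]; positivity
  have vae : ∀ᵐ r ∂nu d, 0 ≤ v r := by filter_upwards [nu_pos_ae] with r hr using S.nonneg hr
  have v1ae : ∀ᵐ r ∂nu d, 0 ≤ v r + (v1 r - v r) := by
    filter_upwards [nu_pos_ae] with r hr; simpa using S1.nonneg hr
  have vdm : AEMeasurable (fun r => v1 r - v r) (nu d) := S1.vm'.sub S.vm'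
  have D1 := int_deriv (s := m+1) (by linarith [P.hq, P.hqm]) S.vm' vdm vae v1ae iI (by simpa using (hmax _ _ S1).1)
  have D2 := int_deriv (s := q+1) (by linarith [P.hq]) S.vm' vdm vae v1ae S.iM (by simpa using S1.iM)
  have D3 := int_deriv (μ := nu d) (s := p) P.hp.le S.gm.aemeasurable (S1.gm.sub S.gm).aemeasurable (.of_forall S.g0)
    (.of_forall fun r => by simpa using S1.g0 r) S.iG (by simpa using S1.iG)
  simp only [add_sub_cancel_right] at D1 D2
  set x := ∫ r, v r^m * (v1 r - v r) ∂nu d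
  set y := ∫ r, v r^q * (v1 r - v r) ∂nu d
  change HasDerivWithinAt _ (p * ∫ r, g r^pJ * (g1 r - g r) ∂nu d) _ _ at D3
  set z := ∫ r, g r^pJ * (g1 r - g r) ∂nu d
  change HasDerivWithinAt (fun ε => RI d mJ (fun r => v r + ε * (v1 r - v r))) _ _ _ at D1
  change HasDerivWithinAt (fun ε => RI d qJ (fun r => v r + ε * (v1 r - v r))) _ _ _ at D2
  change HasDerivWithinAt (fun ε => RI d p (fun r => g r + ε * (g1 r - g r))) _ _ _ at D3
  have e0 : ∀ (s : ℝ) (A B : ℝ → ℝ), RI d s (fun r => A r + 0 * B r) = RI d s A := fun s A B => by simp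
  have D2' := D2.rpow_const (p := eX) (Or.inl (by simp only [e0]; exact hM0.ne'))
  have D3' := D3.rpow_const (p := eY) (Or.inl (by simp only [e0]; exact hG0.ne'))
  simp only [zero_mul, add_zero] at D2' D3'
  have D := (D1.mul_const (RI d qJ v^(eX) * RI d p g^(eY))).sub ((D2'.mul D3').const_mul (RI d mJ v))
  have key := deriv_nonpos D (fun ε h0 h1 => by
    have := (hmax _ _ (S.path P S1 h0.le h1)).2
    simp only [Pi.sub_apply, Pi.mul_apply, zero_mul, add_zero] at this ⊢
    linarith)
  simp only [zero_mul, add_zero] at key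
  set Ma := RI d qJ v^(eX) with hMa
  set Gb := RI d p g^(eY) with hGb
  have f1 : RI d qJ v^(eX - 1) = Ma / RI d qJ v := by rw [Real.rpow_sub_one hM0.ne']
  have f2 : RI d p g^(eY - 1) = Gb / RI d p g := by rw [Real.rpow_sub_one hG0.ne']
  rw [f1, f2, hM, hG] at key
  have Ma0 : 0 < Ma := by positivity
  have Gb0 : 0 < Gb := by positivity
  set I := RI d mJ v
  have key2 : mJ * (Ma * Gb) * (x - y - z) ≤ 0 := by
    refine Mm (le_of_eq ?_) key
    field_simp
    ring
  have : 0 < mJ * (Ma * Gb) := by positivity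
  by_contra hc
  push Not at hc
  nlinarith [mul_pos this hc]

lemma add_pow_le' {x y s : ℝ} (hs : 0 ≤ s) (hx : 0 ≤ x) (hy : 0 ≤ y) : (x+y)^s ≤ 2^s*(x^s+y^s) := by
  have h1 : (x+y)^s ≤ (2*max x y)^s := by
    apply Ko PO _ hs
    linarith [Lf x y, Mo x y]
  rw [Kg (by norm_num) PO] at h1
  refine h1.trans ?_
  have := Kb hx s
  have := Kb hy s
  gcongr
  rcases max_choice x y with h | h <;> rw [h] <;> linarith

lemma nu_ind {b : ℝ} (c : ℝ) : Integrable ((Ioc 0 b).indicator fun _ => c) (nu d) := by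
  rw [nu_integrable]
  have : IntegrableOn (fun r:ℝ => r^dJ*c) (Ioc 0 b) :=
    ((Mh dJ).mul continuous_const).integrableOn_Icc.mono_set Ioc_subset_Icc_self
  rw [← Mf Ke] at this
  refine (this.integrableOn (s := Ioi 0)).congr_fun (fun r _ => ?_) Ka
  by_cases h : r ∈ Ioc 0 b <;> simp [h]

lemma pow_le_one_add {x s t : ℝ} (hx : 0 ≤ x) (hs : 0 ≤ s) (hst : s ≤ t) : x^s ≤ 1 + x^t := by
  have := Kb hx t
  rcases le_total x 1 with h | h
  · linarith [Real.rpow_le_one hx h hs]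
  · linarith [Real.rpow_le_rpow_of_exponent_le h hst]

lemma Rad.pert (S : Rad v g) {ψ : ℝ → ℝ} (hm : Measurable ψ) {a b : ℝ} (ha : 0 < a)
    (h1 : ∀ s, 0 ≤ g s + ψ s) (h2 : ∀ s, ψ s ≤ 1) (h3 : ∀ s, s ∉ Ioc a b → ψ s = 0) :
    Integrable ψ ∧ Rad (fun r => v r + ∫ s in Ioi r, ψ s) (fun r => g r + ψ r) := by
  have i0 : IntegrableOn (fun s => 1 + g s) (Ioc a b) := (integrableOn_const (by simp)).add ((S.gi a ha).mono_set Ioc_subset_Ioi_self)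
  have iψ : IntegrableOn ψ (Ioc a b) := by
    refine Lp i0 hm.aestronglyMeasurable (.of_forall fun s => ?_)
    rw [Mk, abs_le]
    constructor <;> linarith [h1 s, h2 s, S.g0 s]
  have iψ' : Integrable ψ := by
    rw [← Mf Ke] at iψ
    refine iψ.congr (.of_forall fun s => ?_)
    by_cases h : s ∈ Ioc a b <;> simp [h, h3 s]
  refine ⟨iψ', S.gm.add hm, h1, fun r hr => (S.gi r hr).add iψ'.integrableOn, fun r hr => ?_⟩
  rw [integral_add (S.gi r hr) iψ'.integrableOn, S.hv r hr]

lemma Adm.pert (P : PA) (S : AD v g) {ψ : ℝ → ℝ} (hm : Measurable ψ) {a b : ℝ} (ha : 0 < a)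
    (h1 : ∀ s, 0 ≤ g s + ψ s) (h2 : ∀ s, ψ s ≤ 1) (h3 : ∀ s, s ∉ Ioc a b → ψ s = 0) :
    AD (fun r => v r + ∫ s in Ioi r, ψ s) (fun r => g r + ψ r) := by
  obtain ⟨i, R⟩ := S.toRad.pert hm ha h1 h2 h3
  refine ⟨R, ?_, ?_⟩
  · refine Lp ((S.iM.add (nu_ind (b := b) ((∫ s, |ψ s|)^qJ))).const_mul (2^qJ)) (R.vm'.pow_const _).aestronglyMeasurable ?_
    filter_upwards [nu_pos_ae] with r hr
    rw [Kc (Kb (R.nonneg hr) _)]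
    have hle : ∫ s in Ioi r, ψ s ≤ ∫ s, |ψ s| := by
      refine (integral_mono i.integrableOn i.abs.integrableOn (fun s => le_abs_self _)).trans ?_
      exact setIntegral_le_integral i.abs (.of_forall fun s => Mw _)
    by_cases h : r ∈ Ioc 0 b
    · simp only [Pi.add_apply, Kh h]
      refine Mm ?_ (add_pow_le' P.q0.le (S.nonneg hr) (integral_nonneg fun s => Mw _))
      exact Ko (R.nonneg hr) LA P.q0.le
    · simp only [Pi.add_apply, Kz h]
      have : ∫ s in Ioi r, ψ s = 0 := by
        apply setIntegral_eq_zero_of_forall_eq_zero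
        intro s hs; apply h3
        intro hs2; apply h
        exact ⟨hr, (Kx hs).trans hs2.2⟩
      rw [this, add_zero, add_zero]
      apply le_mul_of_one_le_left (Kb (S.nonneg hr) _)
      exact Real.one_le_rpow (by norm_num) P.q0.le
  · refine Lp ((S.iG.add (nu_ind (b := b) 1)).const_mul (2^p)) (R.gm.pow_const _).aestronglyMeasurable ?_
    filter_upwards [nu_pos_ae] with r hr
    rw [Kc (Kb (h1 r) _)]
    by_cases h : r ∈ Ioc a b
    · have h' : r ∈ Ioc 0 b := ⟨hr, h.2⟩
      simp only [Pi.add_apply, Kh h']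
      have := add_pow_le' P.p0.le (S.g0 r) Ly
      rw [Real.one_rpow] at this
      refine Mm ?_ this
      exact Ko (h1 r) (by linarith [h2 r]) P.p0.le
    · rw [h3 r h, add_zero]
      have : (0:ℝ) ≤ (Ioc 0 b).indicator (fun _ => (1:ℝ)) r := indicator_nonneg (fun _ _ => Ly) r
      have h5 : 1 ≤ (2:ℝ)^p := Real.one_le_rpow (by norm_num) P.p0.le
      have h6 := Kb (S.g0 r) p
      simp only [Pi.add_apply]
      nlinarith

noncomputable def hs (d : ℕ) (q m : ℝ) (v : ℝ → ℝ) : ℝ → ℝ := (Ioi 0).indicator fun r => r^(d-1) * fN q m (v r)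

lemma int_pow_loc (hm : AEMeasurable v (nu d)) (h0 : ∀ r, 0 < r → 0 ≤ v r) {s t b : ℝ} (hs : 0 ≤ s) (hst : s ≤ t) (i : Integrable (fun r => v r^t) (nu d)) :
    Integrable ((Ioc 0 b).indicator fun r => v r^s) (nu d) := by
  refine Lp (i.add (nu_ind (b := b) 1)) ((hm.pow_const s).indicator Ke).aestronglyMeasurable ?_
  filter_upwards [nu_pos_ae] with r hr
  have := Kb (h0 r hr) t
  by_cases h : r ∈ Ioc 0 b
  · simp only [Pi.add_apply, Kh h, Kc (Kb (h0 r hr) s)]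
    linarith [pow_le_one_add (h0 r hr) hs hst]
  · simp [h, this]

lemma hs_int (P : PA) (S : AD v g) (iI : Integrable (fun r => v r^mJ) (nu d)) (b : ℝ) :
    IntegrableOn (hs d q m v) (Iic b) := by
  have i1 := int_pow_loc (b := b) S.vm' (fun r hr => S.nonneg hr) (s := m) (by linarith [P.hq, P.hqm]) LA iI
  have i2 := int_pow_loc (b := b) S.vm' (fun r hr => S.nonneg hr) (s := q) P.hq LA S.iM
  have i3 := (nu_integrable _).1 (i1.sub i2)
  rw [← Mf Ka] at i3
  rw [← Mf measurableSet_Iic]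
  refine i3.congr (.of_forall fun r => ?_)
  unfold hs fN
  by_cases h : 0 < r <;> by_cases h' : r ≤ b <;> simp [indicator, h, h']

lemma key_ineq (P : PA) (S : AD v g) (iI : Integrable (fun r => v r^mJ) (nu d)) (hI : 0 < RI d mJ v)
    (hM : RI d qJ v = eX*qJ/mJ * RI d mJ v) (hG : RI d p g = eY*p/mJ * RI d mJ v)
    (hmax : IsMax d p q m v g) {ψ : ℝ → ℝ} (hm : Measurable ψ) {a b : ℝ} (ha : 0 < a)
    (h1 : ∀ s, 0 ≤ g s + ψ s) (h2 : ∀ s, ψ s ≤ 1) (h3 : ∀ s, s ∉ Ioc a b → ψ s = 0) :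
    ∫ s, ψ s * ∫ r in (0:ℝ)..s, hs d q m v r ≤ ∫ r in Ioi 0, r^dJ * (g r^pJ * ψ r) := by
  have E := el P S iI hI hM hG hmax (S.pert P hm ha h1 h2 h3)
  obtain ⟨i, R⟩ := S.toRad.pert hm ha h1 h2 h3
  simp only [add_sub_cancel_left] at E
  rw [← nu_int]
  set φ : ℝ → ℝ := fun r => ∫ s in Ioi r, ψ s with hφ
  have φm : AEStronglyMeasurable φ (nu d) := by
    have := ((R.vm' (d := d)).sub (S.vm' (d := d))).aestronglyMeasurable
    refine this.congr (.of_forall fun r => ?_)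
    simp [hφ]
  have φb : ∀ r, ‖φ r‖ ≤ ∫ s, ‖ψ s‖ := fun r => (norm_integral_le_integral_norm _).trans (setIntegral_le_integral i.norm (.of_forall fun s => norm_nonneg _))
  have φ0 : ∀ r, r ∉ Iic b → φ r = 0 := by
    intro r h
    apply setIntegral_eq_zero_of_forall_eq_zero
    intro s hs; apply h3
    intro hs2; apply h
    exact (Kx hs).trans hs2.2
  have loc : ∀ s t : ℝ, 0 ≤ s → s ≤ t → Integrable (fun r => v r^t) (nu d) → Integrable (fun r => v r^s * φ r) (nu d) := by
    intro s t h0 hst it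
    have := (int_pow_loc (b := b) S.vm' (fun r hr => S.nonneg hr) h0 hst it).mul_bdd (c := ∫ s, ‖ψ s‖) φm (.of_forall φb)
    refine this.congr ?_
    filter_upwards [nu_pos_ae] with r hr
    by_cases h : r ≤ b
    · simp [indicator, hr, h]
    · rw [φ0 r h]; simp
  have j1 := loc m mJ (by linarith [P.hq, P.hqm]) LA iI
  have j2 := loc q qJ P.hq LA S.iM
  rw [← integral_sub j1 j2] at E
  refine Mm (le_of_eq ?_) (sub_nonpos.1 E)
  rw [nu_int]

  have ih : Integrable ((Iic b).indicator (hs d q m v)) := (Mf measurableSet_Iic).2 (hs_int P S iI b)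
  have ip : Integrable (fun z : ℝ × ℝ => (Iic b).indicator (hs d q m v) z.1 * ψ z.2) (volume.prod volume) := ih.mul_prod i
  have ip2 := ip.indicator (s := {z : ℝ×ℝ | z.1 < z.2}) (Lk measurable_fst measurable_snd)
  have sw := integral_integral_swap (f := fun x y => {z : ℝ×ℝ | z.1 < z.2}.indicator (fun z : ℝ × ℝ => (Iic b).indicator (hs d q m v) z.1 * ψ z.2) (x,y)) ip2
  have e1 : ∀ x, (∫ y, {z : ℝ×ℝ | z.1 < z.2}.indicator (fun z : ℝ × ℝ => (Iic b).indicator (hs d q m v) z.1 * ψ z.2) (x,y)) = (Ioi 0).indicator (fun r => r^dJ * (v r^m * φ r - v r^q * φ r)) x := by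
    intro x
    have : ∀ y, {z : ℝ×ℝ | z.1 < z.2}.indicator (fun z : ℝ × ℝ => (Iic b).indicator (hs d q m v) z.1 * ψ z.2) (x,y) = (Iic b).indicator (hs d q m v) x * (Ioi x).indicator ψ y := by
      intro y; by_cases h : x < y <;> simp [indicator, h]
    simp_rw [this]
    rw [integral_const_mul, integral_indicator Ka]
    change _ * φ x = _
    by_cases h : x ∈ Iic b
    · rw [Kh h]; unfold hs fN
      by_cases h' : x ∈ Ioi 0
      · rw [Kh h', Kh h']; ring
      · simp [Kz h']
    · rw [φ0 x h, Mn]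
      by_cases h' : x ∈ Ioi 0
      · rw [Kh h', φ0 x h]; simp
      · simp [Kz h']
  have e2 : ∀ y, (∫ x, {z : ℝ×ℝ | z.1 < z.2}.indicator (fun z : ℝ × ℝ => (Iic b).indicator (hs d q m v) z.1 * ψ z.2) (x,y)) = ψ y * ∫ r in (0:ℝ)..y, hs d q m v r := by
    intro y
    by_cases hy : y ∈ Ioc a b
    · have : ∀ x, {z : ℝ×ℝ | z.1 < z.2}.indicator (fun z : ℝ × ℝ => (Iic b).indicator (hs d q m v) z.1 * ψ z.2) (x,y) = ψ y * (Ioo 0 y).indicator (hs d q m v) x := by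
        intro x
        by_cases h0 : 0 < x
        · by_cases h : x < y
          · have : x ≤ b := h.le.trans hy.2
            simp [indicator, h, h0, this, mul_comm]
          · simp [indicator, h]
        · simp [indicator, h0, hs]
      simp_rw [this]
      rw [integral_const_mul, integral_indicator measurableSet_Ioo, Kv (ha.le.trans hy.1.le), integral_Ioc_eq_integral_Ioo]
    · simp [h3 y hy, indicator]
  simp only [e1, e2] at sw
  rw [← sw, integral_indicator Ka]

lemma max_ae (P : PA) (S : AD v g) (iI : Integrable (fun r => v r^mJ) (nu d)) (hI : 0 < RI d mJ v)
    (hM : RI d qJ v = eX*qJ/mJ * RI d mJ v) (hG : RI d p g = eY*p/mJ * RI d mJ v)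
    (hmax : IsMax d p q m v g) (Nc : Continuous fun s => ∫ r in (0:ℝ)..s, hs d q m v r) {a b : ℝ} (ha : 0 < a) :
    ∀ᵐ s ∂Mb (Ioc a b), s^dJ * g s^pJ = max (∫ r in (0:ℝ)..s, hs d q m v r) 0 := by
  set N : ℝ → ℝ := fun s => ∫ r in (0:ℝ)..s, hs d q m v r with hN
  set K : ℝ → ℝ := fun s => N s - s^dJ * g s^pJ with hK
  have Km : Measurable K := Nc.measurable.sub ((measurable_id.pow_const dJ).mul (S.gm.pow_const pJ))
  have p1 : 0 < p - 1 := by linarith [P.hp]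
  classical
  set ψ : ℝ → ℝ := (Ioc a b).indicator (fun s => if 0 < K s then 1 else if K s < 0 then -g s else 0) with hψ
  have hm : Measurable ψ := by
    apply Measurable.indicator _ Ke
    exact Measurable.ite (Lk Mv Km) Mv
      (Measurable.ite (Lk Km Mv) S.gm.neg Mv)
  have h3 : ∀ s, s ∉ Ioc a b → ψ s = 0 := fun s hs => Kz hs _
  have hin : ∀ s, s ∈ Ioc a b → ψ s = if 0 < K s then 1 else if K s < 0 then -g s else 0 := fun s hs => Kh hs _
  have h1 : ∀ s, 0 ≤ g s + ψ s := by
    intro s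
    have := S.g0 s
    by_cases h : s ∈ Ioc a b
    · rw [hin s h]; split_ifs <;> linarith
    · rw [h3 s h]; linarith
  have h2 : ∀ s, ψ s ≤ 1 := by
    intro s
    have := S.g0 s
    by_cases h : s ∈ Ioc a b
    · rw [hin s h]; split_ifs <;> linarith
    · rw [h3 s h]; linarith
  have k := key_ineq P S iI hI hM hG hmax hm ha h1 h2 h3
  obtain ⟨i, -⟩ := S.toRad.pert hm ha h1 h2 h3

  have r1 : ∫ s, ψ s * N s = ∫ s in Ioc a b, ψ s * N s := by
    rw [setIntegral_eq_integral_of_forall_compl_eq_zero]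
    intro s hs; rw [h3 s hs, zero_mul]
  have r2 : ∫ s in Ioi 0, s^dJ * (g s^pJ * ψ s) = ∫ s in Ioc a b, s^dJ * (g s^pJ * ψ s) := by
    rw [setIntegral_eq_integral_of_forall_compl_eq_zero, setIntegral_eq_integral_of_forall_compl_eq_zero]
    · intro s hs; rw [h3 s hs]; simp
    · intro s hs; rw [h3 s (fun h => hs (ha.trans h.1))]; simp
  change ∫ s, ψ s * N s ≤ _ at k
  rw [r1, r2] at k
  have j1 : IntegrableOn (fun s => ψ s * N s) (Ioc a b) := by
    obtain ⟨C, hC⟩ := isCompact_Icc.exists_bound_of_continuousOn (Nc.continuousOn (s := Icc a b))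
    refine i.integrableOn.mul_bdd (c := C) Nc.aestronglyMeasurable ?_
    filter_upwards [Kw Ke] with s hs using hC s (Ioc_subset_Icc_self hs)
  have j2 : IntegrableOn (fun s => s^dJ * (g s^pJ * ψ s)) (Ioc a b) := by
    have i1 : IntegrableOn (fun s => 2 * (s^dJ * g s^p)) (Ioc a b) :=
      (((nu_integrable _).1 S.iG).mono_set (fun x hx => ha.trans hx.1)).const_mul 2
    have i2 : IntegrableOn (fun s:ℝ => s^dJ) (Ioc a b) := (Mh dJ).integrableOn_Icc.mono_set Ioc_subset_Icc_self
    refine Lp (i1.add i2) ((measurable_id.pow_const dJ).mul ((S.gm.pow_const pJ).mul hm)).aestronglyMeasurable ?_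
    filter_upwards [Kw Ke] with s hs
    have s0 : 0 < s := ha.trans hs.1
    have g0 := S.g0 s
    have : |ψ s| ≤ 1 + g s := by rw [abs_le]; constructor <;> linarith [h1 s, h2 s]
    have e : g s^pJ * g s = g s^p := by
      nth_rewrite 2 [← Ku (g s)]
      rw [← Real.rpow_add' g0 LA]; ring_nf
    have b1 := pow_le_one_add g0 p1.le (show p - 1 ≤ p by linarith)
    have b0 := Kb g0 pJ
    rw [norm_mul, norm_mul, Kc (pow_nonneg s0.le _), Kc b0, Mk]
    have : g s^pJ * |ψ s| ≤ 1 + 2 * g s^p := by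
      calc _ ≤ g s^pJ * (1 + g s) := by gcongr
        _ = g s^pJ + g s^p := by rw [mul_add, e, mul_one]
        _ ≤ _ := by linarith
    calc _ ≤ s^dJ * (1 + 2 * g s^p) := by gcongr
      _ = _ := by simp only [Pi.add_apply]; ring
  have hnn : 0 ≤ᵐ[Mb (Ioc a b)] fun s => ψ s * N s - s^dJ * (g s^pJ * ψ s) := by
    filter_upwards [Kw Ke] with s hs
    have : ψ s * N s - s^dJ * (g s^pJ * ψ s) = ψ s * K s := by simp only [hK]; ring
    rw [this, hin s hs]
    split_ifs with c1 c2
    · simp [c1.le]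
    · have := S.g0 s; simp only [Pi.zero_apply]; nlinarith
    · simp
  have hz := (Lo hnn (j1.sub j2)).1 (le_antisymm (by
    rw [integral_sub j1 j2]; linarith) (integral_nonneg_of_ae hnn))
  filter_upwards [hz, Kw Ke] with s hz hs
  have : ψ s * N s - s^dJ * (g s^pJ * ψ s) = ψ s * K s := by simp only [hK]; ring
  rw [this, hin s hs] at hz
  have s0 : 0 < s := ha.trans hs.1
  have b0 := Kb (S.g0 s) pJ
  change _ = max (N s) 0
  simp only [Pi.zero_apply] at hz
  split_ifs at hz with c1 c2
  · linarith
  · have : g s = 0 := by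
      rcases mul_eq_zero.1 hz with h | h
      · linarith
      · exact absurd h c2.ne
    simp only [hK, this, Kd p1.ne'] at c2 ⊢
    rw [max_eq_right LA]; ring
  · have e : N s = s^dJ * g s^pJ := by
      have : K s = 0 := le_antisymm (not_lt.1 c1) (not_lt.1 c2)
      simp only [hK] at this; linarith
    rw [e, max_eq_left PO]

lemma fN_nonpos (hq : 0 ≤ q) (hqm : q < m) {u : ℝ} (h0 : 0 ≤ u) (h1 : u ≤ 1) : fN q m u ≤ 0 := by
  unfold fN
  rcases eq_or_lt_of_le h0 with h | h
  · rw [← h, Kd LA]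
    have := Kb (le_refl (0:ℝ)) q; linarith
  · linarith [Real.rpow_le_rpow_of_exponent_ge h h1 hqm.le]

lemma fN_nonneg (hqm : q < m) {u : ℝ} (h1 : 1 ≤ u) : 0 ≤ fN q m u := by
  unfold fN
  linarith [Real.rpow_le_rpow_of_exponent_le h1 hqm.le]

theorem max_GS (P : PA) (S : AD v g) (iI : Integrable (fun r => v r^mJ) (nu d)) (hI : 0 < RI d mJ v)
    (hM : RI d qJ v = eX*qJ/mJ * RI d mJ v) (hG : RI d p g = eY*p/mJ * RI d mJ v)
    (hmax : IsMax d p q m v g) : ∃ g', GV v g' ∧ ∀ᵐ s ∂Mb (Ioi 0), g s = g' s := by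
  have ii : ∀ a b, IntervalIntegrable (hs d q m v) volume a b := fun a b =>
    ⟨(hs_int P S iI b).mono_set Ioc_subset_Iic_self, (hs_int P S iI a).mono_set Ioc_subset_Iic_self⟩
  have Nc : Continuous fun s => ∫ r in (0:ℝ)..s, hs d q m v r := intervalIntegral.continuous_primitive ii 0
  have mae := fun {a b : ℝ} (ha : 0 < a) => max_ae (b := b) P S iI hI hM hG hmax Nc ha
  set N : ℝ → ℝ := fun s => ∫ r in (0:ℝ)..s, hs d q m v r with hN
  have p1 : 0 < p - 1 := by linarith [P.hp]
  set g' : ℝ → ℝ := fun s => (max (N s) 0 / s^dJ)^(1/pJ) with hg'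
  have g'0 : ∀ s, 0 < s → 0 ≤ g' s := fun s hs => Kb PO _
  have Nn' : ∀ s, 0 < s → Nn d p g' s = max (N s) 0 := by
    intro s hs
    simp only [Nn, hg']
    rw [← Ks PO, one_div_mul_cancel p1.ne', Ku]
    field_simp
  have g'c : ContinuousOn g' (Ioi 0) := by
    apply ContinuousOn.rpow_const _ (fun s _ => Or.inr PO)
    exact (Nc.max continuous_const).continuousOn.div (Mh _).continuousOn (fun s hs => (pow_pos hs _).ne')
  have ae1 : ∀ {a b : ℝ}, 0 < a → ∀ᵐ s ∂Mb (Ioc a b), g s = g' s := by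
    intro a b ha
    filter_upwards [mae (b := b) ha, Kw Ke] with s h hs
    have s0 : 0 < s := ha.trans hs.1
    simp only [hg']
    rw [← h, mul_div_cancel_left₀ _ (pow_pos s0 _).ne', ← Ks (S.g0 s), mul_one_div_cancel p1.ne', Ku]
  have ae2 : ∀ᵐ s ∂Mb (Ioi 0), g s = g' s := by
    have : Ioi (0:ℝ) = ⋃ n : ℕ, Ioc (1/((n:ℝ)+1)) (n+1) := by
      ext x; simp only [mem_Ioi, mem_iUnion, mem_Ioc]
      constructor
      · intro hx
        obtain ⟨n, hn⟩ := exists_nat_gt (max x (1/x))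
        refine ⟨n, ?_, by linarith [Lf x (1/x)]⟩
        have : 1/x < n + 1 := by linarith [Mo x (1/x)]
        rw [div_lt_iff₀ PO]
        rw [div_lt_iff₀ hx] at this; linarith
      · rintro ⟨n, h, -⟩; exact lt_trans PO h
    rw [this, ae_restrict_iUnion_iff]
    intro n; exact ae1 PO
  have vd : ∀ {a b : ℝ}, 0 < a → a ≤ b → v b = v a - ∫ s in a..b, g' s := by
    intro a b ha hab
    rw [Kv hab, ← Nb (ae1 ha), ← S.diff ha hab]; ring
  have hv : ∀ r, 0 < r → HasDerivAt v (-(g' r)) r := by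
    intro r hr
    have sm : StronglyMeasurableAtFilter g' (𝓝 r) := g'c.stronglyMeasurableAtFilter isOpen_Ioi r hr
    have iv : IntervalIntegrable g' volume (r/2) r := by
      apply ContinuousOn.intervalIntegrable
      apply g'c.mono
      rw [uIcc_of_le LA]; intro x hx; exact Kn LA hx.1
    have := (Mg iv sm (g'c.continuousAt (Ioi_mem_nhds hr))).const_sub (v (r/2))
    refine this.congr_of_eventuallyEq ?_
    filter_upwards [Ioi_mem_nhds (show r/2 < r by linarith)] with x hx
    exact vd LA (Kx hx)
  have hsub : ∀ {x y : ℝ}, N y = N x + ∫ r in x..y, hs d q m v r := fun {x y} =>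
    (intervalIntegral.integral_add_adjacent_intervals (ii 0 x) (ii x y)).symm
  have Npos : ∀ r, 0 < r → 0 < v r → 0 ≤ N r := by
    intro r0 hr0 hv0
    by_contra hc
    push Not at hc
    rcases Mz 1 (v r0) with h | h
    · have : 0 ≤ N r0 := by
        apply intervalIntegral.integral_nonneg hr0.le
        intro r hr
        unfold hs
        apply indicator_apply_nonneg
        intro h0
        exact La (pow_nonneg hr.1 _) (fN_nonneg P.hqm (h.trans (S.anti h0 hr0 hr.2)))
      linarith
    · have Nneg : ∀ r, r0 ≤ r → N r < 0 := by
        intro r hr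
        rw [hsub (x := r0)]
        have : ∫ s in r0..r, hs d q m v s ≤ 0 := by
          rw [← neg_nonneg, ← intervalIntegral.integral_neg]
          apply intervalIntegral.integral_nonneg hr
          intro s h3
          have s0 : 0 < s := hr0.trans_le h3.1
          rw [hs, Kh (show s ∈ Ioi 0 from s0)]
          have := fN_nonpos P.hq P.hqm (S.nonneg s0) ((S.anti hr0 s0 h3.1).trans h.le)
          have := La (pow_nonneg s0.le dJ) (neg_nonneg.2 this)
          linarith
        linarith
      have vc : ∀ r, r0 ≤ r → v r = v r0 := by
        intro r hr
        rw [vd hr0 hr, sub_eq_self]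
        apply intervalIntegral.integral_zero_ae
        filter_upwards with s h3
        rw [uIoc_of_le hr] at h3
        simp only [hg']
        rw [max_eq_right (Nneg s h3.1.le).le, zero_div, Kd PO]
      have : Tendsto v atTop (𝓝 (v r0)) := Ml (by
        filter_upwards [Lr r0] with r hr using (vc r hr).symm)
      exact hv0.ne' (tendsto_nhds_unique this S.lim)
  refine ⟨g', ⟨hv, g'0, fun r hr => S.nonneg hr, g'c, S.lim, ?_, ?_, ?_, ?_, (nu_integrable _).1 S.iM, (nu_integrable _).1 iI⟩, ae2⟩
  · by_contra hc
    push Not at hc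
    have : RI d mJ v = 0 := by
      apply integral_eq_zero_of_ae
      filter_upwards [nu_pos_ae] with r hr
      rw [le_antisymm (hc r hr) (S.nonneg hr), Kd (by linarith [P.m0])]; rfl
    linarith
  · intro r hr hvr
    have hcont : ContinuousAt v r := (hv r hr).continuousAt
    have hca : ContinuousAt (fun r => r^dJ * fN q m (v r)) r := by
      unfold fN
      exact (Mh _).continuousAt.mul ((hcont.rpow_const (Or.inl hvr.ne')).sub (hcont.rpow_const (Or.inl hvr.ne')))
    have heq : hs d q m v =ᶠ[𝓝 r] fun r => r^dJ * fN q m (v r) := by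
      filter_upwards [Ioi_mem_nhds hr] with s h3
      rw [hs, Kh h3]
    have hca' : ContinuousAt (hs d q m v) r := hca.congr heq.symm
    have sm : StronglyMeasurableAtFilter (hs d q m v) (𝓝 r) := 
      ⟨Iic (r+1), Iic_mem_nhds LA, (hs_int P S iI (r+1)).aestronglyMeasurable⟩
    have := Mg (ii 0 r) sm hca'
    rw [heq.eq_of_nhds] at this
    refine this.congr_of_eventuallyEq ?_
    filter_upwards [Ioi_mem_nhds hr, hcont.eventually (Lh hvr)] with s h3 h4
    rw [Nn' s h3, max_eq_left (Npos s h3 h4)]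
  · have t : Tendsto (fun s => max (N s) 0) (𝓝[>] 0) (𝓝 (max (N 0) 0)) := ((Nc.max continuous_const).tendsto 0).mono_left Lm
    have : N 0 = 0 := by simp [hN]
    rw [this, max_self] at t
    refine t.congr' ?_
    filter_upwards [Ln] with s h3 using (Nn' s h3).symm
  · refine ((nu_integrable _).1 S.iG).congr ?_
    filter_upwards [ae2] with s h3
    rw [h3]

theorem radial_main (P : PA) {c : ℝ} (S : GV v g) (A : AD v g) (hc : Tendsto v (𝓝[>] 0) (𝓝 c)) :
    0 < RI d mJ v ∧ RI d qJ v = eX*qJ/mJ * RI d mJ v ∧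
    RI d p g = eY*p/mJ * RI d mJ v ∧ IsMax d p q m v g := by
  have iI : Integrable (fun r => v r^mJ) (nu d) := (nu_integrable _).2 S.iI
  have I0 : 0 < RI d mJ v := by
    refine Kf (RI_nonneg S.hv0) fun h => ?_
    obtain ⟨r, hr, hv⟩ := S.pos
    have := (Lo (by filter_upwards [nu_pos_ae] with r hr using Kb (S.hv0 r hr) _) iI).1 h.symm
    have h2 := ae_nu this
    rw [ae_restrict_iff' Ka] at h2
    have h3 : ∀ᵐ x ∂Mb (Ioc (0:ℝ) r), False := by
      rw [ae_restrict_iff' Ke]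
      filter_upwards [h2] with x hx h4
      have h5 := hx h4.1
      have : 0 < v x := hv.trans_le (A.anti h4.1 hr h4.2)
      exact (Real.rpow_pos_of_pos this _).ne' h5
    rw [ae_iff] at h3
    simp [hr.not_ge] at h3
  obtain ⟨w, h, W, iW, W0, e1, e2, hmax⟩ := exists_ismax P A I0
  obtain ⟨g', G, hae⟩ := max_GS P W iW W0 e1 e2 hmax
  have u := G.unique P S hc
  have ug : ∀ r, 0 < r → g' r = g r := by
    intro r hr
    have h1 := (S.hv r hr).congr_of_eventuallyEq (f₁ := w) (by filter_upwards [Ioi_mem_nhds hr] with x hx using u x hx)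
    linarith [h1.unique (G.hv r hr)]
  have r1 : ∀ s, RI d s w = RI d s v := fun s => Nb (by
    filter_upwards [nu_pos_ae] with r hr; rw [u r hr])
  have r2 : RI d p h = RI d p g := Nb (by
    filter_upwards [nu_pos_ae, nu_ae hae] with r hr h2; rw [h2, ug r hr])
  unfold IsMax at hmax
  rw [r1, r1] at e1
  rw [r1, r2] at e2
  simp only [r1, r2] at hmax
  exact ⟨I0, e1, e2, hmax⟩

lemma uc_main (P : PA) (uc uc' : ℝ → ℝ)
    (hderivc : ∀ r ∈ Ici (0:ℝ), HasDerivWithinAt uc (uc' r) (Ici 0) r)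
    (hcc : ContinuousOn uc' (Ici 0))
    (hnn : ∀ r ∈ Ici (0:ℝ), 0 ≤ uc r)
    (hmono : AntitoneOn uc (Ici 0))
    (h0 : uc' 0 = 0)
    (hlim : Tendsto uc atTop (𝓝 0))
    (hint : IntegrableOn (fun r => r ^ dJ * uc r ^ qJ) (Ioi 0))
    (hcase :
      ((∀ r : ℝ, 0 ≤ r → 0 < uc r) ∧
        ∀ r ∈ Ioi (0:ℝ),
          HasDerivAt (fun s => s ^ dJ * |uc' s| ^ (p - 2) * uc' s)
            (r ^ dJ * (uc r ^ q - uc r ^ m)) r) ∨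
      (∃ R : ℝ, 0 < R ∧ (∀ r ∈ Ico (0:ℝ) R, 0 < uc r) ∧ (∀ r : ℝ, R ≤ r → uc r = 0) ∧
        uc' R = 0 ∧
        ∀ r ∈ Ioo (0:ℝ) R,
          HasDerivAt (fun s => s ^ dJ * |uc' s| ^ (p - 2) * uc' s)
            (r ^ dJ * (uc r ^ q - uc r ^ m)) r)) :
    ∃ g, (∀ r, 0 < r → HasDerivAt uc (-(g r)) r) ∧ AD uc g ∧ 0 < RI d mJ uc ∧
      RI d qJ uc = eX*qJ/mJ * RI d mJ uc ∧
      RI d p g = eY*p/mJ * RI d mJ uc ∧ IsMax d p q m uc g := by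
  set g : ℝ → ℝ := (Ioi 0).indicator (fun r => -uc' r) with hg
  have p1 : 0 < p - 1 := by linarith [P.hp]
  have gp : ∀ r, 0 < r → g r = -uc' r := fun r hr => Kh hr _
  have u'n : ∀ r, 0 ≤ r → uc' r ≤ 0 := by
    intro r hr
    rw [← (hderivc r hr).derivWithin (uniqueDiffOn_Ici 0 r hr)]
    exact hmono.derivWithin_nonpos
  have g0 : ∀ r, 0 ≤ g r := fun r => indicator_apply_nonneg fun hr => by linarith [u'n r (Kx hr)]
  have gc : ContinuousOn g (Ioi 0) := (hcc.mono Ioi_subset_Ici_self).neg.congr (fun r hr => gp r hr)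
  have gm : Measurable g := measurable_of_restrict_of_restrict_compl Ka
      (gc.domRestrict.measurable) (by
        have : (Ioi (0:ℝ))ᶜ.domRestrict g = fun _ => 0 := by ext x; simp [hg, indicator]; intro h; exact absurd h (not_lt.2 (by simpa using x.2))
        rw [this]; exact Mv)
  have hv : ∀ r, 0 < r → HasDerivAt uc (-(g r)) r := fun r hr => by
    rw [gp r hr, neg_neg]; exact (hderivc r hr.le).hasDerivAt (Ici_mem_nhds hr)
  have hNn : ∀ r, 0 < r → Nn d p g r = -(r^dJ * |uc' r|^(p-2) * uc' r) := by
    intro r hr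
    have e : |uc' r| = g r := by rw [gp r hr, abs_of_nonpos (u'n r hr.le)]
    have e2 : uc' r = -g r := by rw [gp r hr]; ring
    rw [e, e2, Nn]
    rcases eq_or_lt_of_le (g0 r) with h | h
    · rw [← h, Kd p1.ne']; ring
    · have : g r^pJ = g r^(p-2) * g r := by
        nth_rewrite 3 [← Ku (g r)]; rw [← Kr h]; ring_nf
      rw [this]; ring
  have ode : ∀ r, 0 < r → 0 < uc r → HasDerivAt (Nn d p g) (r^dJ * fN q m (uc r)) r := by
    intro r hr hu
    have : HasDerivAt (fun s => s ^ dJ * |uc' s| ^ (p - 2) * uc' s) (r ^ dJ * (uc r ^ q - uc r ^ m)) r := by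
      rcases hcase with ⟨-, h⟩ | ⟨R, hR, -, hz, -, h⟩
      · exact h r hr
      · refine h r ⟨hr, ?_⟩
        by_contra hc
        exact hu.ne' (hz r (not_lt.1 hc))
    refine (this.neg.congr_of_eventuallyEq ?_).congr_deriv (by unfold fN; ring)
    filter_upwards [Ioi_mem_nhds hr] with s hs using hNn s hs
  have iI : IntegrableOn (fun r => r^dJ * uc r^mJ) (Ioi 0) := by
    have ucm : AEMeasurable uc (Mb (Ioi 0)) := aemeasurable_restrict_of_antitoneOn Ka (hmono.mono Ioi_subset_Ici_self)
    refine Lp (hint.const_mul (uc 0^(m-q))) (((measurable_id.pow_const dJ).aemeasurable).mul (ucm.pow_const _)).aestronglyMeasurable ?_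
    filter_upwards [Kw Ka] with r hr
    have hr' : 0 ≤ r := Kx hr
    have un := hnn r hr'
    rw [Kc PO]
    have : uc r^mJ = uc r^(m-q) * uc r^qJ := by
      rw [← Real.rpow_add_of_nonneg un (by linarith [P.hqm]) P.q0.le]; ring_nf
    rw [this]
    have h2 : uc r^(m-q) ≤ uc 0^(m-q) := Ko un (hmono self_mem_Ici hr' hr') (by linarith [P.hqm])
    have : uc r^(m-q) * (r^dJ * uc r^qJ) ≤ uc 0^(m-q) * (r^dJ * uc r^qJ) := by gcongr
    calc _ = uc r^(m-q) * (r^dJ * uc r^qJ) := by ring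
      _ ≤ _ := this
  have iG0 : ∀ b : ℝ, IntegrableOn (fun r => r^dJ * g r^p) (Ioc 0 b) := by
    intro b
    have : ContinuousOn (fun r => r^dJ * (-uc' r)^p) (Icc 0 b) :=
      (Mh _).continuousOn.mul ((hcc.mono Icc_subset_Ici_self).neg.rpow_const (fun _ _ => Or.inr P.p0.le))
    refine (this.integrableOn_Icc.mono_set Ioc_subset_Icc_self).congr_fun (fun r hr => ?_) Ke
    simp only [gp r hr.1]
  have iG : IntegrableOn (fun r => r^dJ * g r^p) (Ioi 0) := by
    rcases hcase with ⟨hpos, -⟩ | ⟨R, hR, -, hz, hR', -⟩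
    · rw [← Ioc_union_Ioi_eq_Ioi Ly]
      refine (iG0 1).union ?_
      refine integrableOn_Ioi_of_intervalIntegral_norm_bounded ((∫ r in Ioi 0, r^dJ * uc r^mJ) + Nn d p g 1 * uc 1) 1
        (fun b : ℝ => (iG0 b).mono_set (Ioc_subset_Ioc_left Ly)) tendsto_id ?_
      filter_upwards [Lr (1:ℝ)] with b hb
      have sub : uIcc 1 b ⊆ Ioi 0 := by rw [uIcc_of_le hb]; intro x hx; exact Kn Lz hx.1
      have D : ∀ r ∈ uIcc 1 b, HasDerivAt (fun r => Nn d p g r * uc r) (r^dJ * fN q m (uc r) * uc r + Nn d p g r * (-(g r))) r :=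
        fun r hr => (ode r (sub hr) (hpos r (Kx (sub hr)))).mul (hv r (sub hr))
      have cu : ContinuousOn uc (uIcc 1 b) := fun r hr => (hv r (sub hr)).continuousAt.continuousWithinAt
      have cD : IntervalIntegrable (fun r => r^dJ * fN q m (uc r) * uc r + Nn d p g r * (-(g r))) volume 1 b := by
        apply ContinuousOn.intervalIntegrable
        have cN : ContinuousOn (Nn d p g) (uIcc 1 b) := fun r hr => (ode r (sub hr) (hpos r (Kx (sub hr)))).continuousAt.continuousWithinAt
        refine ContinuousOn.add (ContinuousOn.mul ((Mh _).continuousOn.mul ?_) cu) (cN.mul (gc.mono sub).neg)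
        unfold fN
        exact (cu.rpow_const (fun r hr => Or.inl (hpos r (Kx (sub hr))).ne')).sub (cu.rpow_const (fun r hr => Or.inl (hpos r (Kx (sub hr))).ne'))
      have F := intervalIntegral.integral_eq_sub_of_hasDerivAt D cD
      have jI : IntervalIntegrable (fun r => r^dJ * uc r^mJ) volume 1 b := by
        rw [Kp hb]
        exact iI.mono_set fun x hx => lt_trans Lz hx.1
      have jG : IntervalIntegrable (fun r => r^dJ * g r^p) volume 1 b := by
        rw [Kp hb]
        exact (iG0 b).mono_set (Ioc_subset_Ioc_left Ly)
      have le : ∫ r in (1:ℝ)..b, ‖r^dJ * g r^p‖ ≤ ∫ r in (1:ℝ)..b, (r^dJ * uc r^mJ - (r^dJ * fN q m (uc r) * uc r + Nn d p g r * (-(g r)))) := by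
        apply intervalIntegral.integral_mono_on hb jG.norm (jI.sub cD)
        intro r hr
        have r0 : 0 < r := Kn Lz hr.1
        have ur := hpos r r0.le
        rw [Kc (La PO (Kb (g0 r) _))]
        have e : g r^p = g r^pJ * g r := by
          nth_rewrite 3 [← Ku (g r)]
          rw [← Real.rpow_add' (g0 r) (by linarith [P.hp])]; ring_nf
        have e2 : uc r^mJ = uc r^m * uc r := Real.rpow_add_one ur.ne' m
        have : 0 ≤ r^dJ * uc r^q * uc r := by positivity
        rw [e, e2]; unfold fN Nn; linarith
      rw [intervalIntegral.integral_sub jI cD, F] at le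
      have : ∫ r in (1:ℝ)..b, r^dJ * uc r^mJ ≤ ∫ r in Ioi 0, r^dJ * uc r^mJ := by
        rw [Kv hb]
        apply setIntegral_mono_set iI
        · filter_upwards [Kw Ka] with r hr
          exact La (pow_nonneg (Kx hr) _) (Kb (hnn r (mem_Ici.2 (Kx hr))) _)
        · exact (LE.le.eventuallyLE fun x (hx : x ∈ Ioc 1 b) => lt_trans Lz hx.1)
      have : 0 ≤ Nn d p g b * uc b := La (La PO (Kb (g0 b) _)) (hnn b (by simp; linarith))
      linarith
    · rw [← Ioc_union_Ioi_eq_Ioi hR.le]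
      refine (iG0 R).union ?_
      refine integrableOn_zero.congr_fun (fun r hr => ?_) Ka
      have hr0 : 0 < r := hR.trans hr
      have : HasDerivAt uc 0 r := (hasDerivAt_const r (0:ℝ)).congr_of_eventuallyEq (by
        filter_upwards [Ioi_mem_nhds hr] with x hx using hz x (Kx hx))
      have : g r = 0 := by linarith [this.unique (hv r hr0)]
      rw [this, Kd P.p0.ne', Mn]
  have N0 : Tendsto (Nn d p g) (𝓝[>] 0) (𝓝 0) := by
    have t : Tendsto (fun r => r^dJ * (-uc' r)^pJ) (𝓝[>] 0) (𝓝 (0^dJ * (-uc' 0)^pJ)) := by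
      have h1 : ContinuousWithinAt (fun r => r^dJ * (-uc' r)^pJ) (Ici 0) 0 :=
        (Mh _).continuousWithinAt.mul ((hcc 0 self_mem_Ici).neg.rpow_const (Or.inr p1.le))
      exact h1.mono_left (nhdsWithin_mono _ Ioi_subset_Ici_self)
    rw [h0, neg_zero, Kd p1.ne', Mn] at t
    refine t.congr' ?_
    filter_upwards [Ln] with r hr
    rw [Nn, gp r hr]
  have pos : ∃ r, 0 < r ∧ 0 < uc r := by
    rcases hcase with ⟨h, -⟩ | ⟨R, hR, h, -⟩
    · exact ⟨1, Lz, h 1 Ly⟩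
    · exact ⟨R/2, by linarith, h _ ⟨by linarith, by linarith⟩⟩
  have S : GV uc g := ⟨hv, fun r _ => g0 r, fun r hr => hnn r hr.le, gc, hlim, pos, ode, N0, iG, hint, iI⟩
  have A : AD uc g := by
    refine ⟨⟨gm, g0, fun r hr => ?_, fun r hr => ?_⟩, (nu_integrable _).2 hint, (nu_integrable _).2 iG⟩
    · have := integrableOn_Ioi_deriv_of_nonpos' (g := uc) (g' := fun r => -g r) (a := r) (fun x hx => hv x (hr.trans_le hx))
        (fun x hx => by linarith [g0 x]) hlim
      simpa using this.neg
    · have := integral_Ioi_of_hasDerivAt_of_nonpos' (g := uc) (g' := fun r => -g r) (a := r) (fun x hx => hv x (hr.trans_le hx))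
        (fun x hx => by linarith [g0 x]) hlim
      rw [integral_neg] at this; linarith
  obtain ⟨a1, a2, a3, a4⟩ := radial_main P S A (((hderivc 0 self_mem_Ici).continuousWithinAt).mono_left (nhdsWithin_mono _ Ioi_subset_Ici_self))
  exact ⟨g, hv, A, a1, a2, a3, a4⟩

lemma const_id {y z K I T th a b n de : ℝ} (hy : 0 ≤ y) (hz : 0 ≤ z) (hK : 0 < K) (hI : 0 < I) (hT : 0 < T) (hth : 0 < th)
    (hn : n = a*n + b*n - de) :
    th^(-(b*n)) * T^(b*n-n) * (K*(T*I))^(-de) * (K*y)^(a*n) * (K*z)^(b*n) =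
      (K*(I*(y^a*z^b)/((T*I)^a*(th*I)^b)))^n := by
  have e1 : T^(b*n-n) = T^de/T^(a*n) := by rw [← Real.rpow_sub hT]; congr 1; linarith
  have e2 : ∀ x : ℝ, 0 < x → x^n = x^(a*n) * x^(b*n) / x^de := fun x hx => by
    rw [← Kr hx, ← Real.rpow_sub hx, ← hn]
  have eR : (K*(I*(y^a*z^b)/((T*I)^a*(th*I)^b)))^n = K^n * (I ^ n * (y^(a*n) * z^(b*n)) / (T^(a*n) * I ^ (a*n) * (th^(b*n) * I ^ (b*n)))) := by
    rw [Kg hK.le PO, Real.div_rpow PO PO, Kg hI.le PO,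
      Kg PO PO, Kg PO PO,
      ← Ks hy, ← Ks hz, ← Ks PO, ← Ks PO,
      Kg hT.le hI.le, Kg hth.le hI.le]
  rw [eR, Kg hK.le hy, Kg hK.le hz, Kg hK.le (by positivity : 0 ≤ T*I), Kg hT.le hI.le, 
    e1, e2 K hK, e2 I hI, Real.rpow_neg hth.le, Real.rpow_neg hK.le, Real.rpow_neg hT.le, Real.rpow_neg hI.le]
  field_simp

noncomputable def kap (d : ℕ) : ℝ := d * volume.real (Lv (0 : EuclideanSpace ℝ (Fin d)) 1)

lemma kap_pos (hd : 1 ≤ d) : 0 < kap d := by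
  have : (0:ℝ) < d := by exact_mod_cast hd
  have h : 0 < volume.real (Lv (0 : EE) 1) := by
    rw [measureReal_def, ENNReal.toReal_pos_iff]
    exact ⟨Metric.measure_ball_pos _ _ Lz, measure_ball_lt_top⟩
  unfold kap; positivity

lemma polar (hd : 1 ≤ d) (f : ℝ → ℝ) : ∫ x : EE, f ‖x‖ = kap d * ∫ r, f r ∂nu d := by
  have : Nonempty (Fin d) := ⟨⟨0, hd⟩⟩
  rw [integral_fun_norm_addHaar volume f, nu_int, finrank_euclideanSpace_fin]
  simp [kap, Mx]

lemma const_main (P : Par d p q m) {θ : ℝ} (hθ : θ = p * (d : ℝ) * (m - q) /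
      (mJ * ((d : ℝ) * (p - q - 1) + p * qJ))) :
    θ = eb d p q m * p/mJ ∧ 1 - θ = ea d p q m * qJ/mJ := by
  have m0 := P.m0
  have dn := P.den
  have h1 : θ = eb d p q m * p/mJ := by
    have : (d : ℝ) * (p - q - 1) + p * qJ = d*p-qJ*((d:ℝ)-p) := by ring
    rw [hθ, eb, this]; field_simp
  refine ⟨h1, ?_⟩
  rw [h1, eq_div_iff m0.ne', sub_mul, div_mul_cancel₀ _ m0.ne']
  linarith [P.e1]

lemma const_eq (P : Par d p q m) {θ Mc C y z : ℝ} (hθ : θ = p * (d : ℝ) * (m - q) /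
      (mJ * ((d : ℝ) * (p - q - 1) + p * qJ)))
    (hI : 0 < RI d mJ v) (hM : RI d qJ v = ea d p q m*qJ/mJ * RI d mJ v)
    (hG : RI d p g = eb d p q m*p/mJ * RI d mJ v) (hMc : Mc = kap d * RI d qJ v)
    (hC : C = θ ^ (-(θ / p)) * (1 - θ) ^ (θ / p - 1 / mJ) * Mc ^ (-(θ / d))) (hy : 0 ≤ y) (hz : 0 ≤ z) :
    C * (kap d * y)^((1 - θ) / qJ) * (kap d * z)^(θ/p) =
      (kap d * (RI d mJ v * (y^(ea d p q m) * z^(eb d p q m)) / (RI d qJ v^(ea d p q m) * RI d p g^(eb d p q m))))^(1/mJ) := by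
  obtain ⟨t1, t2⟩ := const_main P hθ
  have m0 := P.m0
  have q0 := P.q0
  have p0 := P.p0
  have d0 := P.d0
  have th0 : 0 < θ := by rw [t1]; have := P.b0; positivity
  have T0 : 0 < 1 - θ := by rw [t2]; have := P.a0; positivity
  have f1 : θ/p = eb d p q m * (1/mJ) := by rw [t1]; field_simp
  have f2 : (1-θ)/qJ = ea d p q m * (1/mJ) := by rw [t2]; field_simp
  have f3 : 1/mJ = ea d p q m * (1/mJ) + eb d p q m * (1/mJ) - θ/d := by
    rw [t1]; have := P.e2; field_simp; linarith
  rw [← t2] at hM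
  rw [← t1] at hG
  rw [hC, hMc, f2, f1, hM, hG]
  exact const_id hy hz (kap_pos P.hd) hI T0 th0 f3

lemma hasFDerivAt_norm' {x : EE} (hx : x ≠ 0) :
    ∃ L : EE →L[ℝ] ℝ, HasFDerivAt (fun y : EE => ‖y‖) L x ∧ ‖L‖ = 1 := by
  have n0 : 0 < ‖x‖ := norm_pos_iff.2 hx
  have h := (hasStrictFDerivAt_norm_sq x).hasFDerivAt.sqrt PO
  refine ⟨_, h.congr_of_eventuallyEq (.of_forall fun y => (Real.sqrt_sq (norm_nonneg y)).symm), ?_⟩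
  rw [Real.sqrt_sq n0.le, two_smul, ← two_smul ℝ, smul_smul, norm_smul, innerSL_apply_norm, Kc PO]
  field_simp

lemma norm_fderiv_rad {u : ℝ → ℝ} (hv : ∀ r, 0 < r → HasDerivAt u (-(g r)) r) (hg : ∀ r, 0 ≤ g r) {A l : ℝ} (hA : 0 < A) (hl : 0 < l)
    {x : EE} (hx : x ≠ 0) :
    ‖fderiv ℝ (fun y : EE => A * u (l * ‖y‖)) x‖ = A * l * g (l * ‖x‖) := by
  have n0 : 0 < ‖x‖ := norm_pos_iff.2 hx
  obtain ⟨L, h, hL⟩ := hasFDerivAt_norm' hx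
  have h2 := ((hv (l * ‖x‖) PO).comp_hasFDerivAt x (h.const_mul l)).const_mul A
  have h3 := h2.fderiv
  simp only [Function.comp_def] at h3
  rw [h3]
  simp only [norm_smul, hL, Mk, abs_neg, abs_of_nonneg (hg _), Na hA, Na hl]
  ring

lemma equality (P : Par d p q m) {θ Mc C : ℝ} (hθ : θ = p * (d : ℝ) * (m - q) /
      (mJ * ((d : ℝ) * (p - q - 1) + p * qJ))) {uc : ℝ → ℝ} (hu0 : ∀ r, 0 ≤ r → 0 ≤ uc r)
    (hv : ∀ r, 0 < r → HasDerivAt uc (-(g r)) r) (S : Adm d p q uc g)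
    (hI : 0 < RI d mJ uc) (hM : RI d qJ uc = ea d p q m*qJ/mJ * RI d mJ uc)
    (hG : RI d p g = eb d p q m*p/mJ * RI d mJ uc) (hMc : Mc = kap d * RI d qJ uc)
    (hC : C = θ ^ (-(θ / p)) * (1 - θ) ^ (θ / p - 1 / mJ) * Mc ^ (-(θ / d)))
    (A lam : ℝ) (hA : 0 < A) (hl : 0 < lam) (x₀ : EuclideanSpace ℝ (Fin d)) :
      (∫ x, |A * uc (lam * ‖x - x₀‖)| ^ mJ) ^ (1 / mJ) =
        C * (∫ x, |A * uc (lam * ‖x - x₀‖)| ^ qJ) ^ ((1 - θ) / qJ) *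
          (∫ x, ‖fderiv ℝ (fun y => A * uc (lam * ‖y - x₀‖)) x‖ ^ p) ^ (θ / p) := by
  have u0 : ∀ r, 0 < r → 0 ≤ uc r := fun r hr => hu0 r hr.le
  have i1 : ∀ s : ℝ, ∫ x, |A * uc (lam * ‖x - x₀‖)| ^ s = kap d * (A^s * lam^(-(d:ℝ)) * RI d s uc) := by
    intro s
    rw [integral_sub_right_eq_self (fun x => |A * uc (lam * ‖x‖)|^s), ← RI_scale P.hd hA.le hl u0,
      polar P.hd (fun r => |A * uc (lam * r)|^s)]
    congr 1
    apply Nb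
    filter_upwards [nu_pos_ae] with r hr
    rw [abs_of_nonneg (La hA.le (u0 _ PO))]
  have i2 : ∫ x, ‖fderiv ℝ (fun y => A * uc (lam * ‖y - x₀‖)) x‖ ^ p = kap d * (A^p * lam^(p-(d:ℝ)) * RI d p g) := by
    have : ∀ x, fderiv ℝ (fun y => A * uc (lam * ‖y - x₀‖)) x = fderiv ℝ (fun y => A * uc (lam * ‖y‖)) (x - x₀) := fun x =>
      fderiv_comp_sub (f := fun y => A * uc (lam * ‖y‖)) (x := x) x₀
    simp_rw [this]
    rw [integral_sub_right_eq_self (fun x => ‖fderiv ℝ (fun y => A * uc (lam * ‖y‖)) x‖ ^ p), ← RIg_scale P.hd hA.le hl (fun r _ => S.g0 r)]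
    unfold RI
    rw [← polar P.hd (fun r => (A * lam * g (lam * r))^p)]
    apply Nb
    have : Nonempty (Fin d) := ⟨⟨0, P.hd⟩⟩
    have : ∀ᵐ x : EuclideanSpace ℝ (Fin d), x ≠ 0 := by rw [ae_iff]; simp
    filter_upwards [this] with x hx
    rw [norm_fderiv_rad hv S.g0 hA hl hx]
  rw [i1, i1, i2]
  have M0 : 0 < RI d qJ uc := by rw [hM]; have := P.a0; have := P.q0; have := P.m0; positivity
  have G0 : 0 < RI d p g := by rw [hG]; have := P.b0; have := P.p0; have := P.m0; positivity
  rw [const_eq P hθ hI hM hG hMc hC PO PO, P.scal_id hA hl M0.le G0.le]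
  congr 2
  have : 0 < RI d qJ uc^(ea d p q m) * RI d p g^(eb d p q m) := by positivity
  rw [eq_div_iff this.ne']; ring

lemma ineq_of (P : Par d p q m) {θ Mc C : ℝ} (hθ : θ = p * (d : ℝ) * (m - q) /
      (mJ * ((d : ℝ) * (p - q - 1) + p * qJ))) {uc : ℝ → ℝ} 
    (hI : 0 < RI d mJ uc) (hM : RI d qJ uc = ea d p q m*qJ/mJ * RI d mJ uc)
    (hG : RI d p g = eb d p q m*p/mJ * RI d mJ uc) (hMc : Mc = kap d * RI d qJ uc)
    (hC : C = θ ^ (-(θ / p)) * (1 - θ) ^ (θ / p - 1 / mJ) * Mc ^ (-(θ / d)))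
    (hmax : IsMax d p q m uc g) {w h : ℝ → ℝ} (W : Adm d p q w h) {G : ℝ} (hGG : kap d * RI d p h ≤ G) :
    (kap d * RI d mJ w)^(1/mJ) ≤ C * (kap d * RI d qJ w)^((1 - θ) / qJ) * G^(θ/p) := by
  have M0 : 0 < RI d qJ uc := by rw [hM]; have := P.a0; have := P.q0; have := P.m0; positivity
  have G0 : 0 < RI d p g := by rw [hG]; have := P.b0; have := P.p0; have := P.m0; positivity
  have k0 := kap_pos P.hd
  have n1 : 0 ≤ RI d mJ w := RI_nonneg fun r hr => W.nonneg hr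
  have n2 : 0 ≤ RI d qJ w := RI_nonneg fun r hr => W.nonneg hr
  have n3 : 0 ≤ RI d p h := RI_nonneg fun r hr => W.g0 r
  obtain ⟨t1, t2⟩ := const_main P hθ
  have m0 := P.m0
  have q0 := P.q0
  have p0 := P.p0
  have th0 : 0 < θ := by rw [t1]; have := P.b0; positivity
  have T0 : 0 < 1 - θ := by rw [t2]; have := P.a0; positivity
  have C0 : 0 ≤ C := by rw [hC, hMc]; positivity
  calc _ ≤ (kap d * (RI d mJ uc * (RI d qJ w^(ea d p q m) * RI d p h^(eb d p q m)) / (RI d qJ uc^(ea d p q m) * RI d p g^(eb d p q m))))^(1/mJ) := by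
        apply Ko PO _ PO
        gcongr
        rw [Ms PO]
        exact (hmax w h W).2
    _ = C * (kap d * RI d qJ w)^((1 - θ) / qJ) * (kap d * RI d p h)^(θ/p) := (const_eq P hθ hI hM hG hMc hC n2 n3).symm
    _ ≤ _ := by gcongr

lemma lcE {X : Type*} [MeasurableSpace X] (μ : Measure X) [SFinite μ] (φ : X → ENNReal)
    (hφ : Measurable φ) :
    ∫⁻ x, φ x ∂μ = ∫⁻ t in Ioi (0:ℝ), μ {x | oR t < φ x} := by
  have hms : MeasurableSet {z : X × ℝ | oR z.2 < φ z.1} :=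
    Lk (by fun_prop) (by fun_prop)
  have h1 : ∀ x, φ x = ∫⁻ t in Ioi (0:ℝ),
      ({z : X × ℝ | oR z.2 < φ z.1}.indicator 1 : X × ℝ → ENNReal) (x, t) := by
    intro x
    have : (fun t : ℝ => ({z : X × ℝ | oR z.2 < φ z.1}.indicator 1 : X × ℝ → ENNReal)
        (x, t)) = {t : ℝ | oR t < φ x}.indicator 1 := by
      ext t; simp only [indicator_apply, Le]; rfl
    rw [this, Lt (Lk (by fun_prop) (by fun_prop)),
      Measure.restrict_apply (Lk (by fun_prop) (by fun_prop))]
    rcases eq_or_ne (φ x) ⊤ with h | h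
    · have : {t : ℝ | oR t < φ x} ∩ Ioi 0 = Ioi 0 := by
        ext t; simp [h]
      rw [this, h, Real.volume_Ioi]
    · have : {t : ℝ | oR t < φ x} ∩ Ioi 0 = Ioo 0 (φ x).toReal := by
        ext t
        simp only [mem_inter_iff, Le, mem_Ioi, mem_Ioo]
        constructor
        · rintro ⟨h1, h2⟩; exact ⟨h2, (ENNReal.ofReal_lt_iff_lt_toReal h2.le h).1 h1⟩
        · rintro ⟨h1, h2⟩; exact ⟨(ENNReal.ofReal_lt_iff_lt_toReal h1.le h).2 h2, h1⟩
      rw [this, Real.volume_Ioo, sub_zero, ENNReal.ofReal_toReal h]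
  calc ∫⁻ x, φ x ∂μ = ∫⁻ x, (∫⁻ t in Ioi (0:ℝ),
      ({z : X × ℝ | oR z.2 < φ z.1}.indicator 1 : X × ℝ → ENNReal) (x, t)) ∂μ :=
        lintegral_congr h1
    _ = ∫⁻ t in Ioi (0:ℝ), (∫⁻ x,
      ({z : X × ℝ | oR z.2 < φ z.1}.indicator 1 : X × ℝ → ENNReal) (x, t) ∂μ) := by
        apply lintegral_lintegral_swap
        exact (Mq hms).aemeasurable
    _ = _ := by
        apply lintegral_congr; intro t
        have : (fun x : X => ({z : X × ℝ | oR z.2 < φ z.1}.indicator 1 : X × ℝ → ENNReal)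
          (x, t)) = {x : X | oR t < φ x}.indicator 1 := by
          ext t; simp only [indicator_apply, Le]; rfl
        rw [this, Lt (Lk (by fun_prop) (by fun_prop))]

lemma bm_compact {K L C : Set ℝ} (hK : IsCompact K) (hL : IsCompact L) (nK : K.Nonempty)
    (nL : L.Nonempty) (h : ∀ a ∈ K, ∀ b ∈ L, a + b ∈ C) : volume K + volume L ≤ volume C := by
  obtain ⟨k, hk, hk'⟩ := hK.exists_isMaxOn nK continuousOn_id
  obtain ⟨l, hl, hl'⟩ := hL.exists_isMinOn nL continuousOn_id
  have e1 : volume ((fun x => x + l) '' K) = volume K := by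
    rw [image_add_right, measure_preimage_add_right]
  have e2 : volume ((fun x => k + x) '' L) = volume L := by
    rw [image_add_left, measure_preimage_add]
  have hd : AEDisjoint volume ((fun x => x + l) '' K) ((fun x => k + x) '' L) := by
    refine measure_mono_null (t := {k + l}) ?_ (by simp)
    rintro _ ⟨⟨a, ha, rfl⟩, ⟨b, hb, hab⟩⟩
    have h1 := hk' ha; have h2 := hl' hb
    simp only [id, Le] at h1 h2 hab
    simp only [mem_singleton_iff]; linarith
  have hm : NullMeasurableSet ((fun x => k + x) '' L) volume :=
    (hL.image (by fun_prop)).measurableSet.nullMeasurableSet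
  rw [← e1, ← e2, ← measure_union₀ hm hd]
  apply measure_mono
  rintro _ (⟨a, ha, rfl⟩ | ⟨b, hb, rfl⟩)
  · exact h _ ha _ hl
  · exact h _ hk _ hb

lemma bm1_aux {A : Set ℝ} (hA : MeasurableSet A) (nA : A.Nonempty) {D c : ENNReal}
    (hh : ∀ K ⊆ A, IsCompact K → K.Nonempty → volume K + c ≤ D) : volume A + c ≤ D := by
  obtain ⟨a, ha⟩ := nA
  have h1 : c ≤ D := by simpa using hh {a} (by simpa) isCompact_singleton (by simp)
  rcases eq_or_ne c ⊤ with rfl | hc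
  · rw [top_le_iff.1 h1]; exact le_top
  · rw [← tsub_add_cancel_of_le h1]
    gcongr
    refine le_of_forall_lt fun r hr => ?_
    obtain ⟨K, h1, h2, h3⟩ := hA.exists_lt_isCompact hr
    refine h3.trans_le (ENNReal.le_sub_of_add_le_right hc (hh K h1 h2 ?_))
    rw [nonempty_iff_ne_empty]; rintro rfl; simp at h3

lemma bm1 {A B C : Set ℝ} (hA : MeasurableSet A) (hB : MeasurableSet B) (nA : A.Nonempty)
    (nB : B.Nonempty) (h : ∀ a ∈ A, ∀ b ∈ B, a + b ∈ C) : volume A + volume B ≤ volume C := by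
  refine bm1_aux hA nA fun K hK kK nK => ?_
  rw [add_comm]
  refine bm1_aux hB nB fun L hL kL nL => ?_
  rw [add_comm]
  exact bm_compact kK kL nK nL fun a ha b hb => h a (hK ha) b (hL hb)

lemma bm1' {A B C : Set ℝ} (hA : MeasurableSet A) (hB : MeasurableSet B) (nA : A.Nonempty)
    (nB : B.Nonempty) {l k : ℝ} (hl : 0 < l) (hk : 0 < k)
    (h : ∀ a ∈ A, ∀ b ∈ B, k * a + l * b ∈ C) :
    oR k * volume A + oR l * volume B ≤ volume C := by
  have e : ∀ {k : ℝ} (A : Set ℝ), 0 < k → volume ((fun x => k⁻¹ * x) ⁻¹' A) = oR k * volume A := by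
    intro k A hk
    rw [Real.volume_preimage_mul_left PO, inv_inv, Na hk]
  rw [← e A hk, ← e B hl]
  refine bm1 (hA.preimage (by fun_prop)) (hB.preimage (by fun_prop)) ?_ ?_ ?_
  · obtain ⟨a, ha⟩ := nA; exact ⟨k * a, by simpa [hk.ne'] using ha⟩
  · obtain ⟨a, ha⟩ := nB; exact ⟨l * a, by simpa [hl.ne'] using ha⟩
  · intro a ha b hb
    have := h _ ha _ hb
    simpa [hk.ne', hl.ne'] using this

lemma amgm {k l : ℝ} (hk : 0 < k) (hl : 0 < l) (h1 : k + l = 1) (x y : ENNReal) :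
    x ^ k * y ^ l ≤ oR k * x + oR l * y := by
  rcases eq_or_ne x ⊤ with rfl | hx
  · simp [ENNReal.mul_top, hk]
  rcases eq_or_ne y ⊤ with rfl | hy
  · simp [ENNReal.mul_top, hl]
  lift x to NNReal using hx
  lift y to NNReal using hy
  have := NNReal.geom_mean_le_arith_mean2_weighted k.toNNReal l.toNNReal x y
    (by rw [← Real.toNNReal_add hk.le hl.le, h1, Real.toNNReal_one])
  rw [Real.coe_toNNReal _ hk.le, Real.coe_toNNReal _ hl.le] at this
  rw [← ENNReal.coe_rpow_of_nonneg _ hk.le, ← ENNReal.coe_rpow_of_nonneg _ hl.le]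
  unfold ENNReal.ofReal
  exact_mod_cast this

lemma pl_norm {k l : ℝ} (hk : 0 < k) (hl : 0 < l) (h1 : k + l = 1) {f g h : ℝ → ENNReal}
    (hf : Measurable f) (hg : Measurable g) (hh : Measurable h)
    (H : ∀ x y, f x ^ k * g y ^ l ≤ h (k * x + l * y))
    (f1 : ⨆ x, f x = 1) (g1 : ⨆ x, g x = 1) :
    (∫⁻ x, f x) ^ k * (∫⁻ x, g x) ^ l ≤ ∫⁻ x, h x := by
  refine (amgm hk hl h1 _ _).trans ?_
  rw [lcE _ f hf, lcE _ g hg, lcE _ h hh]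
  have key : ∀ t, 0 < t → oR k * volume {x | oR t < f x} +
      oR l * volume {x | oR t < g x} ≤ volume {x | oR t < h x} := by
    intro t ht
    rcases lt_or_ge (oR t) 1 with h1t | h1t
    · have nf : ∀ f : ℝ → ENNReal, ⨆ x, f x = 1 → {x | oR t < f x}.Nonempty :=
        fun f f1 => by
          rw [← f1] at h1t
          obtain ⟨x, hx⟩ := lt_iSup_iff.1 h1t
          exact ⟨x, hx⟩
      refine bm1' (Lk (by fun_prop) hf) (Lk (by fun_prop) hg)
        (nf f f1) (nf g g1) hl hk ?_
      intro a ha b hb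
      refine Kn ?_ (H a b)
      have e : oR t = oR t ^ k * oR t ^ l := by
        rw [← ENNReal.rpow_add _ _ (by simpa using ht) (by simp), h1, ENNReal.rpow_one]
      rw [e]
      exact ENNReal.mul_lt_mul (ENNReal.rpow_lt_rpow ha hk) (ENNReal.rpow_lt_rpow hb hl)
    · have e1 : {x | oR t < f x} = ∅ := by
        ext x; simpa using (le_iSup f x).trans (f1 ▸ h1t)
      have e2 : {x | oR t < g x} = ∅ := by
        ext x; simpa using (le_iSup g x).trans (g1 ▸ h1t)
      simp [e1, e2]
  have mm : ∀ f : ℝ → ENNReal, Measurable fun t : ℝ => volume {x | oR t < f x} := by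
    intro f
    refine Antitone.measurable fun s t hst => measure_mono fun x hx => ?_
    exact Mu (Ki hst) hx
  rw [← Mi _ (mm f), ← Mi _ (mm g),
    ← lintegral_add_left ((mm f).const_mul _)]
  exact setLIntegral_mono (mm h) fun t ht => key t ht

lemma pl_bdd {k l : ℝ} (hk : 0 < k) (hl : 0 < l) (h1 : k + l = 1) {f g h : ℝ → ENNReal}
    (hf : Measurable f) (hg : Measurable g) (hh : Measurable h)
    (H : ∀ x y, f x ^ k * g y ^ l ≤ h (k * x + l * y))
    (fT : ⨆ x, f x ≠ ⊤) (gT : ⨆ x, g x ≠ ⊤) :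
    (∫⁻ x, f x) ^ k * (∫⁻ x, g x) ^ l ≤ ∫⁻ x, h x := by
  set a := ⨆ x, f x with ha
  set b := ⨆ x, g x with hb
  rcases eq_or_ne a 0 with a0 | a0
  · have : ∀ x, f x = 0 := fun x => le_zero_iff.1 (a0 ▸ le_iSup f x)
    simp [this, hk]
  rcases eq_or_ne b 0 with b0 | b0
  · have : ∀ x, g x = 0 := fun x => le_zero_iff.1 (b0 ▸ le_iSup g x)
    simp [this, hl]
  have ak : a ^ k ≠ 0 := by simp [a0, fT]
  have bl : b ^ l ≠ 0 := by simp [b0, gT]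
  have akT : a ^ k ≠ ⊤ := ENNReal.rpow_ne_top_of_nonneg hk.le fT
  have blT : b ^ l ≠ ⊤ := ENNReal.rpow_ne_top_of_nonneg hl.le gT
  have ei : (a ^ k * b ^ l)⁻¹ = (a⁻¹) ^ k * (b⁻¹) ^ l := by
    rw [ENNReal.mul_inv (Or.inl ak) (Or.inl akT), ENNReal.inv_rpow, ENNReal.inv_rpow]
  have := pl_norm hk hl h1 (f := fun x => a⁻¹ * f x) (g := fun x => b⁻¹ * g x)
    (h := fun x => (a ^ k * b ^ l)⁻¹ * h x) (by fun_prop) (by fun_prop) (by fun_prop) ?_ ?_ ?_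
  · rw [Mi _ hf, Mi _ hg, Mi _ hh,
      Ls _ _ hk.le, Ls _ _ hl.le, mul_mul_mul_comm, ← ei] at this
    exact (ENNReal.mul_le_mul_iff_right (ENNReal.inv_ne_zero.2 (ENNReal.mul_ne_top akT blT))
      (ENNReal.inv_ne_top.2 (mul_ne_zero ak bl))).1 this
  · intro x y
    rw [Ls _ _ hk.le, Ls _ _ hl.le, mul_mul_mul_comm, ← ei]
    exact Ld Lj (H x y)
  · rw [← ENNReal.mul_iSup, ← ha, ENNReal.inv_mul_cancel a0 fT]
  · rw [← ENNReal.mul_iSup, ← hb, ENNReal.inv_mul_cancel b0 gT]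

lemma pl1 {k l : ℝ} (hk : 0 < k) (hl : 0 < l) (h1 : k + l = 1) {f g h : ℝ → ENNReal}
    (hf : Measurable f) (hg : Measurable g) (hh : Measurable h)
    (H : ∀ x y, f x ^ k * g y ^ l ≤ h (k * x + l * y)) :
    (∫⁻ x, f x) ^ k * (∫⁻ x, g x) ^ l ≤ ∫⁻ x, h x := by
  have hT : ∀ (f : ℝ → ENNReal) (n : ℕ), ⨆ x, min (f x) n ≠ ⊤ := fun f n =>
    ne_top_of_le_ne_top (ENNReal.natCast_ne_top n) (iSup_le fun x => Lb _ _)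
  have key : ∀ i n : ℕ, (∫⁻ x, min (f x) i) ^ k * (∫⁻ x, min (g x) n) ^ l ≤ ∫⁻ x, h x := by
    intro i n
    refine pl_bdd hk hl h1 (by fun_prop) (by fun_prop) hh (fun x y => ?_) (hT f i) (hT g n)
    refine Mm ?_ (H x y)
    exact Ld (Nd (Lq _ _) hk.le)
      (Nd (Lq _ _) hl.le)
  have sup : ∀ f : ℝ → ENNReal, Measurable f → ∫⁻ x, f x = ⨆ n : ℕ, ∫⁻ x, min (f x) n := by
    intro f hf
    rw [← lintegral_iSup (f := fun (n : ℕ) x => min (f x) n) (fun n => by fun_prop)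
      (fun i j hij x => min_le_min Lj (by exact_mod_cast hij))]
    refine lintegral_congr fun x => ?_
    rw [← inf_iSup_eq, ENNReal.iSup_natCast, inf_top_eq]
  have pow : ∀ {k : ℝ} (hk : 0 < k) (u : ℕ → ENNReal), (⨆ n, u n) ^ k = ⨆ n, (u n) ^ k := by
    intro k hk u
    exact (ENNReal.orderIsoRpow k hk).map_iSup u
  rw [sup f hf, sup g hg, pow hk, pow hl, ENNReal.iSup_mul]
  refine iSup_le fun i => ?_
  rw [ENNReal.mul_iSup]
  exact iSup_le fun n => key i n

lemma lint_cons {n : ℕ} (f : (Fin (n+1) → ℝ) → ENNReal) (hf : Measurable f) :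
    ∫⁻ x, f x = ∫⁻ a : ℝ, ∫⁻ b : Fin n → ℝ, f (Fin.cons a b) := by
  have h := (volume_preserving_piFinSuccAbove (fun _ : Fin (n+1) => ℝ) 0).symm
  rw [← h.lintegral_comp hf, Measure.volume_eq_prod,
    lintegral_prod (fun z => f ((MeasurableEquiv.piFinSuccAbove (fun _ : Fin (n+1) => ℝ) 0).symm z))
      (hf.comp (MeasurableEquiv.measurable _)).aemeasurable]
  simp [MeasurableEquiv.piFinSuccAbove, Fin.insertNthEquiv]

lemma meas_cons {n : ℕ} : Measurable (fun z : ℝ × (Fin n → ℝ) => (Fin.cons z.1 z.2 : Fin (n+1) → ℝ)) := by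
  refine measurable_pi_iff.2 fun i => ?_
  refine Fin.cases ?_ (fun j => ?_) i
  · simpa using measurable_fst
  · simp only [Fin.cons_succ]; fun_prop

lemma pln {k l : ℝ} (hk : 0 < k) (hl : 0 < l) (h1 : k + l = 1) (n : ℕ) :
    ∀ {f g h : (Fin n → ℝ) → ENNReal}, Measurable f → Measurable g → Measurable h →
    (∀ x y, f x ^ k * g y ^ l ≤ h (k • x + l • y)) →
    (∫⁻ x, f x) ^ k * (∫⁻ x, g x) ^ l ≤ ∫⁻ x, h x := by
  induction n with
  | zero =>
    intro f g h hf hg hh H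
    have e : ∀ f : (Fin 0 → ℝ) → ENNReal, ∫⁻ x, f x = f default := fun f => by
      rw [lintegral_unique, volume_pi, Measure.pi_univ]; simp; exact congrArg f (Subsingleton.elim _ _)
    rw [e, e, e]
    exact (H _ _).trans_eq (congrArg h (Subsingleton.elim _ _))
  | succ n ih =>
    intro f g h hf hg hh H
    have mc : ∀ a, Measurable (fun b : Fin n → ℝ => (Fin.cons a b : Fin (n+1) → ℝ)) := fun a =>
      meas_cons.comp (by fun_prop : Measurable fun b : Fin n → ℝ => (a, b))
    have mm : ∀ f : (Fin (n+1) → ℝ) → ENNReal, Measurable f →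
      Measurable fun a : ℝ => ∫⁻ b : Fin n → ℝ, f (Fin.cons a b) := fun f hf =>
      Measurable.lintegral_prod_right (hf.comp meas_cons)
    rw [lint_cons f hf, lint_cons g hg, lint_cons h hh]
    refine pl1 hk hl h1 (mm f hf) (mm g hg) (mm h hh) fun a a' => ?_
    refine ih (hf.comp (mc a)) (hg.comp (mc a')) (hh.comp (mc _)) fun b b' => ?_
    refine (H _ _).trans_eq (congrArg h ?_)
    ext i
    refine Fin.cases ?_ (fun j => ?_) i <;> simp

lemma plE {k l : ℝ} (hk : 0 < k) (hl : 0 < l) (h1 : k + l = 1) {d : ℕ}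
    {f g h : EuclideanSpace ℝ (Fin d) → ENNReal} (hf : Measurable f) (hg : Measurable g)
    (hh : Measurable h) (H : ∀ x y, f x ^ k * g y ^ l ≤ h (k • x + l • y)) :
    (∫⁻ x, f x) ^ k * (∫⁻ x, g x) ^ l ≤ ∫⁻ x, h x := by
  have e := (EuclideanSpace.volume_preserving_symm_measurableEquiv_toLp (Fin d)).symm
  rw [← e.lintegral_comp hf, ← e.lintegral_comp hg, ← e.lintegral_comp hh]
  refine pln hk hl h1 d (hf.comp (MeasurableEquiv.measurable _)) (hg.comp (MeasurableEquiv.measurable _))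
    (hh.comp (MeasurableEquiv.measurable _)) fun x y => ?_
  exact H _ _

lemma bm {d : ℕ} {A : Set (EuclideanSpace ℝ (Fin d))} (hA : IsOpen A)
    (hA0 : A.Nonempty) {ρ h : ℝ} (hρ : 0 ≤ ρ) (hh : 0 < h)
    (hr : oR (ρ ^ d) * volume (Lv (0 : EuclideanSpace ℝ (Fin d)) 1) ≤ volume A) :
    oR ((ρ + h) ^ d) * volume (Lv (0 : EuclideanSpace ℝ (Fin d)) 1) ≤
      volume (Metric.thickening h A) := by
  have fr : Module.finrank ℝ (EuclideanSpace ℝ (Fin d)) = d := by simp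
  set ω := volume (Lv (0 : EuclideanSpace ℝ (Fin d)) 1) with hω
  have sub : ∀ x ∈ A, ∀ y : EuclideanSpace ℝ (Fin d), y ∈ Lv (0 : EuclideanSpace ℝ (Fin d)) h →
    x + y ∈ Metric.thickening h A := fun x hx y hy =>
      Metric.mem_thickening_iff.2 ⟨x, hx, by simpa using hy⟩
  have bv : ∀ (x : EuclideanSpace ℝ (Fin d)) {r : ℝ}, 0 < r →
      volume (Lv x r) = oR (r ^ d) * ω := fun x r hr => by
    rw [Measure.addHaar_ball_of_pos _ x hr, fr]
  rcases hρ.eq_or_lt with rfl | hρ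
  · obtain ⟨x, hx⟩ := hA0
    rw [zero_add, ← bv x hh]
    exact measure_mono fun y hy => Metric.mem_thickening_iff.2 ⟨x, hx, hy⟩
  set k := ρ / (ρ + h) with hkd
  set l := h / (ρ + h) with hld
  have hk : 0 < k := by positivity
  have hl : 0 < l := by positivity
  have hkl : k + l = 1 := by rw [hkd, hld]; field_simp
  set X := oR ((ρ + h) ^ d) * ω
  have mA : MeasurableSet ((fun x => k • x) ⁻¹' A) := (hA.preimage (by fun_prop)).measurableSet
  have key := plE hk hl hkl (f := ((fun x => k • x) ⁻¹' A).indicator 1)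
    (g := (Lv (0 : EuclideanSpace ℝ (Fin d)) (ρ + h)).indicator 1)
    (h := (Metric.thickening h A).indicator 1) (Mq mA)
    (Mq measurableSet_ball)
    (Mq Metric.isOpen_thickening.measurableSet) ?_
  · rw [Lt mA, Lt measurableSet_ball,
      Lt Metric.isOpen_thickening.measurableSet, bv _ PO] at key
    refine Mm ?_ key
    have h2 : X ≤ volume ((fun x => k • x) ⁻¹' A) := by
      rw [Measure.addHaar_preimage_smul _ hk.ne', fr, Na PO]
      refine Mm (le_of_eq ?_) (Ld Lj hr)
      rw [← Mx, ← Kj PO]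
      have : (ρ + h) ^ d = (k ^ d)⁻¹ * ρ ^ d := by rw [hkd, div_pow]; field_simp
      rw [← this]
    have h3 : X = X ^ k * X ^ l := by
      rw [← ENNReal.rpow_add_of_nonneg _ _ hk.le hl.le, hkl, ENNReal.rpow_one X]
    nth_rewrite 1 [h3]
    exact Ld (Nd h2 hk.le) Lj
  · intro x y
    by_cases hx : x ∈ (fun x => k • x) ⁻¹' A
    · by_cases hy : y ∈ Lv (0 : EuclideanSpace ℝ (Fin d)) (ρ + h)
      · rw [Kh hx, Kh hy, Kh]
        · simp
        · refine sub _ hx _ ?_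
          rw [mem_ball_zero_iff] at hy ⊢
          rw [norm_smul, Kc hl.le, hld, Kt, div_lt_iff₀ PO]
          gcongr
      · simp [Kz hy, hl]
    · simp [Kz hx, hk]

instance nu_sf : SFinite (nu d) := by unfold nu; infer_instance

lemma dlc_pt (hp : 1 < p) {a : ℝ} (ha : 0 ≤ a) :
    ∫⁻ l in Ioi (0:ℝ), oR (p*pJ*l^(p-2)) * oR (a - l) = oR (a^p) := by
  have e : ∀ l ∈ Ioi (0:ℝ), oR (p*pJ*l^(p-2)) * oR (a - l) =
      (Ioc 0 a).indicator (fun l => oR (p*pJ*l^(p-2) * (a - l))) l := by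
    intro l hl
    have hl : 0 < l := hl
    have h0 : 0 ≤ p*pJ*l^(p-2) := by
      have : 0 < p - 1 := by linarith
      positivity
    by_cases h : l ≤ a
    · rw [Kh (by exact ⟨hl, h⟩), Kj h0]
    · rw [Kz (by simp [h]), ENNReal.ofReal_of_nonpos (p := a - l) LA, Mn]
  rw [setLIntegral_congr_fun Ka e, setLIntegral_indicator Ke,
    inter_eq_left.2 Ioc_subset_Ioi_self]
  have hi1 : IntervalIntegrable (fun l : ℝ => l^(p-2)) volume 0 a :=
    intervalIntegral.intervalIntegrable_rpow' LA
  have hi2 : IntervalIntegrable (fun l : ℝ => l^pJ) volume 0 a :=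
    intervalIntegral.intervalIntegrable_rpow' LA
  have hi : IntervalIntegrable (fun l : ℝ => p*pJ*a*l^(p-2) - p*pJ*l^pJ) volume 0 a :=
    (hi1.const_mul _).sub (hi2.const_mul _)
  have ee : EqOn (fun l : ℝ => p*pJ*l^(p-2) * (a - l)) (fun l : ℝ => p*pJ*a*l^(p-2) - p*pJ*l^pJ) (Ioc 0 a) := by
    intro l hl
    have : l^pJ = l^(p-2) * l := by
      rw [← Real.rpow_add_one hl.1.ne']; ring_nf
    simp only; rw [this]; ring
  have hI : IntegrableOn (fun l : ℝ => p*pJ*l^(p-2) * (a - l)) (Ioc 0 a) :=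
    ((Kp ha).1 hi).congr_fun ee.symm Ke
  rw [← Kl hI]
  · congr 1
    rw [setIntegral_congr_fun Ke ee, ← Kv ha,
      intervalIntegral.integral_sub (hi1.const_mul _) (hi2.const_mul _),
      intervalIntegral.integral_const_mul, intervalIntegral.integral_const_mul,
      integral_rpow (by left; linarith), integral_rpow (by left; linarith)]
    have e1 : p - 2 + 1 = p - 1 := by ring
    have e2 : p - 1 + 1 = p := by ring
    rw [e1, e2, Kd LA, Kd LA]
    have h1 : p - 1 ≠ 0 := by linarith
    have h2 : p ≠ 0 := by linarith
    rcases ha.eq_or_lt with rfl | ha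
    · rw [Kd h2, Kd h1]; simp
    · have : a^p = a * a^pJ := by rw [mul_comm, ← Real.rpow_add_one ha.ne']; ring_nf
      rw [this]; field_simp; ring
  · filter_upwards [Kw Ke] with l hl
    have : 0 < p - 1 := by linarith
    have := hl.1
    have : 0 ≤ a - l := by linarith [hl.2]
    simp only [Pi.zero_apply]; positivity

lemma dlc {X : Type*} [MeasurableSpace X] (μ : Measure X) [SFinite μ] (hp : 1 < p) {F G : X → ℝ}
    (hF : Measurable F) (hG : Measurable G) (h0 : ∀ x, 0 ≤ G x) (hle : ∀ x, G x ≤ F x) :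
    ∫⁻ x, oR ((F x - G x)^p) ∂μ = ∫⁻ l in Ioi (0:ℝ), ∫⁻ t in Ioi (0:ℝ),
      oR (p*pJ*l^(p-2)) * μ {x | G x ≤ t ∧ t + l < F x} := by
  have hS : MeasurableSet {z : X × ℝ × ℝ | G z.1 ≤ z.2.2 ∧ z.2.2 + z.2.1 < F z.1} :=
    (measurableSet_le (hG.comp measurable_fst) (by fun_prop : Measurable fun z : X × ℝ × ℝ => z.2.2)).inter
      (Lk (by fun_prop : Measurable fun z : X × ℝ × ℝ => z.2.2 + z.2.1) (hF.comp measurable_fst))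
  set S := {z : X × ℝ × ℝ | G z.1 ≤ z.2.2 ∧ z.2.2 + z.2.1 < F z.1}
  have hI : Measurable (S.indicator (1 : X × ℝ × ℝ → ENNReal)) := Mq hS
  have eS : ∀ l t, ∫⁻ x, S.indicator (1 : X × ℝ × ℝ → ENNReal) (x, l, t) ∂μ = μ {x | G x ≤ t ∧ t + l < F x} := by
    intro l t
    have : (fun x => S.indicator (1 : X × ℝ × ℝ → ENNReal) (x, l, t)) = {x | G x ≤ t ∧ t + l < F x}.indicator 1 := by
      ext x; simp only [indicator_apply, S, Le]; rfl
    rw [this, Lt]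
    exact (measurableSet_le hG Mv).inter (Lk Mv hF)
  have hc : Measurable fun l : ℝ => oR (p*pJ*l^(p-2)) := by fun_prop
  have e1 : ∀ x, ∀ l ∈ Ioi (0:ℝ), ∫⁻ t in Ioi (0:ℝ), S.indicator 1 (x, l, t) = oR ((F x - G x) - l) := by
    intro x l hl
    have hl : 0 < l := hl
    have : (fun t : ℝ => S.indicator (1 : X × ℝ × ℝ → ENNReal) (x, l, t)) = (Ico (G x) (F x - l)).indicator 1 := by
      ext t
      have : (x, l, t) ∈ S ↔ t ∈ Ico (G x) (F x - l) := by
        simp only [S, Le, mem_Ico, lt_sub_iff_add_lt]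
      simp only [indicator_apply, this]; rfl
    rw [this, Lt measurableSet_Ico, Measure.restrict_apply measurableSet_Ico]
    have h2 : volume (Ico (G x) (F x - l) ∩ Ioi 0) = volume (Ico (G x) (F x - l)) := by
      apply measure_congr
      have : ∀ᵐ t : ℝ, t ≠ 0 := by simp [ae_iff]
      filter_upwards [this] with t ht
      apply propext
      constructor
      · exact fun h => h.1
      · exact fun h => ⟨h, Kf ((h0 x).trans h.1) ht.symm⟩
    rw [h2, Real.volume_Ico]; congr 1; ring
  have e2 : ∀ x, oR ((F x - G x)^p) = ∫⁻ l in Ioi (0:ℝ),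
      oR (p*pJ*l^(p-2)) * ∫⁻ t in Ioi (0:ℝ), S.indicator 1 (x, l, t) := by
    intro x
    rw [← dlc_pt hp (sub_nonneg.2 (hle x))]
    refine setLIntegral_congr_fun Ka fun l hl => ?_
    simp only [e1 x l hl]
  have m1 : Measurable fun z : X × ℝ => ∫⁻ t in Ioi (0:ℝ), S.indicator (1 : X × ℝ × ℝ → ENNReal) (z.1, z.2, t) := by
    exact Measurable.lintegral_prod_right
      (hI.comp (by fun_prop : Measurable fun z : (X × ℝ) × ℝ => (z.1.1, z.1.2, z.2)))
  rw [lintegral_congr e2, lintegral_lintegral_swap]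
  · refine lintegral_congr fun l => ?_
    rw [lintegral_const_mul (f := fun x => ∫⁻ t in Ioi (0:ℝ), S.indicator (1 : X × ℝ × ℝ → ENNReal) (x, l, t)) _
      (m1.comp (by fun_prop : Measurable fun x => (x, l))), Mi]
    · rw [lintegral_lintegral_swap]
      · simp_rw [eS]
      · exact (hI.comp (by fun_prop : Measurable fun z : X × ℝ => (z.1, l, z.2))).aemeasurable
    · simp_rw [← eS]
      exact Measurable.lintegral_prod_left
        (hI.comp (by fun_prop : Measurable fun z : X × ℝ => (z.1, l, z.2)))
  · exact ((hc.comp measurable_snd).mul m1).aemeasurable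

abbrev Eu (d : ℕ) := EuclideanSpace ℝ (Fin d)

lemma pow_conv {s R h : ℝ} (hs : 0 ≤ s) (hR : s ≤ R) (hh : 0 ≤ h) (n : ℕ) :
    (s+h)^n - s^n ≤ (R+h)^n - R^n := by
  induction n with
  | zero => simp
  | succ n ih =>
    have h1 : 0 ≤ (s+h)^n - s^n := sub_nonneg.2 (Lu hs LA n)
    have h2 : s^n ≤ R^n := Lu hs hR n
    have : (s+h) * ((s+h)^n - s^n) ≤ (R+h) * ((R+h)^n - R^n) :=
      mul_le_mul LA ih h1 LA
    rw [pow_succ, pow_succ, pow_succ, pow_succ]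
    nlinarith

lemma ball_ne : volume (Lv (0 : Eu d) 1) ≠ 0 := (Metric.measure_ball_pos _ _ Lz).ne'

lemma ball_nt : volume (Lv (0 : Eu d) 1) ≠ ⊤ := measure_ball_lt_top.ne

lemma ball_re : oR (volume.real (Lv (0 : Eu d) 1)) = volume (Lv (0 : Eu d) 1) :=
  ofReal_measureReal ball_nt

lemma nu_Ico (hd : 1 ≤ d) {a b : ℝ} (ha : 0 ≤ a) (hab : a ≤ b) :
    oR (kap d) * nu d (Ico a b) = oR (b^d - a^d) * volume (Lv (0 : Eu d) 1) := by
  have h1 : nu d (Ico a b) = oR ((b^d - a^d)/d) := by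
    rw [nu, withDensity_apply _ measurableSet_Ico, Measure.restrict_restrict measurableSet_Ico]
    have : (Ico a b ∩ Ioi 0 : Set ℝ) =ᵐ[volume] (Ioc a b : Set ℝ) := by
      have n1 : ∀ᵐ t : ℝ, t ≠ a := by simp [ae_iff]
      have n2 : ∀ᵐ t : ℝ, t ≠ b := by simp [ae_iff]
      filter_upwards [n1, n2] with t h1 h2
      apply propext
      constructor
      · rintro ⟨⟨h3, h4⟩, h5⟩; exact ⟨Kf h3 h1.symm, h4.le⟩
      · rintro ⟨h3, h4⟩; exact ⟨⟨h3.le, Kf h4 h2⟩, Mu ha h3⟩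
    rw [setLIntegral_congr this, ← Kl, ← Kv hab,
      integral_pow]
    · rw [Nat.sub_add_cancel hd, Nat.cast_sub hd]; simp
    · exact ((continuous_pow _).integrableOn_Icc).mono_set Ioc_subset_Icc_self
    · filter_upwards [Kw Ke] with t ht
      exact pow_nonneg (ha.trans ht.1.le) _
  have d0 : (0:ℝ) < d := by exact_mod_cast hd
  rw [h1, ← ball_re, ← Kj (kap_pos hd).le, ← Kj (sub_nonneg.2 (Lu ha hab d))]
  congr 1; unfold kap; field_simp

noncomputable def dR (f : Eu d → ℝ) (t : ℝ) : ℝ :=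
  (volume.real {x | t < f x} / volume.real (Lv (0 : Eu d) 1)) ^ (1/(d:ℝ))

noncomputable def rea (f : Eu d → ℝ) (r : ℝ) : ℝ := sSup {t | 0 ≤ t ∧ max r 0 < dR f t}

variable {f : Eu d → ℝ}

lemma dR_nonneg (t : ℝ) : 0 ≤ dR f t := by unfold dR; positivity

lemma lev_fin (hs : HasCompactSupport f) {t : ℝ} (ht : 0 ≤ t) : volume {x | t < f x} ≠ ⊤ := by
  refine ne_top_of_le_ne_top hs.isCompact.measure_lt_top.ne (measure_mono fun x hx => subset_tsupport f ?_)
  simp only [Le] at hx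
  simp; linarith

lemma dR_pow (hd : 1 ≤ d) (hs : HasCompactSupport f) {t : ℝ} (ht : 0 ≤ t) :
    oR (dR f t ^ d) * volume (Lv (0 : Eu d) 1) = volume {x | t < f x} := by
  have d0 : dX ≠ 0 := by exact_mod_cast (by omega : d ≠ 0)
  have o0 : 0 < volume.real (Lv (0 : Eu d) 1) := ENNReal.toReal_pos ball_ne ball_nt
  rw [dR, ← Real.rpow_natCast, ← Ks PO, one_div, inv_mul_cancel₀ d0, Ku,
    ← ball_re, ← Kj PO, div_mul_cancel₀ _ o0.ne', ofReal_measureReal (lev_fin hs ht)]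

lemma lt_dR (hd : 1 ≤ d) (hs : HasCompactSupport f) {t r : ℝ} (ht : 0 ≤ t) (hr : 0 ≤ r) :
    r < dR f t ↔ oR (r^d) * volume (Lv (0 : Eu d) 1) < volume {x | t < f x} := by
  rw [← dR_pow hd hs ht, ENNReal.mul_lt_mul_iff_left ball_ne ball_nt, ENNReal.ofReal_lt_ofReal_iff_of_nonneg PO,
    pow_lt_pow_iff_left₀ hr (dR_nonneg _) (by omega)]

lemma dR_anti (hs : HasCompactSupport f) {s t : ℝ} (h0 : 0 ≤ s) (h : s ≤ t) : dR f t ≤ dR f s := by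
  unfold dR
  refine Ko PO ?_ PO
  refine div_le_div_of_nonneg_right ?_ PO
  exact measureReal_mono (fun x hx => Mu h hx) (lev_fin hs h0)

lemma dR_rc (hd : 1 ≤ d) (hs : HasCompactSupport f) {t r : ℝ} (ht : 0 ≤ t) (hr : 0 ≤ r)
    (h : r < dR f t) : ∃ t' > t, r < dR f t' := by
  rw [lt_dR hd hs ht hr] at h
  have e : {x | t < f x} = ⋃ n : ℕ, {x | t + 1/((n:ℝ)+1) < f x} := by
    ext x
    simp only [mem_iUnion, Le]
    constructor
    · intro h
      obtain ⟨n, hn⟩ := exists_nat_one_div_lt (sub_pos.2 h)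
      exact ⟨n, by linarith⟩
    · rintro ⟨n, hn⟩
      have : (0:ℝ) < 1/((n:ℝ)+1) := by positivity
      linarith
  have mono : Monotone fun n : ℕ => {x | t + 1/((n:ℝ)+1) < f x} := by
    intro i j hij x hx
    simp only [Le] at hx ⊢
    have : 1/((j:ℝ)+1) ≤ 1/((i:ℝ)+1) := by gcongr
    linarith
  rw [e, mono.measure_iUnion] at h
  obtain ⟨n, hn⟩ := lt_iSup_iff.1 h
  have : (0:ℝ) < 1/((n:ℝ)+1) := by positivity
  exact ⟨t + 1/((n:ℝ)+1), by simp only [gt_iff_lt]; linarith, (lt_dR hd hs LA hr).2 hn⟩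

lemma rea_bdd (hc : Continuous f) (hs : HasCompactSupport f) (hd : 1 ≤ d) (r : ℝ) :
    BddAbove {t | 0 ≤ t ∧ max r 0 < dR f t} := by
  obtain ⟨B, hB⟩ := hc.bddAbove_range_of_hasCompactSupport hs
  refine ⟨B, fun t ht => ?_⟩
  by_contra h
  push Not at h
  have e : {x | t < f x} = ∅ := by
    ext x; simpa using (hB (mem_range_self x)).trans h.le
  have := (lt_dR hd hs ht.1 (Mo r 0)).1 ht.2
  simp [e] at this

lemma lt_rea (hd : 1 ≤ d) (hc : Continuous f) (hs : HasCompactSupport f) {t r : ℝ} (ht : 0 ≤ t)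
    (hr : 0 ≤ r) : t < rea f r ↔ r < dR f t := by
  constructor
  · intro h
    have ne : {t | 0 ≤ t ∧ max r 0 < dR f t}.Nonempty := by
      by_contra h0
      rw [not_nonempty_iff_eq_empty] at h0
      rw [rea, h0, Real.sSup_empty] at h; linarith
    obtain ⟨t', h1, h2⟩ := exists_lt_of_lt_csSup ne h
    exact (Lf _ _).trans_lt (h1.2.trans_le (dR_anti hs ht h2.le))
  · intro h
    obtain ⟨t', h1, h2⟩ := dR_rc hd hs ht hr h
    exact h1.trans_le (le_csSup (rea_bdd hc hs hd r) ⟨ht.trans h1.le, by rwa [max_eq_left hr]⟩)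

lemma rea_nonneg (r : ℝ) : 0 ≤ rea f r := Real.sSup_nonneg fun t ht => ht.1

lemma rea_anti (hd : 1 ≤ d) (hc : Continuous f) (hs : HasCompactSupport f) : Antitone (rea f) := by
  intro r s hrs
  rcases eq_empty_or_nonempty {t | 0 ≤ t ∧ max s 0 < dR f t} with h | h
  · rw [rea, h, Real.sSup_empty]; exact rea_nonneg r
  · exact csSup_le_csSup (rea_bdd hc hs hd r) h fun t ht => ⟨ht.1, (max_le_max hrs Lj).trans_lt ht.2⟩

lemma rea_lim (hs : HasCompactSupport f) : Tendsto (rea f) atTop (𝓝 0) := by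
  refine Ml ?_
  filter_upwards [Lr (dR f 0)] with r hr
  have : {t | 0 ≤ t ∧ max r 0 < dR f t} = ∅ := by
    ext t
    simp only [Le, mem_empty_iff_false, iff_false, not_and, not_lt]
    exact fun ht => (dR_anti hs Lj ht).trans (hr.trans (Lf _ _))
  rw [rea, this, Real.sSup_empty]

lemma rea_equi (hd : 1 ≤ d) (hc : Continuous f) (h0 : ∀ x, 0 ≤ f x) (hs : HasCompactSupport f)
    {s : ℝ} (hs0 : 0 < s) :
    ∫⁻ x, oR (f x ^ s) = oR (kap d) * LI d s (rea f) := by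
  unfold LI
  rw [lintegral_rpow_eq_lintegral_meas_lt_mul _ (Eventually.of_forall h0) hc.measurable.aemeasurable hs0,
    lintegral_rpow_eq_lintegral_meas_lt_mul _ (Eventually.of_forall rea_nonneg)
      (rea_anti hd hc hs).measurable.aemeasurable hs0, mul_left_comm]
  congr 1
  rw [← Ky _ _ (by simp)]
  refine setLIntegral_congr_fun Ka fun t ht => ?_
  have ht : 0 < t := ht
  rw [← Mx]
  congr 1
  have : nu d {a | t < rea f a} = nu d (Ico 0 (dR f t)) := by
    apply measure_congr
    filter_upwards [nu_pos_ae] with r hr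
    apply propext
    change t < rea f r ↔ r ∈ Ico 0 (dR f t)
    rw [lt_rea hd hc hs ht.le hr.le]
    simp [hr.le]
  rw [this, nu_Ico hd Lj (dR_nonneg _), zero_pow (by omega), sub_zero, dR_pow hd hs ht.le]

lemma rea_step (hd : 1 ≤ d) (hp : 1 < p) (hc : Continuous f) (h0 : ∀ x, 0 ≤ f x) (hs : HasCompactSupport f)
    {Φ : Eu d → ℝ} (hΦ : Measurable Φ) {h : ℝ} (hh : 0 < h) (hle : ∀ x y, dist x y < h → f y ≤ Φ x) :
    oR (kap d) * ∫⁻ r, oR ((rea f r - rea f (r + h))^p) ∂nu d ≤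
      ∫⁻ x, oR ((Φ x - f x)^p) := by
  have ra := rea_anti hd hc hs
  rw [dlc volume hp hΦ hc.measurable h0 (fun x => hle x x (by simpa)),
    dlc (nu d) hp ra.measurable (G := fun r => rea f (r + h)) (ra.measurable.comp (by fun_prop))
      (fun r => rea_nonneg _) (fun r => ra LA),
    ← Ky _ _ (by simp)]
  refine Li Ka fun l hl => ?_
  rw [← Ky _ _ (by simp)]
  refine Li Ka fun t ht => ?_
  rw [mul_left_comm]
  refine Ld Lj ?_
  have hl : 0 < l := hl
  have ht : 0 < t := ht
  set s := max (dR f t - h) 0 with hsd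
  set R := dR f (t + l) with hR
  have s0 : 0 ≤ s := Mo _ _
  have h1 : nu d {r | rea f (r + h) ≤ t ∧ t + l < rea f r} ≤ nu d (Ico s R) := by
    apply measure_mono_ae
    filter_upwards [nu_pos_ae] with r hr h1
    change r ∈ Ico s R
    obtain ⟨h1, h2⟩ : rea f (r + h) ≤ t ∧ t + l < rea f r := h1
    rw [lt_rea hd hc hs LA hr.le] at h2
    rw [← not_lt, lt_rea hd hc hs ht.le LA] at h1
    exact ⟨max_le LA hr.le, h2⟩
  refine (Ld Lj h1).trans ?_
  rcases Mz R s with hRs | hRs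
  · simp [Ico_eq_empty (not_lt.2 hRs)]
  rw [nu_Ico hd s0 hRs.le]
  have hA : IsOpen {x | t + l < f x} := isOpen_lt continuous_const hc
  have hne : {x | t + l < f x}.Nonempty := by
    by_contra hn
    rw [not_nonempty_iff_eq_empty] at hn
    have := (lt_dR hd hs (by linarith : 0 ≤ t + l) s0).1 hRs
    simp [hn] at this
  have hb := bm hA hne (dR_nonneg (f := f) (t+l)) hh (dR_pow hd hs LA).le
  rw [← hR] at hb
  have h2 : volume (Metric.thickening h {x | t + l < f x}) ≤
      volume {x | f x ≤ t ∧ t + l < Φ x} + volume {x | t < f x} := by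
    refine (measure_mono ?_).trans (measure_union_le _ _)
    intro x hx
    obtain ⟨y, hy, hxy⟩ := Metric.mem_thickening_iff.1 hx
    rcases Mz (f x) t with h | h
    · exact Or.inl ⟨h, Kn hy (hle x y hxy)⟩
    · exact Or.inr h
  have h3 := hb.trans h2
  rw [← dR_pow hd hs ht.le] at h3
  have nt : oR (dR f t ^ d) * volume (Lv (0 : Eu d) 1) ≠ ⊤ :=
    ENNReal.mul_ne_top (by simp) ball_nt
  refine (ENNReal.add_le_add_iff_right nt).1 (Mm ?_ h3)
  rw [← add_mul, ← Mr (sub_nonneg.2 (Lu s0 hRs.le d)) (pow_nonneg (dR_nonneg _) _)]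
  refine Ld (Ki ?_) Lj
  have h4 := pow_conv s0 hRs.le hh.le d
  have h5 : dR f t ^ d ≤ (s + h)^d :=
    Lu (dR_nonneg _) (by have := Lf (dR f t - h) 0; linarith) d
  linarith

lemma cc_int {D : Eu d → ℝ} (hc : Continuous D) (hs : HasCompactSupport D) {s : ℝ} (hs0 : 0 < s) :
    Integrable fun x => |D x|^s :=
  (hc.abs.rpow_const fun x => Or.inr hs0.le).integrable_of_hasCompactSupport
    (hs.comp_left (g := fun y => |y|^s) (by simp [hs0.ne']))

lemma ps_step {u : Eu d → ℝ} (hu : ContDiff ℝ 1 u) (hs : HasCompactSupport u) {e : ℝ} (he : 0 < e) :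
    ∃ h : ℝ, 0 < h ∧ h ≤ e ∧ h ≤ 1 ∧ ∀ x y, dist x y < h → |u y| ≤
      |u x| + h * (Metric.cthickening 1 (tsupport u)).indicator (fun x => ‖fderiv ℝ u x‖ + e) x := by
  have huc : UniformContinuous (fderiv ℝ u) :=
    (hu.continuous_fderiv Mj).uniformContinuous_of_tendsto_cocompact
      (hs.fderiv (𝕜 := ℝ)).is_zero_at_infty
  obtain ⟨δ, hδ, H⟩ := Metric.uniformContinuous_iff.1 huc e he
  refine ⟨min δ (min e 1), by positivity, (Lb _ _).trans (Lq _ _),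
    (Lb _ _).trans (Lb _ _), fun x y hxy => ?_⟩
  set h := min δ (min e 1)
  have h0 : 0 < h := by positivity
  have h1 : h ≤ 1 := (Lb _ _).trans (Lb _ _)
  by_cases hx : x ∈ Metric.cthickening 1 (tsupport u)
  · rw [Kh hx]
    have key := (convex_ball x h).norm_image_sub_le_of_norm_fderiv_le (𝕜 := ℝ) (f := u)
      (C := ‖fderiv ℝ u x‖ + e) (fun z _ => (hu.differentiable Mj).differentiableAt)
      (fun z hz => by
        have := H (a := z) (b := x) (Kn hz (Lq _ _))
        rw [dist_eq_norm] at this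
        have := norm_le_norm_add_norm_sub' (fderiv ℝ u z) (fderiv ℝ u x)
        linarith) (Metric.mem_ball_self h0) (by rwa [Metric.mem_ball, dist_comm])
    have h2 : ‖y - x‖ ≤ h := by rw [← dist_eq_norm, dist_comm]; exact hxy.le
    have h3 : (‖fderiv ℝ u x‖ + e) * ‖y - x‖ ≤ (‖fderiv ℝ u x‖ + e) * h := by gcongr
    have h4 := abs_sub_abs_le_abs_sub (u y) (u x)
    rw [Mk] at key
    linarith
  · have : y ∉ tsupport u := fun hy => hx (Metric.mem_cthickening_of_dist_le x y 1 _ hy (hxy.le.trans h1))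
    rw [image_eq_zero_of_notMem_tsupport this, Kz hx]
    simp

lemma polya (hd : 1 ≤ d) (hp : 1 < p) (hq : 0 < q + 1) {u : Eu d → ℝ} (hu : ContDiff ℝ 1 u)
    (hs : HasCompactSupport u) :
    (∀ s : ℝ, 0 < s → ∫ x, |u x|^s = kap d * RI d s (rea fun x => |u x|)) ∧
    ∃ g, AD (rea fun x => |u x|) g ∧ kap d * RI d p g ≤ ∫ x, ‖fderiv ℝ u x‖^p := by
  set f : Eu d → ℝ := fun x => |u x| with hf
  have hc : Continuous f := hu.continuous.abs
  have f0 : ∀ x, 0 ≤ f x := fun x => Mw _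
  have fs : HasCompactSupport f := hs.comp_left (g := fun y => |y|) abs_zero
  have k0 := kap_pos hd
  have wm : Measurable (rea f) := (rea_anti hd hc fs).measurable
  have w0 : ∀ r, 0 < r → 0 ≤ rea f r := fun r _ => rea_nonneg r
  have ei : ∀ s : ℝ, 0 < s → oR (∫ x, f x^s) = oR (kap d) * LI d s (rea f) := by
    intro s hs0
    rw [← rea_equi hd hc f0 fs hs0, Kl (cc_int hu.continuous hs hs0)
      (Eventually.of_forall fun x => Kb (f0 x) s)]
  have ii : ∀ s : ℝ, 0 < s → Integrable (fun r => rea f r ^ s) (nu d) := by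
    intro s hs0
    rw [← li_iff wm.aemeasurable w0]
    intro h
    have := ei s hs0
    rw [h, ENNReal.mul_top (by simpa using k0)] at this
    simp at this
  refine ⟨fun s hs0 => ?_, ?_⟩
  · have := ei s hs0
    rw [li_eq w0 (ii s hs0), ← Kj k0.le] at this
    exact (ENNReal.ofReal_eq_ofReal_iff (integral_nonneg fun x => Kb (f0 x) s)
      (La k0.le (RI_nonneg w0))).1 this
  have p0 : 0 < p := by linarith
  have Dc : Continuous fun x => ‖fderiv ℝ u x‖ := (hu.continuous_fderiv Mj).norm
  have Ds : HasCompactSupport fun x => ‖fderiv ℝ u x‖ := (hs.fderiv (𝕜 := ℝ)).norm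
  have Di : Integrable fun x => ‖fderiv ℝ u x‖^p := by simpa using! cc_int Dc Ds p0
  set K' := Metric.cthickening 1 (tsupport u) with hK'
  have cK' : IsCompact K' := hs.isCompact.cthickening
  choose h h1 h2 _ h3 using fun k : ℕ => ps_step hu hs (e := 1/((k:ℝ)+1)) PO
  set KK : ℝ → ENNReal := fun e => (oR (kap d))⁻¹ * ∫⁻ x in K', oR ((‖fderiv ℝ u x‖ + e)^p)
  have kk0 : oR (kap d) ≠ 0 := by simpa using k0
  have kk1 : oR (kap d) ≠ ⊤ := by simp
  have fin1 : ∫⁻ x in K', oR ((‖fderiv ℝ u x‖ + 1)^p) ≠ ⊤ := by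
    have : IntegrableOn (fun x => (‖fderiv ℝ u x‖ + 1)^p) K' :=
      (((Dc.add continuous_const).rpow_const fun x => Or.inr p0.le).continuousOn).integrableOn_compact cK'
    exact (Integrable.lintegral_lt_top this).ne
  have hK0 : oR (kap d) * KK 0 ≤ oR (∫ x, ‖fderiv ℝ u x‖^p) := by
    simp only [KK, add_zero]
    rw [← Mx, ENNReal.mul_inv_cancel kk0 kk1, one_mul, Kl Di
      (Eventually.of_forall fun x => by positivity)]
    exact setLIntegral_le_lintegral _ _
  have tend : Tendsto (fun k : ℕ => KK (1/((k:ℝ)+1))) atTop (𝓝 (KK 0)) := by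
    refine ENNReal.Tendsto.const_mul ?_ (Or.inr (by simpa using k0))
    refine tendsto_lintegral_of_dominated_convergence (fun x => oR ((‖fderiv ℝ u x‖ + 1)^p))
      (fun n => ?_) (fun n => ?_) fin1 (Eventually.of_forall fun x => ?_)
    · exact ((Dc.add continuous_const).rpow_const fun x => Or.inr p0.le).measurable.ennreal_ofReal
    · refine Eventually.of_forall fun x => Ki ?_
      refine Ko PO ?_ p0.le
      gcongr
      rw [div_le_one PO]; linarith [(n.cast_nonneg : (0:ℝ) ≤ n)]
    · refine ENNReal.tendsto_ofReal ?_
      refine Tendsto.rpow_const ?_ (Or.inr p0.le)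
      exact tendsto_const_nhds.add Lc
  have kt : KK 0 ≠ ⊤ := by
    intro hT
    rw [hT, ENNReal.mul_top kk0] at hK0
    simp at hK0
  have st0 : ∀ k, ∫⁻ r, oR (((rea f r - rea f (r + h k))/h k)^p) ∂nu d ≤ KK (1/((k:ℝ)+1)) := by
    intro k
    have hk := h1 k
    set e : ℝ := 1/((k:ℝ)+1)
    have e0 : 0 < e := by positivity
    set ψ : Eu d → ℝ := K'.indicator (fun x => ‖fderiv ℝ u x‖ + e) with hψ
    have hΦ : Measurable fun x => f x + h k * ψ x :=
      hc.measurable.add (((Dc.add continuous_const).measurable.indicator cK'.measurableSet).const_mul _)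
    have st := rea_step hd hp hc f0 fs hΦ hk (h3 k)
    have eL : ∫⁻ r, oR ((rea f r - rea f (r + h k))^p) ∂nu d = oR (h k ^p) *
        ∫⁻ r, oR (((rea f r - rea f (r + h k))/h k)^p) ∂nu d := by
      rw [← Ky _ _ (by simp)]
      refine lintegral_congr fun r => ?_
      have : 0 ≤ rea f r - rea f (r + h k) := sub_nonneg.2 (rea_anti hd hc fs LA)
      rw [← Kj PO, ← Kg hk.le PO, mul_div_cancel₀ _ hk.ne']
    have eR : ∫⁻ x, oR ((f x + h k * ψ x - f x)^p) = oR (h k ^p) *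
        ∫⁻ x in K', oR ((‖fderiv ℝ u x‖ + e)^p) := by
      rw [← lintegral_indicator cK'.measurableSet, ← Ky _ _ (by simp)]
      refine lintegral_congr fun x => ?_
      rw [add_sub_cancel_left]
      by_cases hx : x ∈ K'
      · rw [hψ, Kh hx, Kh hx, Kg hk.le PO, Kj PO]
      · rw [hψ, Kz hx, Kz hx, Mn, Kd p0.ne']; simp
    rw [eL, eR, mul_left_comm] at st
    have hp0 : oR (h k ^ p) ≠ 0 := by simpa using Real.rpow_pos_of_pos hk p
    have st := (ENNReal.mul_le_mul_iff_right hp0 (by simp)).1 st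
    calc _ = (oR (kap d))⁻¹ * (oR (kap d) *
        ∫⁻ r, oR (((rea f r - rea f (r + h k))/h k)^p) ∂nu d) := by
          rw [← Mx, ENNReal.inv_mul_cancel kk0 kk1, one_mul]
      _ ≤ _ := Ld Lj st
  obtain ⟨g, hg, hgK⟩ := riesz (d := d) hp ((rea_anti hd hc fs).antitoneOn _) (rea_lim fs) (h := h) h1
    (squeeze_zero (fun k => (h1 k).le) h2 Lc)
    (K := KK 0) kt tend st0
  have iG : Integrable (fun r => g r ^ p) (nu d) := by
    rw [← li_iff hg.gm.aemeasurable (fun r _ => hg.g0 r)]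
    refine ne_top_of_le_ne_top ?_ hgK
    intro hT
    rw [hT, ENNReal.mul_top kk0] at hK0
    simp at hK0
  refine ⟨g, ⟨hg, ii _ hq, iG⟩, ?_⟩
  have := (Ld (le_refl (oR (kap d))) hgK).trans hK0
  change _ * LI d p g ≤ _ at this
  rw [li_eq (fun r _ => hg.g0 r) iG, ← Kj k0.le] at this
  exact (Lg (integral_nonneg fun x => by positivity)).1 this

lemma dct_pow {u : Eu d → ℝ} {v : ℕ → Eu d → ℝ} (hv : ∀ n, Continuous (v n)) (hle : ∀ n x, |v n x| ≤ |u x|)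
    (hl : ∀ x, Tendsto (fun n => v n x) atTop (𝓝 (u x))) {s : ℝ} (hs : 0 < s) (hi : Integrable fun x => |u x|^s) :
    Tendsto (fun n => ∫ x, |v n x|^s) atTop (𝓝 (∫ x, |u x|^s)) := by
  refine tendsto_integral_of_dominated_convergence _ (fun n => ?_) hi (fun n => .of_forall fun x => ?_)
    (.of_forall fun x => ((hl x).abs).rpow_const (Or.inr hs.le))
  · exact ((hv n).abs.rpow_const fun x => Or.inr hs.le).aestronglyMeasurable
  · rw [Kc PO]
    exact Ko (Mw _) (hle n x) hs.le

lemma lim_step {u : Eu d → ℝ} {v : ℕ → Eu d → ℝ} {C a b : ℝ} (hm : 0 < m + 1) (hq : 0 < q + 1)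
    (hC : 0 ≤ C) (ha : 0 < a) (hb : 0 < b)
    (hv : ∀ n, Continuous (v n)) (hle : ∀ n x, |v n x| ≤ |u x|)
    (hl : ∀ x, Tendsto (fun n => v n x) atTop (𝓝 (u x))) (hi : Integrable fun x => |u x|^qJ)
    {γ : ℕ → ℝ} {G : ℝ} (hG : Tendsto γ atTop (𝓝 G)) (G0 : 0 ≤ G)
    (hn : ∀ n, (∫ x, |v n x|^mJ)^(1/mJ) ≤ C * (∫ x, |v n x|^qJ)^a * γ n^b) :
    (∫ x, |u x|^mJ)^(1/mJ) ≤ C * (∫ x, |u x|^qJ)^a * G^b := by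
  by_cases h : Integrable fun x => |u x|^mJ
  · refine le_of_tendsto_of_tendsto' (b := atTop) ?_ ?_ hn
    · exact (dct_pow hv hle hl hm h).rpow_const (Or.inr PO)
    · exact (((dct_pow hv hle hl hq hi).rpow_const (Or.inr ha.le)).const_mul C).mul (hG.rpow_const (Or.inr hb.le))
  · rw [integral_undef h, Kd PO]
    have : 0 ≤ ∫ x, |u x|^qJ := integral_nonneg fun x => by positivity
    positivity

lemma step_one {C a b : ℝ} (hm : 0 < m + 1) (hq : 0 < q + 1) (hp : 1 < p)
    (hC : 0 ≤ C) (ha : 0 < a) (hb : 0 < b)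
    (H : ∀ v : Eu d → ℝ, ContDiff ℝ 1 v → HasCompactSupport v →
      (∫ x, |v x|^mJ)^(1/mJ) ≤ C * (∫ x, |v x|^qJ)^a * (∫ x, ‖fderiv ℝ v x‖^p)^b)
    {u : Eu d → ℝ} (hu : ContDiff ℝ 1 u) (hi : Integrable fun x => |u x|^qJ)
    (hip : Integrable fun x => |u x|^p) (hg : Integrable fun x => ‖fderiv ℝ u x‖^p) :
    (∫ x, |u x|^mJ)^(1/mJ) ≤ C * (∫ x, |u x|^qJ)^a * (∫ x, ‖fderiv ℝ u x‖^p)^b := by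
  have p0 : 0 < p := by linarith
  let χ : ContDiffBump (0 : Eu d) := ⟨1, 2, by norm_num, by norm_num⟩
  have χs : ContDiff ℝ 1 χ := χ.contDiff
  have χd := χs.differentiable Mj
  obtain ⟨c, hc⟩ := (χ.hasCompactSupport.fderiv (𝕜 := ℝ)).exists_bound_of_continuous (χs.continuous_fderiv Mj)
  have c0 : 0 ≤ c := (norm_nonneg _).trans (hc 0)
  set e : ℕ → ℝ := fun n => 1/((n:ℝ)+1) with he
  have e0 : ∀ n, 0 < e n := fun n => by simp only [he]; positivity
  have e1 : ∀ n, e n ≤ 1 := fun n => by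
    simp only [he]; rw [div_le_one PO]; linarith [(n.cast_nonneg : (0:ℝ) ≤ n)]
  have ev : ∀ x : Eu d, ∀ᶠ n in atTop, ‖e n • x‖ < 1 := fun x => by
    have : Tendsto (fun n => ‖e n • x‖) atTop (𝓝 0) := by
      have := ((tendsto_one_div_add_atTop_nhds_zero_nat (𝕜 := ℝ)).smul_const x).norm
      simpa [he] using this
    exact this.eventually_lt_const Lz
  have one : ∀ y : Eu d, ‖y‖ < 1 → χ y = 1 := fun y hy => χ.one_of_mem_closedBall (by simpa using! hy.le)
  set v : ℕ → Eu d → ℝ := fun n x => χ (e n • x) * u x with hvdef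
  have χn : ∀ n, ContDiff ℝ 1 fun x : Eu d => χ (e n • x) := fun n => χs.comp (contDiff_const_smul _)
  have hvC : ∀ n, ContDiff ℝ 1 (v n) := fun n => (χn n).mul hu
  have hvs : ∀ n, HasCompactSupport (v n) := fun n =>
    HasCompactSupport.mul_right (χ.hasCompactSupport.comp_homeomorph (Homeomorph.smulOfNeZero (e n) (e0 n).ne'))
  have fd : ∀ n x, fderiv ℝ (v n) x = χ (e n • x) • fderiv ℝ u x + (u x) • (e n • fderiv ℝ χ (e n • x)) := by
    intro n x
    have h1 : HasFDerivAt (fun x : Eu d => χ (e n • x)) (e n • fderiv ℝ χ (e n • x)) x := by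
      have := (χd (e n • x)).hasFDerivAt.comp x ((hasFDerivAt_id x).const_smul (e n))
      refine this.congr_fderiv ?_
      ext y; simp
    exact (h1.mul ((hu.differentiable Mj) x).hasFDerivAt).fderiv
  have lim : ∀ x, Tendsto (fun n => v n x) atTop (𝓝 (u x)) := fun x => by
    refine Ml ?_
    filter_upwards [ev x] with n hn
    simp only [hvdef]; rw [one _ hn, one_mul]
  refine lim_step hm hq hC ha hb (fun n => (hvC n).continuous) (fun n x => ?_) lim hi
    (γ := fun n => ∫ x, ‖fderiv ℝ (v n) x‖^p) ?_ (integral_nonneg fun x => by positivity) (fun n => H _ (hvC n) (hvs n))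
  · simp only [hvdef]; rw [abs_mul, abs_of_nonneg χ.nonneg]
    exact mul_le_of_le_one_left (Mw _) χ.le_one
  · refine tendsto_integral_of_dominated_convergence (fun x => 2^p * (‖fderiv ℝ u x‖^p + c^p * |u x|^p)) (fun n => ?_) ?_
      (fun n => .of_forall fun x => ?_) (.of_forall fun x => ?_)
    · exact (((hvC n).continuous_fderiv Mj).norm.rpow_const fun x => Or.inr p0.le).aestronglyMeasurable
    · exact (hg.add (hip.const_mul _)).const_mul _
    · rw [Kc PO, ← Kg c0 (Mw _)]
      refine Mm (Ko (norm_nonneg _) ?_ p0.le) (add_pow_le' p0.le (norm_nonneg _) PO)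
      rw [fd]
      refine (norm_add_le _ _).trans (add_le_add ?_ ?_)
      · rw [norm_smul, Kc χ.nonneg]
        exact mul_le_of_le_one_left (norm_nonneg _) χ.le_one
      · rw [norm_smul, norm_smul, Mk, Kc (e0 n).le, mul_comm]
        refine Me ?_ (Mw _)
        calc _ ≤ 1 * c := mul_le_mul (e1 n) (hc _) (norm_nonneg _) one_pos.le
          _ = c := one_mul c
    · refine Tendsto.rpow_const (Tendsto.norm ?_) (Or.inr p0.le)
      refine Ml ?_
      filter_upwards [ev x] with n hn
      have : fderiv ℝ χ (e n • x) = 0 := by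
        have : (χ : Eu d → ℝ) =ᶠ[𝓝 (e n • x)] fun _ => 1 := by
          filter_upwards [(isOpen_lt continuous_norm continuous_const).mem_nhds hn] with y hy using one y hy
        rw [this.fderiv_eq]; simp
      rw [fd, this, one _ hn]; simp

noncomputable def ta (n : ℕ) (t : ℝ) : ℝ := max 0 (min 1 (((n:ℝ)+1) * |t| - 1)) * max 0 (min 1 ((n:ℝ)+1-|t|))

noncomputable def Tr (n : ℕ) (s : ℝ) : ℝ := ∫ t in (0:ℝ)..s, ta n t

lemma ta_cont (n : ℕ) : Continuous (ta n) := by unfold ta; fun_prop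

lemma ta_nonneg (n : ℕ) (t : ℝ) : 0 ≤ ta n t := La (Lf _ _) (Lf _ _)

lemma ta_le (n : ℕ) (t : ℝ) : ‖ta n t‖ ≤ 1 := by
  rw [Kc (ta_nonneg n t)]
  exact mul_le_one₀ (max_le Ly (Lq _ _)) (Lf _ _) (max_le Ly (Lq _ _))

lemma Tr_deriv (n : ℕ) (s : ℝ) : HasDerivAt (Tr n) (ta n s) s :=
  Mg ((ta_cont n).intervalIntegrable _ _)
    (ta_cont n).stronglyMeasurable.stronglyMeasurableAtFilter (ta_cont n).continuousAt

lemma Tr_le (n : ℕ) (s : ℝ) : |Tr n s| ≤ |s| := by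
  have := intervalIntegral.norm_integral_le_of_norm_le_const (a := 0) (b := s) (C := 1) (f := ta n) (fun x _ => ta_le n x)
  simpa [Tr] using this

lemma Tr_zero (n : ℕ) {s : ℝ} (hs : ((n:ℝ)+1) * |s| ≤ 1) : Tr n s = 0 := by
  unfold Tr
  rw [intervalIntegral.integral_congr (g := fun _ => 0)]
  · simp
  · intro t ht
    have h1 : |t| ≤ |s| := by
      have := abs_sub_left_of_mem_uIcc ht
      simpa using this
    have h2 : ((n:ℝ)+1) * |t| ≤ ((n:ℝ)+1) * |s| := by gcongr
    change ta n t = 0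
    rw [ta, max_eq_left, zero_mul]
    exact (Lb _ _).trans LA

lemma Tr_bdd (n : ℕ) : ∃ B, ∀ s, |Tr n s| ≤ B := by
  have hs : HasCompactSupport (ta n) := by
    refine HasCompactSupport.intro (isCompact_Icc (a := -((n:ℝ)+1)) (b := (n:ℝ)+1)) fun x hx => ?_
    have : (n:ℝ)+1 ≤ |x| := by
      by_contra h
      push Not at h
      exact hx ⟨(abs_lt.1 h).1.le, (abs_lt.1 h).2.le⟩
    rw [ta, max_eq_left (b := min 1 ((n:ℝ)+1-|x|)) ((Lb _ _).trans LA), Mn]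
  have hi := ((ta_cont n).integrable_of_hasCompactSupport hs (μ := volume)).norm
  refine ⟨∫ t, ‖ta n t‖, fun s => ?_⟩
  refine (intervalIntegral.norm_integral_le_integral_norm_uIoc (f := ta n) (a := 0) (b := s) (μ := volume)).trans ?_
  exact setIntegral_le_integral hi (.of_forall fun x => norm_nonneg _)

lemma Tr_lim (s : ℝ) : Tendsto (fun n => Tr n s) atTop (𝓝 s) := by
  have : s = ∫ t in (0:ℝ)..s, (1:ℝ) := by simp
  nth_rw 2 [this]
  refine intervalIntegral.tendsto_integral_filter_of_dominated_convergence (fun _ => 1)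
    (.of_forall fun n => (ta_cont n).aestronglyMeasurable) (.of_forall fun n => .of_forall fun t _ => ta_le n t) (by simp) ?_
  have h0 : ∀ᵐ t : ℝ, t ≠ 0 := by simp [ae_iff]
  filter_upwards [h0] with t ht _
  have ht := abs_pos.2 ht
  refine Ml ?_
  obtain ⟨N, hN⟩ := exists_nat_ge (2/|t| + |t|)
  filter_upwards [Lr N] with n hn
  have hn : (N:ℝ) ≤ n := by exact_mod_cast hn
  have h2 : 0 < 2/|t| := by positivity
  have h3 : 2 ≤ (n:ℝ) * |t| := by rw [← Mt ht]; linarith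
  rw [ta, min_eq_left (by nlinarith), min_eq_left LA]; simp

lemma step_two {C a b : ℝ} (hm : 0 < m + 1) (hq : 0 < q + 1) (hp : 1 < p)
    (hC : 0 ≤ C) (ha : 0 < a) (hb : 0 < b)
    (H : ∀ v : Eu d → ℝ, ContDiff ℝ 1 v → HasCompactSupport v →
      (∫ x, |v x|^mJ)^(1/mJ) ≤ C * (∫ x, |v x|^qJ)^a * (∫ x, ‖fderiv ℝ v x‖^p)^b)
    {u : Eu d → ℝ} (hu : ContDiff ℝ 1 u) (hi : Integrable fun x => |u x|^qJ)
    (hg : Integrable fun x => ‖fderiv ℝ u x‖^p) :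
    (∫ x, |u x|^mJ)^(1/mJ) ≤ C * (∫ x, |u x|^qJ)^a * (∫ x, ‖fderiv ℝ u x‖^p)^b := by
  have p0 : 0 < p := by linarith
  have hT : ∀ n, ContDiff ℝ 1 (Tr n) := fun n => by
    rw [contDiff_one_iff_deriv]
    refine ⟨fun s => (Tr_deriv n s).differentiableAt, ?_⟩
    rw [show deriv (Tr n) = ta n from funext fun s => (Tr_deriv n s).deriv]
    exact ta_cont n
  have hv : ∀ n, ContDiff ℝ 1 fun x => Tr n (u x) := fun n => (hT n).comp hu
  have fle : ∀ n x, ‖fderiv ℝ (fun x => Tr n (u x)) x‖ ≤ ‖fderiv ℝ u x‖ := fun n x => by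
    have := (Tr_deriv n (u x)).comp_hasFDerivAt x ((hu.differentiable Mj) x).hasFDerivAt
    change ‖fderiv ℝ (Tr n ∘ u) x‖ ≤ _
    rw [this.fderiv, norm_smul]
    exact mul_le_of_le_one_left (norm_nonneg _) (ta_le _ _)
  have fpm : ∀ n x, ‖fderiv ℝ (fun x => Tr n (u x)) x‖^p ≤ ‖fderiv ℝ u x‖^p := fun n x =>
    Ko (norm_nonneg _) (fle n x) p0.le
  have fi : ∀ n, Integrable fun x => ‖fderiv ℝ (fun x => Tr n (u x)) x‖^p := fun n => by
    refine hg.mono' ?_ (.of_forall fun x => ?_)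
    · exact (((hv n).continuous_fderiv Mj).norm.rpow_const fun x => Or.inr p0.le).aestronglyMeasurable
    · rw [Kc PO]; exact fpm n x
  refine lim_step hm hq hC ha hb (v := fun n x => Tr n (u x)) (fun n => (hv n).continuous) (fun n x => Tr_le _ _)
    (fun x => Tr_lim _) hi (tendsto_const_nhds (x := ∫ x, ‖fderiv ℝ u x‖^p)) (integral_nonneg fun x => by positivity) fun n => ?_
  have i1 : Integrable fun x => |Tr n (u x)|^qJ := by
    refine hi.mono' ((hv n).continuous.abs.rpow_const fun x => Or.inr hq.le).aestronglyMeasurable (.of_forall fun x => ?_)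
    rw [Kc PO]
    exact Ko (Mw _) (Tr_le _ _) hq.le
  have i2 : Integrable fun x => |Tr n (u x)|^p := by
    obtain ⟨B, hB⟩ := Tr_bdd n
    have B0 : 0 ≤ B := (Mw _).trans (hB 0)
    refine (hi.const_mul (B^p * ((n:ℝ)+1)^qJ)).mono'
      ((hv n).continuous.abs.rpow_const fun x => Or.inr p0.le).aestronglyMeasurable (.of_forall fun x => ?_)
    rw [Kc PO]
    by_cases h : ((n:ℝ)+1) * |u x| ≤ 1
    · rw [Tr_zero n h, abs_zero, Kd p0.ne']; positivity
    · rw [Mx, ← Kg PO (Mw _)]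
      push Not at h
      have h1 := Real.one_le_rpow h.le hq.le
      have h2 := Ko (Mw _) (hB (u x)) p0.le
      have h3 : 0 ≤ B^p := by positivity
      exact h2.trans (le_mul_of_one_le_right h3 h1)
  refine (step_one hm hq hp hC ha hb H (hv n) i1 i2 (fi n)).trans ?_
  have : 0 ≤ ∫ x, |Tr n (u x)|^qJ := integral_nonneg fun x => by positivity
  refine Kq ?_ PO
  exact Ko (integral_nonneg fun x => by positivity) (integral_mono (fi n) hg (fpm n)) hb.le

end GN

/-- The L^m-type Gagliardo-Nirenberg inequality
`‖u‖_{m+1} ≤ C ‖u‖_{q+1}^{1-θ} ‖∇u‖_p^θ` on ℝ^d, with the constant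
`C = θ^{-θ/p} (1-θ)^{θ/p - 1/(m+1)} M_c^{-θ/d}` expressed through the radial
nonincreasing solution `u_c` of the generalized Lane-Emden problem
`Δ_p u + u^m = u^q`, `u'(0)=0`; equality is attained on rescalings of `u_c`. -/
theorem stmt14 (d : ℕ) (hd : 1 ≤ d) (p q m θ : ℝ)
    (hp : max 1 (2 * (d : ℝ) / ((d : ℝ) + 2)) < p)
    (hq0 : 0 ≤ q) (hqm : q < m)
    (hsub : p < d → q < ((p - 1) * (d : ℝ) + p) / ((d : ℝ) - p) - 1 ∧
      m < ((p - 1) * (d : ℝ) + p) / ((d : ℝ) - p))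
    (hθ : θ = p * (d : ℝ) * (m - q) /
      ((m + 1) * ((d : ℝ) * (p - q - 1) + p * (q + 1))))
    (uc uc' : ℝ → ℝ)
    (hderivc : ∀ r ∈ Ici (0:ℝ), HasDerivWithinAt uc (uc' r) (Ici 0) r)
    (hcc : ContinuousOn uc' (Ici 0))
    (hnn : ∀ r ∈ Ici (0:ℝ), 0 ≤ uc r)
    (hmono : AntitoneOn uc (Ici 0))
    (h0 : uc' 0 = 0)
    (hlim : Tendsto uc atTop (𝓝 0))
    (hint : IntegrableOn (fun r => r ^ (d - 1) * uc r ^ (q + 1)) (Ioi 0))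
    (hcase :
      ((∀ r : ℝ, 0 ≤ r → 0 < uc r) ∧
        ∀ r ∈ Ioi (0:ℝ),
          HasDerivAt (fun s => s ^ (d - 1) * |uc' s| ^ (p - 2) * uc' s)
            (r ^ (d - 1) * (uc r ^ q - uc r ^ m)) r) ∨
      (∃ R : ℝ, 0 < R ∧ (∀ r ∈ Ico (0:ℝ) R, 0 < uc r) ∧ (∀ r : ℝ, R ≤ r → uc r = 0) ∧
        uc' R = 0 ∧
        ∀ r ∈ Ioo (0:ℝ) R,
          HasDerivAt (fun s => s ^ (d - 1) * |uc' s| ^ (p - 2) * uc' s)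
            (r ^ (d - 1) * (uc r ^ q - uc r ^ m)) r))
    (Mc C : ℝ)
    (hMc : Mc = ∫ x : EuclideanSpace ℝ (Fin d), (uc ‖x‖) ^ (q + 1))
    (hC : C = θ ^ (-(θ / p)) * (1 - θ) ^ (θ / p - 1 / (m + 1)) * Mc ^ (-(θ / d))) :
    (∀ u : EuclideanSpace ℝ (Fin d) → ℝ, ContDiff ℝ 1 u →
      Integrable (fun x => |u x| ^ (q + 1)) →
      Integrable (fun x => ‖fderiv ℝ u x‖ ^ p) →
      (∫ x, |u x| ^ (m + 1)) ^ (1 / (m + 1)) ≤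
        C * (∫ x, |u x| ^ (q + 1)) ^ ((1 - θ) / (q + 1)) *
          (∫ x, ‖fderiv ℝ u x‖ ^ p) ^ (θ / p)) ∧
    (∀ A lam : ℝ, 0 < A → 0 < lam → ∀ x₀ : EuclideanSpace ℝ (Fin d),
      (∫ x, |A * uc (lam * ‖x - x₀‖)| ^ (m + 1)) ^ (1 / (m + 1)) =
        C * (∫ x, |A * uc (lam * ‖x - x₀‖)| ^ (q + 1)) ^ ((1 - θ) / (q + 1)) *
          (∫ x, ‖fderiv ℝ (fun y => A * uc (lam * ‖y - x₀‖)) x‖ ^ p) ^ (θ / p)) := by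
  have P := GN.par_of d hd p q m hp hq0 hqm hsub
  have p1 : 1 < p := (le_max_left _ _).trans_lt hp
  obtain ⟨g, hg, S, hI, hM, hG, hmax⟩ := GN.uc_main P uc uc' hderivc hcc hnn hmono h0 hlim hint hcase
  have hMc' : Mc = GN.kap d * GN.RI d (q+1) uc := by rw [hMc, GN.polar hd (fun r => uc r ^ (q+1))]; rfl
  refine ⟨fun u hu hi hgi => ?_, GN.equality P hθ hnn hg S hI hM hG hMc' hC⟩
  obtain ⟨t1, t2⟩ := GN.const_main P hθ
  have m0 := P.m0
  have q0 := P.q0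
  have p0 := P.p0
  have k0 := GN.kap_pos hd
  have th0 : 0 < θ := by rw [t1]; have := P.b0; positivity
  have T0 : 0 < 1 - θ := by rw [t2]; have := P.a0; positivity
  have M0 : 0 ≤ GN.RI d (q+1) uc := by rw [hM]; have := P.a0; positivity
  have C0 : 0 ≤ C := by rw [hC, hMc']; positivity
  refine GN.step_two m0 q0 p1 C0 (div_pos T0 q0) (div_pos th0 p0) (fun v hv hs => ?_) hu hi hgi
  obtain ⟨h1, w, W, hw⟩ := GN.polya (q := q) hd p1 q0 hv hs
  rw [h1 _ m0, h1 _ q0]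
  exact GN.ineq_of P hθ hI hM hG hMc' hC hmax W hw
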